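/- arXiv:1010.4229 — 13 statements merged into one kernel-verified Lean document; each statement's English description precedes it below -/
import Mathlib

section
/- For every nonempty compact set P ⊆ ℝ^d, every container C ⊆ ℝ^d, and every ε ≥ 0, there exists a subset S ⊆ P with |S| ≤ ⌈d/(1+ε)⌉ + 1 such that R(P,C) ≤ (1+ε)·R(S,C), i.e. S is an ε-core-set of P with respect to C. -/
open Set Pointwise

/-- The C-radius: least ρ ≥ 0 such that P ⊆ c + ρC for some c. -/
noncomputable def cRadius {d : ℕ} (P C : Set (EuclideanSpace ℝ (Fin d))) : ℝ :=
  sInf {ρ : ℝ | 0 ≤ ρ ∧ ∃ c : EuclideanSpace ℝ (Fin d), P ⊆ c +ᵥ ρ • C}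

/-- A container: a compact convex set with 0 in its interior. -/
def IsContainer {d : ℕ} (C : Set (EuclideanSpace ℝ (Fin d))) : Prop :=
  IsCompact C ∧ Convex ℝ C ∧ (0 : EuclideanSpace ℝ (Fin d)) ∈ interior C

theorem aux_exists {d : ℕ} {S C : Set (EuclideanSpace ℝ (Fin d))}
    (hC : IsContainer C) (hS : Bornology.IsBounded S) {ρ : ℝ} (h : cRadius S C < ρ) :
    ∃ c : EuclideanSpace ℝ (Fin d), ∀ x ∈ S, x - c ∈ ρ • C := by
  have h0C : (0 : EuclideanSpace ℝ (Fin d)) ∈ C := interior_subset hC.2.2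
  have hne : {ρ : ℝ | 0 ≤ ρ ∧ ∃ c : EuclideanSpace ℝ (Fin d), S ⊆ c +ᵥ ρ • C}.Nonempty := by
    obtain ⟨r, hr, hrC⟩ := Metric.isOpen_iff.1 isOpen_interior 0 hC.2.2
    obtain ⟨M, hM, hMS⟩ := hS.exists_pos_norm_le
    refine ⟨2 * M / r, by positivity, 0, fun x hx => ?_⟩
    rw [zero_vadd, Set.mem_smul_set_iff_inv_smul_mem₀ (by positivity)]
    apply interior_subset
    apply hrC
    rw [mem_ball_zero_iff, norm_smul, norm_inv, Real.norm_of_nonneg (by positivity)]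
    have := hMS x hx
    rw [inv_mul_lt_iff₀ (by positivity)]
    field_simp
    linarith
  obtain ⟨σ, ⟨hσ0, c, hc⟩, hσ⟩ := exists_lt_of_csInf_lt hne h
  refine ⟨c, fun x hx => ?_⟩
  have h1 := hc hx
  rw [Set.mem_vadd_set_iff_neg_vadd_mem, vadd_eq_add, neg_add_eq_sub] at h1
  have h2 : (ρ • C) = σ • C + (ρ - σ) • C := by
    rw [← hC.2.1.add_smul hσ0 (by linarith)]; congr 1; ring
  rw [h2]
  refine ⟨_, h1, 0, ?_, by simp⟩
  exact ⟨0, h0C, by simp⟩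

theorem aux_le {d : ℕ} {S C : Set (EuclideanSpace ℝ (Fin d))} {ρ : ℝ} (hρ : 0 ≤ ρ)
    (c : EuclideanSpace ℝ (Fin d)) (h : ∀ x ∈ S, x - c ∈ ρ • C) : cRadius S C ≤ ρ := by
  refine csInf_le ⟨0, fun x hx => hx.1⟩ ⟨hρ, c, fun x hx => ?_⟩
  rw [Set.mem_vadd_set_iff_neg_vadd_mem, vadd_eq_add, neg_add_eq_sub]
  exact h x hx

theorem aux_nonneg {d : ℕ} (S C : Set (EuclideanSpace ℝ (Fin d))) : 0 ≤ cRadius S C :=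
  Real.sInf_nonneg fun _ hx => hx.1

theorem aux_cont {d k : ℕ} {C : Set (EuclideanSpace ℝ (Fin d))} (hC : IsContainer C) :
    Continuous fun f : Fin k → EuclideanSpace ℝ (Fin d) => cRadius (range f) C := by
  obtain ⟨r, hr, hrC⟩ := Metric.isOpen_iff.1 isOpen_interior 0 hC.2.2
  have key : LipschitzWith (2 / r).toNNReal
      fun f : Fin k → EuclideanSpace ℝ (Fin d) => cRadius (range f) C := by
    apply LipschitzWith.of_le_add_mul
    intro f g
    rw [Real.coe_toNNReal _ (by positivity)]
    refine le_of_forall_pos_le_add fun η hη => ?_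
    obtain ⟨c, hc⟩ := aux_exists (S := range g) (ρ := cRadius (range g) C + η) hC
      (finite_range g).isBounded (by linarith)
    have hn := aux_nonneg (range g) C
    have hd : 0 ≤ 2 / r * dist f g := by positivity
    have : cRadius (range f) C ≤ (cRadius (range g) C + η) + 2 / r * dist f g := by
      refine aux_le (by linarith) c ?_
      rintro _ ⟨i, rfl⟩
      rw [hC.2.1.add_smul (by linarith) hd]
      refine ⟨_, hc _ ⟨i, rfl⟩, f i - g i, ?_, by simp⟩
      rcases (dist_nonneg (x := f) (y := g)).eq_or_lt with h | h
      · have : f = g := dist_eq_zero.1 h.symm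
        subst this
        exact ⟨0, interior_subset hC.2.2, by simp⟩
      · rw [Set.mem_smul_set_iff_inv_smul_mem₀ (by positivity)]
        apply interior_subset
        apply hrC
        rw [mem_ball_zero_iff, norm_smul, norm_inv, Real.norm_of_nonneg (by positivity)]
        have h3 : ‖f i - g i‖ ≤ dist f g := by
          rw [← dist_eq_norm]; exact dist_le_pi_dist f g i
        rw [inv_mul_lt_iff₀ (by positivity)]
        field_simp
        linarith
    linarith
  exact key.continuous

/-- The averaging step. -/
theorem aux_avg {d k : ℕ} (hk : 0 < k) (hkd : k ≤ d) {C : Set (EuclideanSpace ℝ (Fin d))}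
    (hC : Convex ℝ C) {ρ : ℝ} (p : Fin d → EuclideanSpace ℝ (Fin d))
    (p0 : EuclideanSpace ℝ (Fin d))
    (h : ∀ u : Fin k → EuclideanSpace ℝ (Fin d), (∀ s, u s ∈ range p) →
      ∃ c, p0 - c ∈ ρ • C ∧ ∀ s, u s - c ∈ ρ • C) :
    ∃ c, p0 - c ∈ ((d : ℝ) / k * ρ) • C ∧ ∀ j, p j - c ∈ ((d : ℝ) / k * ρ) • C := by
  have hd : 0 < d := by omega
  have : NeZero d := ⟨by omega⟩
  choose c hc0 hc using fun t : Fin d => h (fun s => p (t + Fin.castLE hkd s)) (fun s => ⟨_, rfl⟩)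
  have hkR : (0 : ℝ) < k := by exact_mod_cast hk
  have hdR : (0 : ℝ) < d := by exact_mod_cast hd
  -- any selection average
  have avg : ∀ q : Fin d → EuclideanSpace ℝ (Fin d), (∀ t, q t - c t ∈ ρ • C) →
      (∑ t, q t) - ∑ t, c t ∈ ((d : ℝ) * ρ) • C := by
    intro q hq
    have h1 := (hC.smul ρ).sum_mem (t := Finset.univ) (w := fun _ : Fin d => (1 : ℝ) / d)
      (z := fun t => q t - c t) (fun _ _ => by positivity)
      (by simp [hdR.ne']) (fun t _ => hq t)
    rw [← Finset.smul_sum, Finset.sum_sub_distrib] at h1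
    rw [mul_smul]
    refine ⟨_, h1, ?_⟩
    simp only [smul_smul]
    rw [mul_one_div_cancel hdR.ne', one_smul]
  refine ⟨(1 / k : ℝ) • ((∑ t, c t) - ((d : ℝ) - k) • p0), ?_, fun j => ?_⟩
  · obtain ⟨y, hy, hy'⟩ := avg (fun _ => p0) hc0
    refine ⟨y, hy, ?_⟩
    have : ((d : ℝ) / k * ρ) • y = (1 / k : ℝ) • (((d : ℝ) * ρ) • y) := by
      rw [smul_smul]; congr 1; ring
    simp only at hy' ⊢
    rw [this, hy']
    simp only [Finset.sum_const, Finset.card_univ, Fintype.card_fin, ← Nat.cast_smul_eq_nsmul ℝ]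
    match_scalars <;> field_simp
    ring
  · obtain ⟨y, hy, hy'⟩ := avg (fun t => if (j - t).val < k then p j else p0) (by
      intro t
      split_ifs with hlt
      · have := hc t ⟨_, hlt⟩
        have e : t + Fin.castLE hkd ⟨(j - t).val, hlt⟩ = j := by
          have : Fin.castLE hkd ⟨(j - t).val, hlt⟩ = j - t := by ext; rfl
          rw [this]; abel
        rwa [e] at this
      · exact hc0 t)
    have hsum : (∑ t : Fin d, if (j - t).val < k then p j else p0)
        = (k : ℝ) • p j + ((d : ℝ) - k) • p0 := by
      refine ((Equiv.subLeft j).sum_comp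
        (fun s : Fin d => if s.val < k then p j else p0)).trans ?_
      rw [Fin.sum_univ_eq_sum_range (fun s => if s < k then p j else p0) d]
      rw [← Finset.sum_range_add_sum_Ico _ hkd]
      rw [Finset.sum_congr rfl (g := fun _ => p j)
        (fun x hx => if_pos (Finset.mem_range.1 hx))]
      rw [Finset.sum_congr (s₁ := Finset.Ico k d) rfl (g := fun _ => p0)
        (fun x hx => if_neg (by have := Finset.mem_Ico.1 hx; omega))]
      simp only [Finset.sum_const, Finset.card_range, Nat.card_Ico, ← Nat.cast_smul_eq_nsmul ℝ,
        Nat.cast_sub hkd]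
    rw [hsum] at hy'
    refine ⟨y, hy, ?_⟩
    have : ((d : ℝ) / k * ρ) • y = (1 / k : ℝ) • (((d : ℝ) * ρ) • y) := by
      rw [smul_smul]; congr 1; ring
    simp only at hy' ⊢
    rw [this, hy']
    match_scalars <;> field_simp

theorem coreset_exists_general {d : ℕ} (P C : Set (EuclideanSpace ℝ (Fin d)))
    (hPne : P.Nonempty) (hPcomp : IsCompact P) (hC : IsContainer C)
    (ε : ℝ) (hε : 0 ≤ ε) :
    ∃ S : Set (EuclideanSpace ℝ (Fin d)), S ⊆ P ∧ S.Finite ∧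
      S.ncard ≤ ⌈(d : ℝ) / (1 + ε)⌉₊ + 1 ∧
      cRadius P C ≤ (1 + ε) * cRadius S C := by
  obtain ⟨x0, hx0⟩ := hPne
  rcases Nat.eq_zero_or_pos d with rfl | hd
  · refine ⟨{x0}, by simpa using hx0, finite_singleton _, by simp, ?_⟩
    refine le_trans (aux_le le_rfl 0 fun x hx => ?_)
      (mul_nonneg (by linarith) (aux_nonneg _ _))
    exact ⟨0, interior_subset hC.2.2, Subsingleton.elim _ _⟩
  have hdR : (0 : ℝ) < d := by exact_mod_cast hd
  set k := ⌈(d : ℝ) / (1 + ε)⌉₊ with hkdef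
  have hk : 0 < k := Nat.ceil_pos.2 (by positivity)
  have hkd : k ≤ d := Nat.ceil_le.2 (div_le_self hdR.le (by linarith))
  have hkR : (0 : ℝ) < k := by exact_mod_cast hk
  have hratio : (d : ℝ) / k ≤ 1 + ε := by
    have := Nat.le_ceil ((d : ℝ) / (1 + ε))
    rw [← hkdef, div_le_iff₀ (by linarith)] at this
    rw [div_le_iff₀ hkR]; linarith
  obtain ⟨f, hfP, hf⟩ := (isCompact_univ_pi (fun _ : Fin (k + 1) => hPcomp)).exists_isMaxOn
    ⟨fun _ => x0, by simp [hx0]⟩ (aux_cont hC).continuousOn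
  have hfP' : ∀ i, f i ∈ P := by simpa using hfP
  refine ⟨range f, by rintro _ ⟨i, rfl⟩; exact hfP' i, finite_range f, ?_, ?_⟩
  · have := Set.ncard_image_le (f := f) (s := univ) finite_univ
    simpa [Set.ncard_univ] using this
  set R := cRadius (range f) C with hR
  have hR0 : 0 ≤ R := aux_nonneg _ _
  suffices hs : ∀ ρ, R < ρ → cRadius P C ≤ (1 + ε) * ρ by
    refine le_of_forall_pos_le_add fun η hη => ?_
    have := hs (R + η / (1 + ε)) (by have : 0 < η / (1 + ε) := by positivity
                                     linarith)
    rwa [mul_add, mul_div_cancel₀ _ (by linarith)] at this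
  intro ρ hρ
  have hρ0 : 0 < ρ := by linarith
  have hτ : 0 ≤ (d : ℝ) / k * ρ := by positivity
  refine le_trans ?_ (mul_le_mul_of_nonneg_right hratio hρ0.le)
  have helly : (⋂ x : P, {c | (x : EuclideanSpace ℝ (Fin d)) - c ∈ ((d : ℝ) / k * ρ) • C}).Nonempty := by
    have e : ∀ x : P, {c | (x : EuclideanSpace ℝ (Fin d)) - c ∈ ((d : ℝ) / k * ρ) • C}
        = (x : EuclideanSpace ℝ (Fin d)) +ᵥ -(((d : ℝ) / k * ρ) • C) := by
      intro x
      ext c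
      rw [Set.mem_vadd_set_iff_neg_vadd_mem, vadd_eq_add, Set.mem_neg, mem_setOf_eq]
      congr! 1
      abel
    apply Convex.helly_theorem_compact' (𝕜 := ℝ)
    · intro x
      rw [e]
      exact ((hC.2.1.smul _).neg).vadd _
    · intro x
      rw [e]
      exact ((hC.1.smul _).neg).vadd _
    · intro I hI
      rw [finrank_euclideanSpace_fin] at hI
      rcases I.eq_empty_or_nonempty with rfl | hIne
      · simp
      have : Nonempty I := hIne.to_subtype
      obtain ⟨emb⟩ : Nonempty (I ↪ Fin (d + 1)) :=
        Function.Embedding.nonempty_of_card_le (by simpa using hI)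
      have hsurj := Function.invFun_surjective emb.injective
      set g := Function.invFun emb
      obtain ⟨c, hc0, hc⟩ := aux_avg (ρ := ρ) hk hkd hC.2.1
        (fun j => ((g j.succ : P) : EuclideanSpace ℝ (Fin d))) (g 0 : P) (by
          intro u hu
          have hmem : Fin.cons ((g 0 : P) : EuclideanSpace ℝ (Fin d)) u ∈
              univ.pi (fun _ : Fin (k + 1) => P) := by
            intro i _
            refine Fin.cases ?_ (fun s => ?_) i
            · exact (g 0 : P).2
            · obtain ⟨j, hj⟩ := hu s
              rw [Fin.cons_succ, ← hj]
              exact (g j.succ : P).2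
          have hle := hf hmem
          obtain ⟨c, hc⟩ := aux_exists hC (finite_range _).isBounded (lt_of_le_of_lt hle hρ)
          exact ⟨c, hc _ ⟨0, rfl⟩, fun s => hc _ ⟨s.succ, by simp⟩⟩)
      refine ⟨c, mem_iInter₂.2 fun x hx => ?_⟩
      obtain ⟨j, hj⟩ := hsurj ⟨x, hx⟩
      have hj' : (g j : P) = x := by rw [hj]
      rw [← hj']
      refine Fin.cases ?_ (fun s => ?_) j
      · exact hc0
      · exact hc s
  obtain ⟨c, hc⟩ := helly
  refine aux_le hτ c fun x hx => ?_
  exact mem_iInter.1 hc ⟨x, hx⟩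
end

section
/- Let T^d denote a regular d-simplex in ℝ^d with centroid at the origin, and take P = T^d and C = −T^d. Then for every ε ≥ 0, every natural number k with k < d/(1+ε), and every subset S ⊆ T^d with |S| ≤ k+1, one has R(T^d, −T^d) > (1+ε)·R(S, −T^d); in particular no subset of T^d of fewer than ⌈d/(1+ε)⌉ + 1 points is an ε-core-set of T^d with respect to −T^d. -/
open Set Pointwise

/-- `v` lists the vertices of a regular `d`-simplex in `ℝ^d` with centroid at the origin:
affinely independent, pairwise equidistant points summing to zero. -/
def IsRegularSimplexCentered {d : ℕ} (v : Fin (d + 1) → EuclideanSpace ℝ (Fin d)) : Prop :=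
  AffineIndependent ℝ v ∧ (∃ r : ℝ, 0 < r ∧ ∀ i j, i ≠ j → dist (v i) (v j) = r) ∧
    ∑ i, v i = 0

theorem aux_mem_translate {d : ℕ} (T : Set (EuclideanSpace ℝ (Fin d))) (hT : Convex ℝ T)
    (F : Finset (EuclideanSpace ℝ (Fin d))) (hF : ∀ x ∈ F, x ∈ T)
    (x : EuclideanSpace ℝ (Fin d)) (hx : x ∈ F) :
    x ∈ (∑ y ∈ F, y) +ᵥ ((F.card : ℝ) - 1) • (-T) := by
  classical
  have hc : ((F.erase x).card : ℝ) = (F.card : ℝ) - 1 := by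
    have := Finset.card_erase_add_one hx
    rw [← this]; push_cast; ring
  have hs := Finset.add_sum_erase F (fun y => y) hx
  have key : ∃ t ∈ T, ((F.card : ℝ) - 1) • t = ∑ y ∈ F.erase x, y := by
    rw [← hc]
    rcases (F.erase x).eq_empty_or_nonempty with h | h
    · exact ⟨x, hF x hx, by simp [h]⟩
    · have hpos : (0 : ℝ) < (F.erase x).card := by exact_mod_cast h.card_pos
      refine ⟨∑ y ∈ F.erase x, ((F.erase x).card : ℝ)⁻¹ • y, ?_, ?_⟩
      · apply hT.sum_mem
        · intro i _; positivity
        · rw [Finset.sum_const, nsmul_eq_mul, mul_inv_cancel₀ hpos.ne']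
        · intro i hi; exact hF i (Finset.mem_of_mem_erase hi)
      · rw [← Finset.smul_sum, smul_inv_smul₀ hpos.ne']
  obtain ⟨t, ht, hts⟩ := key
  refine ⟨((F.card : ℝ) - 1) • (-t), ⟨-t, by simpa using ht, rfl⟩, ?_⟩
  simp only [vadd_eq_add, smul_neg]
  rw [hts, ← hs]
  abel

theorem aux_lower {d : ℕ}
    (v : Fin (d + 1) → EuclideanSpace ℝ (Fin d)) (hv : AffineIndependent ℝ v)
    (ρ : ℝ) (hρ : 0 ≤ ρ) (c : EuclideanSpace ℝ (Fin d))
    (h : ∀ i, v i ∈ c +ᵥ ρ • (-(convexHull ℝ (Set.range v)))) : (d : ℝ) ≤ ρ := by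
  have htop : affineSpan ℝ (Set.range v) = ⊤ := by
    rw [hv.affineSpan_eq_top_iff_card_eq_finrank_add_one]; simp
  let B : AffineBasis (Fin (d + 1)) ℝ (EuclideanSpace ℝ (Fin d)) := ⟨v, hv, htop⟩
  have hdec : ∀ i x, B.coord i x = (B.coord i).linear x + B.coord i 0 := by
    intro i x
    have := (B.coord i).map_vadd 0 x
    simpa using this
  have h0 : ∑ i, B.coord i 0 = 1 := B.sum_coord_apply_eq_one 0
  have hL : ∑ i, (B.coord i).linear c = 0 := by
    have h1 := B.sum_coord_apply_eq_one c
    simp_rw [hdec _ c] at h1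
    rw [Finset.sum_add_distrib, h0] at h1
    linarith
  have hi : ∀ i, 1 - B.coord i 0 - ρ * B.coord i 0 ≤ (B.coord i).linear c := by
    intro i
    obtain ⟨_, ⟨t, ht, rfl⟩, hvt⟩ := h i
    have ht' : 0 ≤ B.coord i (-t) := by
      have : -t ∈ convexHull ℝ (Set.range B) := ht
      rw [B.convexHull_eq_nonneg_coord] at this
      exact this i
    have hvi : B.coord i (v i) = 1 := B.coord_apply_eq i
    rw [hdec] at hvi ht'
    rw [← hvt] at hvi
    simp only [vadd_eq_add, map_add, map_smul, smul_eq_mul, map_neg] at hvi ht'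
    nlinarith [mul_nonneg hρ ht']
  have hsum := Finset.sum_le_sum (fun i (_ : i ∈ Finset.univ) => hi i)
  rw [hL, Finset.sum_sub_distrib, Finset.sum_sub_distrib, ← Finset.mul_sum, h0] at hsum
  simp at hsum
  linarith

theorem no_sublinear_coresets_simplex {d : ℕ}
    (v : Fin (d + 1) → EuclideanSpace ℝ (Fin d)) (hv : IsRegularSimplexCentered v)
    (T : Set (EuclideanSpace ℝ (Fin d))) (hT : T = convexHull ℝ (Set.range v))
    (ε : ℝ) (hε : 0 ≤ ε) (k : ℕ) (hk : (k : ℝ) < (d : ℝ) / (1 + ε))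
    (S : Set (EuclideanSpace ℝ (Fin d))) (hSP : S ⊆ T) (hSfin : S.Finite)
    (hScard : S.ncard ≤ k + 1) :
    cRadius T (-T) > (1 + ε) * cRadius S (-T) := by
  classical
  obtain ⟨hind, -, -⟩ := hv
  have hconv : Convex ℝ T := hT ▸ convex_convexHull ℝ _
  have hvT : ∀ i, v i ∈ T := fun i => hT ▸ subset_convexHull ℝ _ ⟨i, rfl⟩
  have hlow : (d : ℝ) ≤ cRadius T (-T) := by
    apply le_csInf
    · let F := Finset.univ.image v
      have hF : ∀ x ∈ F, x ∈ T := by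
        intro x hx
        obtain ⟨i, -, rfl⟩ := Finset.mem_image.1 hx
        exact hvT i
      have hpos : 1 ≤ F.card := Finset.card_pos.2 ⟨v 0, Finset.mem_image_of_mem v (Finset.mem_univ 0)⟩
      refine ⟨(F.card : ℝ) - 1, ?_, ∑ y ∈ F, y, ?_⟩
      · have : (1 : ℝ) ≤ F.card := by exact_mod_cast hpos
        linarith
      · have hC : Convex ℝ ((∑ y ∈ F, y) +ᵥ ((F.card : ℝ) - 1) • (-T)) :=
          (hconv.neg.smul _).vadd _
        have hsub : Set.range v ⊆ (∑ y ∈ F, y) +ᵥ ((F.card : ℝ) - 1) • (-T) := by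
          rintro _ ⟨i, rfl⟩
          exact aux_mem_translate T hconv F hF _ (Finset.mem_image_of_mem v (Finset.mem_univ i))
        have := convexHull_min hsub hC
        rwa [← hT] at this
    · rintro ρ ⟨hρ, c, hc⟩
      exact aux_lower v hind ρ hρ c (fun i => by rw [← hT]; exact hc (hvT i))
  have hbdd : BddBelow {ρ : ℝ | 0 ≤ ρ ∧ ∃ c : EuclideanSpace ℝ (Fin d), S ⊆ c +ᵥ ρ • (-T)} :=
    ⟨0, fun ρ h => h.1⟩
  have hup : cRadius S (-T) ≤ k := by
    rcases S.eq_empty_or_nonempty with hS | hS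
    · refine (csInf_le hbdd ⟨le_refl 0, 0, by simp [hS]⟩).trans (Nat.cast_nonneg k)
    · have hcard : S.ncard = hSfin.toFinset.card := Set.ncard_eq_toFinset_card S hSfin
      have hpos : 1 ≤ hSfin.toFinset.card := Finset.card_pos.2 (by simpa using hS)
      have h1 : (1 : ℝ) ≤ hSfin.toFinset.card := by exact_mod_cast hpos
      have h2 : (hSfin.toFinset.card : ℝ) ≤ k + 1 := by rw [← hcard]; exact_mod_cast hScard
      refine (csInf_le hbdd (a := (hSfin.toFinset.card : ℝ) - 1)
        ⟨by linarith, ∑ y ∈ hSfin.toFinset, y, ?_⟩).trans (by linarith)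
      intro x hx
      exact aux_mem_translate T hconv _ (fun y hy => hSP (by simpa using hy)) x (by simpa using hx)
  have hε1 : 0 < 1 + ε := by linarith
  rw [lt_div_iff₀ hε1] at hk
  nlinarith [mul_le_mul_of_nonneg_left hup hε1.le]
end

section
/- Let T^d denote a regular d-simplex in ℝ^d with centroid at the origin, and let C = T^d ∩ (−T^d), which is a 0-symmetric container. Then for every ε with 0 ≤ ε < 1, every dimension d with 2d/(d+1) > 1+ε, every natural number k with k < d/(1+ε), and every subset S ⊆ T^d with |S| ≤ k+1, one has R(T^d, C) > (1+ε)·R(S, C); in particular, even for 0-symmetric containers, ε-core-sets may need to have at least ⌈d/(1+ε)⌉ + 1 points. -/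
open Set Pointwise

lemma aux_coords {d : ℕ}
    (v : Fin (d + 1) → EuclideanSpace ℝ (Fin d)) (hv : IsRegularSimplexCentered v) :
    ∃ L : Fin (d + 1) → (EuclideanSpace ℝ (Fin d) →ₗ[ℝ] ℝ),
      (convexHull ℝ (Set.range v) = {x | ∀ i, 0 ≤ L i x + 1 / ((d : ℝ) + 1)}) ∧
      (∀ x, ∑ i, L i x = 0) ∧
      (∀ i, L i (v i) = 1 - 1 / ((d : ℝ) + 1)) ∧
      (∀ γ : Fin (d + 1) → ℝ, ∑ i, γ i = 1 → ∃ c, ∀ i, L i c = γ i - 1 / ((d : ℝ) + 1)) := by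
  obtain ⟨hind, -, hsum⟩ := hv
  have htop : affineSpan ℝ (Set.range v) = ⊤ := by
    rw [hind.affineSpan_eq_top_iff_card_eq_finrank_add_one]
    simp
  let b : AffineBasis (Fin (d + 1)) ℝ (EuclideanSpace ℝ (Fin d)) := ⟨v, hind, htop⟩
  have hb : ∀ i, b i = v i := fun i => rfl
  have hcomb : ∀ γ : Fin (d + 1) → ℝ, ∑ i, γ i = 1 → ∀ i, b.coord i (∑ j, γ j • v j) = γ i := by
    intro γ hγ i
    have h := b.coord_apply_combination_of_mem (Finset.mem_univ i) (w := γ) hγ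
    rwa [Finset.affineCombination_eq_linear_combination _ _ _ hγ] at h
  have hd : (d : ℝ) + 1 ≠ 0 := by positivity
  have h0 : ∀ i, b.coord i 0 = 1 / ((d : ℝ) + 1) := by
    intro i
    have h := hcomb (fun _ => 1 / ((d : ℝ) + 1)) (by simp; field_simp) i
    rwa [← Finset.smul_sum, hsum, smul_zero] at h
  have hL : ∀ i x, (b.coord i).linear x = b.coord i x - 1 / ((d : ℝ) + 1) := by
    intro i x
    have := (b.coord i).linearMap_vsub x 0
    rw [h0] at this
    simpa using this
  refine ⟨fun i => (b.coord i).linear, ?_, ?_, ?_, ?_⟩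
  · have h := b.convexHull_eq_nonneg_coord
    have hr : Set.range b = Set.range v := rfl
    rw [hr] at h
    rw [h]
    ext x
    simp only [hL, sub_add_cancel]
  · intro x
    simp only [hL, Finset.sum_sub_distrib, b.sum_coord_apply_eq_one]
    simp
    field_simp
    simp
  · intro i
    rw [hL, ← hb, b.coord_apply_eq]
  · intro γ hγ
    exact ⟨∑ j, γ j • v j, fun i => by rw [hL, hcomb γ hγ]⟩

theorem no_sublinear_coresets_symmetric {d : ℕ}
    (v : Fin (d + 1) → EuclideanSpace ℝ (Fin d)) (hv : IsRegularSimplexCentered v)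
    (T C : Set (EuclideanSpace ℝ (Fin d))) (hT : T = convexHull ℝ (Set.range v))
    (hC : C = T ∩ (-T))
    (ε : ℝ) (hε₀ : 0 ≤ ε) (hε₁ : ε < 1)
    (hd : 2 * (d : ℝ) / ((d : ℝ) + 1) > 1 + ε)
    (k : ℕ) (hk : (k : ℝ) < (d : ℝ) / (1 + ε))
    (S : Set (EuclideanSpace ℝ (Fin d))) (hSP : S ⊆ T) (hSfin : S.Finite)
    (hScard : S.ncard ≤ k + 1) :
    cRadius T C > (1 + ε) * cRadius S C := by
  obtain ⟨L, hLT, hLsum, hLv, hLc⟩ := aux_coords v hv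
  rw [← hT] at hLT
  have hvT : ∀ i, v i ∈ T := fun i => hT ▸ subset_convexHull ℝ _ ⟨i, rfl⟩
  have hd1 : (1 : ℝ) ≤ d := by
    rcases Nat.eq_zero_or_pos d with h | h
    · subst h; simp at hd; linarith
    · exact_mod_cast h
  set n : ℝ := (d : ℝ) + 1 with hn
  have hnpos : 0 < n := by positivity
  have hinv : 1 / n * n = 1 := by field_simp
  have hTm : ∀ x, x ∈ T ↔ ∀ i, 0 ≤ L i x + 1 / n := fun x => by rw [hLT]; rfl
  have hCm : ∀ x, x ∈ C ↔ ∀ i, |L i x| ≤ 1 / n := by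
    intro x
    rw [hC, Set.mem_inter_iff, Set.mem_neg, hTm, hTm, ← forall_and]
    refine forall_congr' fun i => ?_
    rw [map_neg, abs_le]
    constructor
    · rintro ⟨h1, h2⟩; constructor <;> linarith
    · rintro ⟨h1, h2⟩; constructor <;> linarith
  have hfwd : ∀ ρ : ℝ, 0 ≤ ρ → ∀ c p, p ∈ c +ᵥ ρ • C → ∀ i, |L i p - L i c| ≤ ρ / n := by
    intro ρ hρ c p hp i
    obtain ⟨y, ⟨z, hz, rfl⟩, rfl⟩ := hp
    have := (hCm z).1 hz i
    simp only [vadd_eq_add, map_add, map_smul, smul_eq_mul, add_sub_cancel_left, abs_mul,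
      abs_of_nonneg hρ]
    calc ρ * |L i z| ≤ ρ * (1 / n) := by gcongr
      _ = ρ / n := by ring
  have hbwd : ∀ ρ : ℝ, 0 < ρ → ∀ c p, (∀ i, |L i p - L i c| ≤ ρ / n) → p ∈ c +ᵥ ρ • C := by
    intro ρ hρ c p h
    refine ⟨p - c, ⟨ρ⁻¹ • (p - c), (hCm _).2 fun i => ?_, ?_⟩, ?_⟩
    · simp only [map_smul, map_sub, smul_eq_mul, abs_mul, abs_of_pos (inv_pos.2 hρ)]
      calc ρ⁻¹ * |L i p - L i c| ≤ ρ⁻¹ * (ρ / n) := by gcongr; exact h i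
        _ = 1 / n := by field_simp
    · simp [smul_smul, hρ.ne']
    · simp
  have hTle : ∀ p ∈ T, ∀ i, L i p + 1 / n ≤ 1 := by
    intro p hp i
    have h1 : ∑ j, (L j p + 1 / n) = 1 := by
      rw [Finset.sum_add_distrib, hLsum]
      simp [hn]
      field_simp
    exact (Finset.single_le_sum (f := fun j => L j p + 1 / n)
      (fun j _ => (hTm p).1 hp j) (Finset.mem_univ i)).trans h1.le
  -- lower bound for T
  have hTR : (d : ℝ) ≤ cRadius T C := by
    refine le_csInf ⟨d, by positivity, 0, fun p hp => hbwd d (by linarith) 0 p fun i => ?_⟩ ?_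
    · have h1 := hTle p hp i
      have h2 := (hTm p).1 hp i
      have h3 : (d : ℝ) / n = 1 - 1 / n := by rw [hn]; field_simp; ring
      have h4 : 1 / n ≤ (d : ℝ) / n := by gcongr
      rw [map_zero, sub_zero, abs_le]
      constructor <;> linarith
    · rintro ρ ⟨hρ, c, hc⟩
      have h : ∀ i, (1 - 1 / n) - L i c ≤ ρ / n := fun i => by
        have := (abs_le.1 (hfwd ρ hρ c (v i) (hc (hvT i)) i)).2
        rwa [hLv] at this
      have h2 := Finset.sum_le_sum (s := Finset.univ) fun i _ => h i
      rw [Finset.sum_sub_distrib, hLsum] at h2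
      simp only [Finset.sum_const, Finset.card_univ, Fintype.card_fin, nsmul_eq_mul] at h2
      push_cast at h2
      rw [← hn, mul_div_cancel₀ _ hnpos.ne'] at h2
      linarith [mul_sub n 1 (1 / n), mul_comm n (1 / n)]
  -- upper bound for S
  have hSR : ∀ ρ : ℝ, (k : ℝ) ≤ ρ → n / 2 ≤ ρ → cRadius S C ≤ ρ := by
    intro ρ hkρ hnρ
    have hρ1 : 1 ≤ ρ := by linarith
    have hr : 1 / 2 ≤ ρ / n := by rw [le_div_iff₀ hnpos]; linarith
    set F := hSfin.toFinset with hF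
    have hFc : (F.card : ℝ) ≤ k + 1 := by
      rw [Set.ncard_eq_toFinset_card S hSfin] at hScard
      exact_mod_cast hScard
    let l : Fin (d + 1) → EuclideanSpace ℝ (Fin d) → ℝ := fun i p => L i p + 1 / n
    have hl0 : ∀ p ∈ S, ∀ i, 0 ≤ l i p := fun p hp i => (hTm p).1 (hSP hp) i
    let M : Fin (d + 1) → ℝ := fun i => min 1 (∑ p ∈ F, l i p)
    have hM1 : ∀ i, M i ≤ 1 := fun i => min_le_left _ _
    have hMl : ∀ p ∈ S, ∀ i, l i p ≤ M i := by
      intro p hp i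
      refine le_min (hTle p (hSP hp) i) ?_
      exact Finset.single_le_sum (f := fun q => l i q)
        (fun q hq => hl0 q (by simpa [hF] using hq) i) (by simpa [hF] using hp)
    have hlsum : ∀ p, ∑ i, l i p = 1 := by
      intro p
      simp only [l]
      rw [Finset.sum_add_distrib, hLsum]
      simp [hn]
      field_simp
    have hMs : ∑ i, M i ≤ k + 1 := by
      calc ∑ i, M i ≤ ∑ i, ∑ p ∈ F, l i p := Finset.sum_le_sum fun i _ => min_le_right _ _
        _ = F.card := by rw [Finset.sum_comm]; simp [hlsum]
        _ ≤ _ := hFc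
    have hsr : ∑ _i : Fin (d + 1), ρ / n = ρ := by
      simp [hn]
      field_simp
    have hA : ∑ i, (M i - ρ / n) ≤ 1 := by
      rw [Finset.sum_sub_distrib, hsr]; linarith
    obtain ⟨γ, hγ1, hγl, hγu⟩ : ∃ γ : Fin (d + 1) → ℝ, ∑ i, γ i = 1 ∧
        (∀ i, M i - ρ / n ≤ γ i) ∧ ∀ i, γ i ≤ ρ / n := by
      have hLU : ∀ i, M i - ρ / n ≤ ρ / n := fun i => by linarith [hM1 i]
      have hcont : ContinuousOn (fun t : ℝ => ∑ i, ((1 - t) * (M i - ρ / n) + t * (ρ / n)))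
          (Set.Icc 0 1) := by fun_prop
      obtain ⟨t, ⟨ht0, ht1⟩, ht⟩ := intermediate_value_Icc zero_le_one hcont
        (show (1 : ℝ) ∈ _ from ⟨by simpa using hA, by
          simp only [sub_self, zero_mul, one_mul, zero_add, hsr]; exact hρ1⟩)
      refine ⟨_, ht, fun i => ?_, fun i => ?_⟩
      · nlinarith [hLU i]
      · nlinarith [hLU i]
    obtain ⟨c, hc⟩ := hLc γ hγ1
    refine csInf_le ⟨0, fun x hx => hx.1⟩ ⟨by linarith, c, fun p hp => ?_⟩
    refine hbwd ρ (by linarith) c p fun i => ?_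
    have h1 := hl0 p hp i
    have h2 := hMl p hp i
    have h3 := hγl i
    have h4 := hγu i
    simp only [l] at h1 h2
    rw [hc, abs_le]
    constructor <;> linarith
  have h1e : 0 < 1 + ε := by linarith
  have hlt : max (k : ℝ) (n / 2) < d / (1 + ε) := by
    refine max_lt hk ?_
    rw [gt_iff_lt, lt_div_iff₀ hnpos] at hd
    rw [lt_div_iff₀ h1e]
    linarith
  have := (hSR _ (le_max_left _ _) (le_max_right _ _)).trans_lt hlt
  rw [lt_div_iff₀ h1e] at this
  linarith
end

section
/- For every nonempty compact set P ⊆ ℝ^d and every ε > 0, there exists a subset S ⊆ P with |S| ≤ ⌈1/(2ε+ε²)⌉ + 1 such that R(P, B^d) ≤ (1+ε)·R(S, B^d), where B^d is the Euclidean unit ball; i.e. the minimal enclosing ball problem admits ε-core-sets of size at most ⌈1/(2ε+ε²)⌉ + 1, independent of the dimension d. -/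
open Set Pointwise

section Helpers

open Filter Topology

theorem meb_subset_iff {d : ℕ} (P : Set (EuclideanSpace ℝ (Fin d)))
    (c : EuclideanSpace ℝ (Fin d)) {ρ : ℝ} (hρ : 0 ≤ ρ) :
    P ⊆ c +ᵥ ρ • Metric.closedBall (0 : EuclideanSpace ℝ (Fin d)) 1 ↔ ∀ p ∈ P, ‖p - c‖ ≤ ρ := by
  have h : c +ᵥ ρ • Metric.closedBall (0 : EuclideanSpace ℝ (Fin d)) 1
      = Metric.closedBall c ρ := by
    rw [smul_closedBall ρ 0 zero_le_one, Metric.vadd_closedBall]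
    simp [abs_of_nonneg hρ]
  rw [h]
  constructor
  · intro h p hp
    have := h hp
    rwa [Metric.mem_closedBall, dist_eq_norm] at this
  · intro h p hp
    rw [Metric.mem_closedBall, dist_eq_norm]
    exact h p hp

theorem meb_radius_le {d : ℕ} (P : Set (EuclideanSpace ℝ (Fin d)))
    (c : EuclideanSpace ℝ (Fin d)) {ρ : ℝ} (hρ : 0 ≤ ρ) (h : ∀ p ∈ P, ‖p - c‖ ≤ ρ) :
    cRadius P (Metric.closedBall (0 : EuclideanSpace ℝ (Fin d)) 1) ≤ ρ :=
  csInf_le ⟨0, fun _ hx => hx.1⟩ ⟨hρ, c, (meb_subset_iff P c hρ).2 h⟩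

theorem meb_le_radius {d : ℕ} (P : Set (EuclideanSpace ℝ (Fin d))) (hP : Bornology.IsBounded P)
    {a : ℝ} (h : ∀ ρ : ℝ, 0 ≤ ρ → ∀ c, (∀ p ∈ P, ‖p - c‖ ≤ ρ) → a ≤ ρ) :
    a ≤ cRadius P (Metric.closedBall (0 : EuclideanSpace ℝ (Fin d)) 1) := by
  apply le_csInf
  · obtain ⟨r, hr⟩ := hP.exists_norm_le
    refine ⟨max r 0, le_max_right _ _, 0, (meb_subset_iff P 0 (le_max_right _ _)).2 ?_⟩
    intro p hp
    rw [sub_zero]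
    exact (hr p hp).trans (le_max_left _ _)
  · rintro ρ ⟨hρ, c, hc⟩
    exact h ρ hρ c ((meb_subset_iff P c hρ).1 hc)

/-- Existence of a center. -/
theorem meb_center {d : ℕ} (P : Set (EuclideanSpace ℝ (Fin d)))
    (hPne : P.Nonempty) (hP : Bornology.IsBounded P) :
    ∃ c, ∀ p ∈ P, ‖p - c‖ ≤ cRadius P (Metric.closedBall (0 : EuclideanSpace ℝ (Fin d)) 1) := by
  set R := cRadius P (Metric.closedBall (0 : EuclideanSpace ℝ (Fin d)) 1) with hR
  have key : ∀ n : ℕ, ∃ c, ∀ p ∈ P, ‖p - c‖ ≤ R + 1 / ((n : ℝ) + 1) := by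
    intro n
    by_contra hcon
    push Not at hcon
    have h1 : R + 1 / ((n : ℝ) + 1) ≤ R := by
      apply meb_le_radius P hP
      intro ρ _ c hc
      obtain ⟨p, hp, hlt⟩ := hcon c
      exact (hlt.trans_le (hc p hp)).le
    have : 0 < 1 / ((n : ℝ) + 1) := by positivity
    linarith
  choose u hu using key
  obtain ⟨p₀, hp₀⟩ := hPne
  have hub : ∀ n, u n ∈ Metric.closedBall p₀ (R + 1) := by
    intro n
    rw [Metric.mem_closedBall, dist_comm, dist_eq_norm]
    refine (hu n p₀ hp₀).trans ?_
    have : 1 / ((n : ℝ) + 1) ≤ 1 := by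
      rw [div_le_one (by positivity)]
      linarith [Nat.cast_nonneg (α := ℝ) n]
    linarith
  obtain ⟨c, _, φ, hφ, hlim⟩ := (isCompact_closedBall p₀ (R + 1)).tendsto_subseq hub
  refine ⟨c, fun p hp => ?_⟩
  have h1 : Tendsto (fun n => ‖p - (u ∘ φ) n‖) atTop (𝓝 ‖p - c‖) :=
    (tendsto_const_nhds.sub hlim).norm
  have h2 : Tendsto (fun n => R + 1 / ((φ n : ℝ) + 1)) atTop (𝓝 (R + 0)) :=
    tendsto_const_nhds.add (tendsto_one_div_add_atTop_nhds_zero_nat.comp hφ.tendsto_atTop)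
  rw [add_zero] at h2
  exact le_of_tendsto_of_tendsto' h1 h2 (fun n => hu (φ n) p hp)

/-- Optimality condition. -/
theorem meb_optimal {d : ℕ} (P : Set (EuclideanSpace ℝ (Fin d)))
    (hPne : P.Nonempty) (hP : IsCompact P) (c : EuclideanSpace ℝ (Fin d))
    (hc : ∀ p ∈ P, ‖p - c‖ ≤ cRadius P (Metric.closedBall (0 : EuclideanSpace ℝ (Fin d)) 1))
    (v : EuclideanSpace ℝ (Fin d)) :
    ∃ p ∈ P, ‖p - c‖ = cRadius P (Metric.closedBall (0 : EuclideanSpace ℝ (Fin d)) 1) ∧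
      inner ℝ (p - c) v ≤ 0 := by
  set R := cRadius P (Metric.closedBall (0 : EuclideanSpace ℝ (Fin d)) 1) with hR
  have key : ∀ n : ℕ, ∃ p ∈ P, R ≤ ‖p - (c + (1 / ((n : ℝ) + 1)) • v)‖ := by
    intro n
    obtain ⟨p, hp, hmax⟩ := hP.exists_isMaxOn hPne
      (f := fun p => ‖p - (c + (1 / ((n : ℝ) + 1)) • v)‖) (by fun_prop)
    exact ⟨p, hp, meb_radius_le P _ (norm_nonneg _) (fun q hq => hmax hq)⟩
  choose u huP hu using key
  have hR0 : 0 ≤ R := by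
    obtain ⟨p, hp⟩ := hPne
    exact (norm_nonneg _).trans (hc p hp)
  have hin : ∀ n : ℕ, 2 * inner ℝ (u n - c) v ≤ (1 / ((n : ℝ) + 1)) * ‖v‖ ^ 2 := by
    intro n
    have ht : 0 < 1 / ((n : ℝ) + 1) := by positivity
    have h1 := hu n
    have h2 := hc _ (huP n)
    generalize 1 / ((n : ℝ) + 1) = t at *
    rw [← sub_sub] at h1
    have h3 : ‖u n - c - t • v‖ ^ 2 =
        ‖u n - c‖ ^ 2 - 2 * (t * inner ℝ (u n - c) v) + t ^ 2 * ‖v‖ ^ 2 := by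
      rw [norm_sub_sq_real, inner_smul_right, norm_smul, mul_pow, Real.norm_eq_abs, sq_abs]
    have h4 : R ^ 2 ≤ ‖u n - c - t • v‖ ^ 2 := by gcongr
    have h5 : ‖u n - c‖ ^ 2 ≤ R ^ 2 := by gcongr
    have h6 : t * (2 * inner ℝ (u n - c) v) ≤ t * (t * ‖v‖ ^ 2) := by nlinarith
    exact le_of_mul_le_mul_left h6 ht
  obtain ⟨p, hp, φ, hφ, hlim⟩ := hP.tendsto_subseq huP
  have ht : Tendsto (fun n => 1 / ((φ n : ℝ) + 1)) atTop (𝓝 0) :=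
    tendsto_one_div_add_atTop_nhds_zero_nat.comp hφ.tendsto_atTop
  refine ⟨p, hp, le_antisymm (hc p hp) ?_, ?_⟩
  · have h1 : Tendsto (fun n => ‖(u ∘ φ) n - (c + (1 / ((φ n : ℝ) + 1)) • v)‖) atTop
        (𝓝 ‖p - (c + (0 : ℝ) • v)‖) :=
      (hlim.sub (tendsto_const_nhds.add (ht.smul tendsto_const_nhds))).norm
    have h2 := ge_of_tendsto' h1 (fun n => hu (φ n))
    simpa using h2
  · have h1 : Tendsto (fun n => 2 * inner ℝ ((u ∘ φ) n - c) v) atTop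
        (𝓝 (2 * inner ℝ (p - c) v)) :=
      ((hlim.sub tendsto_const_nhds).inner tendsto_const_nhds).const_mul 2
    have h2 := le_of_tendsto_of_tendsto' h1 (ht.mul_const (‖v‖ ^ 2)) (fun n => hin (φ n))
    linarith

/-- Greedy partial sums. -/
noncomputable def mebSum {d : ℕ} (c : EuclideanSpace ℝ (Fin d))
    (g : EuclideanSpace ℝ (Fin d) → EuclideanSpace ℝ (Fin d)) : ℕ → EuclideanSpace ℝ (Fin d)
  | 0 => 0
  | n + 1 => mebSum c g n + (g (mebSum c g n) - c)

end Helpers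

theorem coreset_MEB {d : ℕ} (P : Set (EuclideanSpace ℝ (Fin d)))
    (hPne : P.Nonempty) (hPcomp : IsCompact P) (ε : ℝ) (hε : 0 < ε) :
    ∃ S : Set (EuclideanSpace ℝ (Fin d)), S ⊆ P ∧ S.Finite ∧
      S.ncard ≤ ⌈1 / (2 * ε + ε ^ 2)⌉₊ + 1 ∧
      cRadius P (Metric.closedBall (0 : EuclideanSpace ℝ (Fin d)) 1) ≤
        (1 + ε) * cRadius S (Metric.closedBall (0 : EuclideanSpace ℝ (Fin d)) 1) := by
  obtain ⟨c, hc⟩ := meb_center P hPne hPcomp.isBounded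
  have hopt := meb_optimal P hPne hPcomp c hc
  set R := cRadius P (Metric.closedBall (0 : EuclideanSpace ℝ (Fin d)) 1) with hR
  have hR0 : 0 ≤ R := by
    obtain ⟨p, hp⟩ := hPne
    exact (norm_nonneg _).trans (hc p hp)
  choose g hgP hgR hg using hopt
  set k := ⌈1 / (2 * ε + ε ^ 2)⌉₊ with hk
  have hδ : 0 < 2 * ε + ε ^ 2 := by positivity
  have hkδ : 1 ≤ (k : ℝ) * (2 * ε + ε ^ 2) := by
    have := Nat.le_ceil (1 / (2 * ε + ε ^ 2))
    rwa [div_le_iff₀ hδ] at this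
  have hs : ∀ n : ℕ, ‖mebSum c g n‖ ^ 2 ≤ n * R ^ 2 := by
    intro n
    induction n with
    | zero => simp [mebSum]
    | succ n ih =>
      have h1 := hg (mebSum c g n)
      rw [real_inner_comm] at h1
      rw [mebSum, norm_add_sq_real, hgR]
      push_cast
      linarith
  have hsum : ∀ (c' : EuclideanSpace ℝ (Fin d)) (n : ℕ),
      ∑ i ∈ Finset.range n, ‖g (mebSum c g i) - c'‖ ^ 2 =
        n * R ^ 2 + 2 * inner ℝ (mebSum c g n) (c - c') + n * ‖c - c'‖ ^ 2 := by
    intro c' n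
    induction n with
    | zero => simp [mebSum]
    | succ n ih =>
      have h1 : g (mebSum c g n) - c' = (g (mebSum c g n) - c) + (c - c') := by abel
      rw [Finset.sum_range_succ, ih, h1, norm_add_sq_real, hgR, mebSum, inner_add_left]
      push_cast
      ring
  classical
  refine ⟨((Finset.range (k + 1)).image (fun i => g (mebSum c g i)) : Finset _), ?_,
    Finset.finite_toSet _, ?_, ?_⟩
  · intro x hx
    simp only [Finset.coe_image, Set.mem_image] at hx
    obtain ⟨i, _, rfl⟩ := hx
    exact hgP _
  · rw [Set.ncard_coe_finset]
    exact Finset.card_image_le.trans (by simp)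
  · rw [mul_comm, ← div_le_iff₀ (by positivity)]
    apply meb_le_radius _ (Finset.finite_toSet _).isBounded
    intro ρ hρ c' hc'
    rw [div_le_iff₀ (by positivity)]
    have h1 : ∑ i ∈ Finset.range (k + 1), ‖g (mebSum c g i) - c'‖ ^ 2 ≤ ((k : ℝ) + 1) * ρ ^ 2 := by
      have := Finset.sum_le_card_nsmul (Finset.range (k + 1))
        (fun i => ‖g (mebSum c g i) - c'‖ ^ 2) (ρ ^ 2) (by
          intro i hi
          have := hc' (g (mebSum c g i)) (Finset.mem_coe.2 (Finset.mem_image_of_mem _ hi))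
          show ‖g (mebSum c g i) - c'‖ ^ 2 ≤ ρ ^ 2
          gcongr)
      simpa using this
    have h2 := hsum c' (k + 1)
    have h3 := hs (k + 1)
    have h4 := abs_le.1 (abs_real_inner_le_norm (mebSum c g (k + 1)) (c - c'))
    push_cast at h2 h3
    set x := ‖mebSum c g (k + 1)‖
    set y := ‖c - c'‖
    have hk0 : (0 : ℝ) ≤ k := Nat.cast_nonneg k
    have h5 : ((k : ℝ) + 1) * R ^ 2 - 2 * (x * y) + (k + 1) * y ^ 2 ≤ (k + 1) * ρ ^ 2 := by
      linarith [h4.1]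
    have h6 : (k : ℝ) * R ^ 2 ≤ (k + 1) * ρ ^ 2 := by
      have h7 : 0 ≤ (x - (k + 1) * y) ^ 2 := sq_nonneg _
      have h8 : ((k : ℝ) + 1) * (k * R ^ 2) ≤ (k + 1) * ((k + 1) * ρ ^ 2) := by nlinarith
      exact le_of_mul_le_mul_left h8 (by positivity)
    have hkpos : (0 : ℝ) < k := by
      rcases hk0.lt_or_eq with h | h
      · exact h
      · rw [← h] at hkδ
        linarith
    have h9 : R ^ 2 ≤ (ρ * (1 + ε)) ^ 2 := by
      have h10 : (k : ℝ) * R ^ 2 ≤ k * (ρ * (1 + ε)) ^ 2 := by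
        have := mul_le_mul_of_nonneg_right hkδ (sq_nonneg ρ)
        nlinarith
      exact le_of_mul_le_mul_left h10 hkpos
    exact (pow_le_pow_iff_left₀ hR0 (by positivity) two_ne_zero).1 h9
end

section
/- Let ε > 0 and let k be a natural number with k < 1/(2ε+ε²). Then for every dimension d with d/(d+1) > (1+ε)²·k/(k+1), taking T^d a regular d-simplex in ℝ^d, every subset S ⊆ T^d with |S| ≤ k+1 satisfies R(T^d, B^d) > (1+ε)·R(S, B^d); hence the bound ⌈1/(2ε+ε²)⌉ + 1 on the size of ε-core-sets for the minimal enclosing ball problem is the best possible dimension-independent bound. -/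
open Set Pointwise

/-- `v` lists the vertices of a regular `d`-simplex in `ℝ^d`:
affinely independent, pairwise equidistant points. -/
def IsRegularSimplex {d : ℕ} (v : Fin (d + 1) → EuclideanSpace ℝ (Fin d)) : Prop :=
  AffineIndependent ℝ v ∧ (∃ r : ℝ, 0 < r ∧ ∀ i j, i ≠ j → dist (v i) (v j) = r)

/-- Weighted sum of pairwise squared distances. -/
lemma sum_sum_sq_dist {E ι : Type*} [NormedAddCommGroup E] [InnerProductSpace ℝ E] [Fintype ι]
    (w : ι → ℝ) (x : ι → E) :
    ∑ i, ∑ j, w i * w j * ‖x i - x j‖ ^ 2 =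
      2 * (∑ i, w i) * (∑ i, w i * ‖x i‖ ^ 2) - 2 * ‖∑ i, w i • x i‖ ^ 2 := by
  have h1 : ∀ i j, w i * w j * ‖x i - x j‖ ^ 2 =
      (w i * ‖x i‖ ^ 2) * w j + w i * (w j * ‖x j‖ ^ 2) - 2 * (w i * (w j * inner ℝ (x i) (x j))) := by
    intro i j
    rw [norm_sub_sq_real]; ring
  have h2 : ‖∑ i, w i • x i‖ ^ 2 = ∑ i, ∑ j, w i * (w j * inner ℝ (x i) (x j)) := by
    rw [← real_inner_self_eq_norm_sq, sum_inner]
    refine Finset.sum_congr rfl fun i _ => ?_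
    rw [inner_sum]
    refine Finset.sum_congr rfl fun j _ => ?_
    rw [real_inner_smul_left, real_inner_smul_right]
  simp_rw [h1, Finset.sum_sub_distrib, Finset.sum_add_distrib, ← Finset.mul_sum, h2,
    ← Finset.mul_sum, ← Finset.sum_mul]
  ring

/-- Jung theorem for finitely many points. -/
lemma jung_fintype {E ι : Type*} [NormedAddCommGroup E] [InnerProductSpace ℝ E] [Fintype ι]
    [Nonempty ι] (x : ι → E) (r : ℝ) (hx : ∀ i j, ‖x i - x j‖ ≤ r) :
    ∃ c : E, ∀ j, ‖x j - c‖ ^ 2 ≤ r ^ 2 / 2 * (1 - 1 / (Fintype.card ι : ℝ)) := by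
  classical
  set g : (ι → ℝ) → ℝ := fun w => (∑ i, w i * ‖x i‖ ^ 2) - ‖∑ i, w i • x i‖ ^ 2 with hg
  have hgc : Continuous g := by
    simp only [hg]; fun_prop
  obtain ⟨i0⟩ := ‹Nonempty ι›
  obtain ⟨w, hw, hmax⟩ := (isCompact_stdSimplex ℝ ι).exists_isMaxOn
    ⟨_, single_mem_stdSimplex ℝ i0⟩ hgc.continuousOn
  have hw1 : ∑ i, w i = 1 := hw.2
  have hw0 : ∀ i, 0 ≤ w i := hw.1
  have hcard : (0 : ℝ) < Fintype.card ι := by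
    exact_mod_cast Fintype.card_pos_iff.2 ⟨i0⟩
  have hr : 0 ≤ r := (norm_nonneg _).trans (hx i0 i0)
  -- bound on the maximum
  have hbound : g w ≤ r ^ 2 / 2 * (1 - 1 / (Fintype.card ι : ℝ)) := by
    have h := sum_sum_sq_dist w x
    have h2 : ∑ i, ∑ j, w i * w j * ‖x i - x j‖ ^ 2 ≤
        ∑ i, ∑ j, (w i * w j * r ^ 2 - if i = j then w i * w j * r ^ 2 else 0) := by
      refine Finset.sum_le_sum fun i _ => Finset.sum_le_sum fun j _ => ?_
      by_cases hij : i = j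
      · simp [hij]
      · simp only [hij, if_false, sub_zero]
        exact mul_le_mul_of_nonneg_left (pow_le_pow_left₀ (norm_nonneg _) (hx i j) 2)
          (mul_nonneg (hw0 i) (hw0 j))
    have h3 : ∑ i, ∑ j, (w i * w j * r ^ 2 - if i = j then w i * w j * r ^ 2 else 0) =
        r ^ 2 * (1 - ∑ i, w i ^ 2) := by
      simp only [Finset.sum_sub_distrib, Finset.sum_ite_eq, Finset.mem_univ, if_true]
      simp_rw [← Finset.sum_mul, ← Finset.mul_sum, ← Finset.sum_mul, hw1]
      simp_rw [← pow_two]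
      ring
    have h4 : 1 / (Fintype.card ι : ℝ) ≤ ∑ i, w i ^ 2 := by
      have := sq_sum_le_card_mul_sum_sq (s := Finset.univ) (f := w)
      rw [hw1, Finset.card_univ] at this
      rw [div_le_iff₀ hcard]; linarith
    have h5 : r ^ 2 * (1 - ∑ i, w i ^ 2) ≤ r ^ 2 * (1 - 1 / (Fintype.card ι : ℝ)) :=
      mul_le_mul_of_nonneg_left (by linarith) (sq_nonneg r)
    simp only [hg]
    rw [hw1] at h
    linarith
  refine ⟨∑ i, w i • x i, fun j => le_trans ?_ hbound⟩
  set c := ∑ i, w i • x i with hc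
  set a := ∑ i, w i * ‖x i‖ ^ 2 with ha
  have hgw : g w = a - ‖c‖ ^ 2 := rfl
  have hD : ‖x j - c‖ ^ 2 = ‖x j‖ ^ 2 - 2 * inner ℝ (x j) c + ‖c‖ ^ 2 := norm_sub_sq_real _ _
  have key : ∀ t : ℝ, 0 < t → t ≤ 1 → ‖x j - c‖ ^ 2 - g w ≤ t * ‖x j - c‖ ^ 2 := by
    intro t ht0 ht1
    have hmem : (1 - t) • w + t • Pi.single j 1 ∈ stdSimplex ℝ ι :=
      convex_stdSimplex ℝ ι hw (single_mem_stdSimplex ℝ j) (by linarith) ht0.le (by ring)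
    have hle : g ((1 - t) • w + t • Pi.single j 1) ≤ g w := hmax hmem
    have e1 : ∑ i, ((1 - t) • w + t • Pi.single j 1 : ι → ℝ) i * ‖x i‖ ^ 2
        = (1 - t) * a + t * ‖x j‖ ^ 2 := by
      simp [add_mul, Finset.sum_add_distrib, Pi.single_apply, ha, Finset.mul_sum, mul_assoc]
    have e2 : ∑ i, ((1 - t) • w + t • Pi.single j 1 : ι → ℝ) i • x i
        = (1 - t) • c + t • x j := by
      simp [add_smul, Finset.sum_add_distrib, Pi.single_apply, hc, Finset.smul_sum, mul_smul]
    have e3 : g ((1 - t) • w + t • Pi.single j 1) =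
        (1 - t) * a + t * ‖x j‖ ^ 2 - ‖(1 - t) • c + t • x j‖ ^ 2 := by
      simp only [hg]; rw [e1, e2]
    have e4 : ‖(1 - t) • c + t • x j‖ ^ 2 =
        (1 - t) ^ 2 * ‖c‖ ^ 2 + 2 * ((1 - t) * (t * inner ℝ (x j) c)) + t ^ 2 * ‖x j‖ ^ 2 := by
      rw [norm_add_sq_real, real_inner_smul_left, real_inner_smul_right, norm_smul, norm_smul,
        mul_pow, mul_pow, Real.norm_eq_abs, Real.norm_eq_abs, sq_abs, sq_abs, real_inner_comm]
    rw [e3, e4, hgw] at hle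
    rw [hgw, hD]
    refine le_of_mul_le_mul_left ?_ ht0
    nlinarith
  by_contra! hcon
  have hg0 := key 1 one_pos le_rfl
  have hDpos : 0 < ‖x j - c‖ ^ 2 := by linarith
  have := key ((‖x j - c‖ ^ 2 - g w) / (2 * ‖x j - c‖ ^ 2)) (div_pos (by linarith) (by linarith))
    (by rw [div_le_one (by linarith)]; linarith)
  have e : (‖x j - c‖ ^ 2 - g w) / (2 * ‖x j - c‖ ^ 2) * ‖x j - c‖ ^ 2
      = (‖x j - c‖ ^ 2 - g w) / 2 := by
    generalize ‖x j - c‖ ^ 2 = D at hDpos ⊢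
    field_simp
  linarith

lemma vadd_smul_unitBall {d : ℕ} (c : EuclideanSpace ℝ (Fin d)) {ρ : ℝ} (hρ : 0 ≤ ρ) :
    c +ᵥ ρ • Metric.closedBall (0 : EuclideanSpace ℝ (Fin d)) 1 = Metric.closedBall c ρ := by
  rw [smul_unitClosedBall_of_nonneg hρ, Metric.vadd_closedBall]
  simp

lemma cRadius_ball_le {d : ℕ} {P : Set (EuclideanSpace ℝ (Fin d))} {ρ : ℝ} (hρ : 0 ≤ ρ)
    (c : EuclideanSpace ℝ (Fin d)) (h : P ⊆ Metric.closedBall c ρ) :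
    cRadius P (Metric.closedBall (0 : EuclideanSpace ℝ (Fin d)) 1) ≤ ρ := by
  refine csInf_le ⟨0, fun y hy => hy.1⟩ ⟨hρ, c, ?_⟩
  rwa [vadd_smul_unitBall c hρ]

lemma le_of_sq_le_sq_aux {a b : ℝ} (h : a ^ 2 ≤ b ^ 2) (hb : 0 ≤ b) : a ≤ b :=
  abs_le_of_sq_le_sq' h hb |>.2

theorem MEB_coreset_bound_sharp {d : ℕ} (ε : ℝ) (hε : 0 < ε) (k : ℕ)
    (hk : (k : ℝ) < 1 / (2 * ε + ε ^ 2))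
    (hd : (d : ℝ) / ((d : ℝ) + 1) > (1 + ε) ^ 2 * (k : ℝ) / ((k : ℝ) + 1))
    (v : Fin (d + 1) → EuclideanSpace ℝ (Fin d)) (hv : IsRegularSimplex v)
    (T : Set (EuclideanSpace ℝ (Fin d))) (hT : T = convexHull ℝ (Set.range v))
    (S : Set (EuclideanSpace ℝ (Fin d))) (hSP : S ⊆ T) (hSfin : S.Finite)
    (hScard : S.ncard ≤ k + 1) :
    cRadius T (Metric.closedBall (0 : EuclideanSpace ℝ (Fin d)) 1) >
      (1 + ε) * cRadius S (Metric.closedBall (0 : EuclideanSpace ℝ (Fin d)) 1) := by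
  subst hT
  obtain ⟨-, r, hr, hvr⟩ := hv
  have hd1 : (0:ℝ) < (d:ℝ) + 1 := by positivity
  have hk1 : (0:ℝ) < (k:ℝ) + 1 := by positivity
  -- lower bound for the simplex
  have hlow : r * √((d:ℝ) / (d + 1) / 2) ≤
      cRadius (convexHull ℝ (Set.range v)) (Metric.closedBall 0 1) := by
    have hb : Bornology.IsBounded (convexHull ℝ (Set.range v)) :=
      isBounded_convexHull.2 (Set.finite_range v).isBounded
    obtain ⟨R, hR⟩ := hb.subset_closedBall 0
    refine le_csInf ⟨max R 0, le_max_right _ _, 0, ?_⟩ ?_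
    · rw [vadd_smul_unitBall _ (le_max_right _ _)]
      exact hR.trans (Metric.closedBall_subset_closedBall (le_max_left _ _))
    · rintro ρ ⟨hρ, c, hc⟩
      rw [vadd_smul_unitBall c hρ] at hc
      have hvc : ∀ i, ‖v i - c‖ ≤ ρ := fun i => by
        rw [← dist_eq_norm]
        exact hc (subset_convexHull ℝ _ (Set.mem_range_self i))
      have h := sum_sum_sq_dist (fun _ => (1:ℝ)) (fun i => v i - c)
      have hl : ∑ i, ∑ j, (1:ℝ) * 1 * ‖(v i - c) - (v j - c)‖ ^ 2 = (d + 1) * d * r ^ 2 := by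
        have : ∀ i j, (1:ℝ) * 1 * ‖(v i - c) - (v j - c)‖ ^ 2 =
            r ^ 2 - if i = j then r ^ 2 else 0 := by
          intro i j
          by_cases hij : i = j
          · simp [hij]
          · rw [sub_sub_sub_cancel_right, ← dist_eq_norm, hvr i j hij]; simp [hij]
        simp_rw [this]
        simp [Finset.sum_sub_distrib]
        ring
      have hs : ∑ i, (1:ℝ) * ‖v i - c‖ ^ 2 ≤ (d + 1) * ρ ^ 2 := by
        calc ∑ i, (1:ℝ) * ‖v i - c‖ ^ 2 ≤ ∑ _i : Fin (d+1), ρ ^ 2 := by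
              refine Finset.sum_le_sum fun i _ => ?_
              rw [one_mul]
              exact pow_le_pow_left₀ (norm_nonneg _) (hvc i) 2
          _ = (d + 1) * ρ ^ 2 := by simp
      rw [hl] at h
      have hone : ∑ _i : Fin (d+1), (1:ℝ) = d + 1 := by simp
      rw [hone] at h
      have h6 : (d:ℝ) * r ^ 2 ≤ 2 * ((d + 1) * ρ ^ 2) := by
        refine le_of_mul_le_mul_left ?_ hd1
        have := mul_le_mul_of_nonneg_left hs hd1.le
        nlinarith [sq_nonneg ‖∑ i, (1:ℝ) • (v i - c)‖]
      refine le_of_sq_le_sq_aux ?_ hρ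
      rw [mul_pow, Real.sq_sqrt (by positivity), div_div, ← mul_div_assoc,
        div_le_iff₀ (by positivity)]
      linarith
  -- upper bound for S
  have hup : cRadius S (Metric.closedBall 0 1) ≤ r * √((k:ℝ) / (k + 1) / 2) := by
    have hB : 0 ≤ r * √((k:ℝ) / (k + 1) / 2) := by positivity
    rcases S.eq_empty_or_nonempty with hS | hS
    · exact cRadius_ball_le hB 0 (by simp [hS])
    · haveI := hSfin.fintype
      haveI : Nonempty S := hS.to_subtype
      have hdist : ∀ i j : S, ‖(i : EuclideanSpace ℝ (Fin d)) - j‖ ≤ r := by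
        intro i j
        obtain ⟨_, ⟨p, rfl⟩, _, ⟨q, rfl⟩, hpq⟩ := convexHull_exists_dist_ge2 (hSP i.2) (hSP j.2)
        rw [← dist_eq_norm]
        refine hpq.trans ?_
        by_cases h : p = q
        · simp [h, hr.le]
        · exact (hvr p q h).le
      obtain ⟨c, hc⟩ := jung_fintype (fun i : S => (i : EuclideanSpace ℝ (Fin d))) r hdist
      refine cRadius_ball_le hB c fun y hy => ?_
      have hy' := hc ⟨y, hy⟩
      rw [Metric.mem_closedBall, dist_eq_norm]
      refine le_of_sq_le_sq_aux (hy'.trans ?_) hB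
      have hcard : (Fintype.card S : ℝ) ≤ k + 1 := by
        rw [← Nat.card_eq_fintype_card, Nat.card_coe_set_eq]
        exact_mod_cast hScard
      have hcp : (0:ℝ) < Fintype.card S := by exact_mod_cast Fintype.card_pos
      have h1 : 1 / ((k:ℝ) + 1) ≤ 1 / (Fintype.card S : ℝ) :=
        one_div_le_one_div_of_le hcp hcard
      rw [mul_pow, Real.sq_sqrt (by positivity)]
      have h2 : (k:ℝ) / (k + 1) = 1 - 1 / (k + 1) := by field_simp; ring
      rw [h2]
      nlinarith [sq_nonneg r]
  have hfin : (1 + ε) * √((k:ℝ) / (k + 1) / 2) < √((d:ℝ) / (d + 1) / 2) := by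
    refine Real.lt_sqrt_of_sq_lt ?_
    rw [mul_pow, Real.sq_sqrt (by positivity)]
    have : (1 + ε) ^ 2 * ((k:ℝ) / (k + 1) / 2) = (1 + ε) ^ 2 * (k : ℝ) / ((k : ℝ) + 1) / 2 := by
      ring
    rw [this]
    linarith
  calc (1 + ε) * cRadius S (Metric.closedBall 0 1)
      ≤ (1 + ε) * (r * √((k:ℝ) / (k + 1) / 2)) := mul_le_mul_of_nonneg_left hup (by linarith)
    _ = r * ((1 + ε) * √((k:ℝ) / (k + 1) / 2)) := by ring
    _ < r * √((d:ℝ) / (d + 1) / 2) := mul_lt_mul_of_pos_left hfin hr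
    _ ≤ _ := hlow
end

section
/- Let P ⊆ ℝ^d be a nonempty compact convex set and C ⊆ ℝ^d a container. Then P is optimally contained in C if and only if (i) P ⊆ C, and (ii) there exist k with 2 ≤ k ≤ d+1, points p_1, …, p_k ∈ P, and vectors a_1, …, a_k ∈ ℝ^d such that for each i the hyperplane {x : a_iᵀx = 1} supports C at p_i (i.e. a_iᵀp_i = 1 and a_iᵀx ≤ 1 for all x ∈ C), and 0 ∈ conv{a_1, …, a_k}. -/
open Set Pointwise RealInnerProductSpace

/-- `P` is optimally contained in `C`: `P ⊆ C` and no smaller homothetic copy of `C` contains `P`. -/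
def OptimallyContained {d : ℕ} (P C : Set (EuclideanSpace ℝ (Fin d))) : Prop :=
  P ⊆ C ∧ ¬ ∃ (c : EuclideanSpace ℝ (Fin d)) (ρ : ℝ), 0 ≤ ρ ∧ ρ < 1 ∧ P ⊆ c +ᵥ ρ • C

/-- Carathéodory with exactly `d + 1` points. -/
lemma carath_fin {d : ℕ} {A : Set (EuclideanSpace ℝ (Fin d))} {x : EuclideanSpace ℝ (Fin d)}
    (hx : x ∈ convexHull ℝ A) :
    ∃ (w : Fin (d + 1) → ℝ) (a : Fin (d + 1) → EuclideanSpace ℝ (Fin d)),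
      w ∈ stdSimplex ℝ (Fin (d + 1)) ∧ (∀ i, a i ∈ A) ∧ ∑ i, w i • a i = x := by
  obtain ⟨ι, _, z, w, hz, hind, hw, hw1, hsum⟩ := eq_pos_convex_span_of_mem_convexHull hx
  have hcard : Fintype.card ι ≤ Fintype.card (Fin (d + 1)) := by
    have h1 := hind.card_le_finrank_succ
    have h2 := Submodule.finrank_le (vectorSpan ℝ (Set.range z))
    rw [finrank_euclideanSpace_fin] at h2
    rw [Fintype.card_fin]
    omega
  obtain ⟨e⟩ := Function.Embedding.nonempty_of_card_le hcard
  have hne : Nonempty ι := by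
    by_contra h
    rw [not_nonempty_iff] at h
    simp at hw1
  obtain ⟨i0⟩ := hne
  have hsupp : ∀ j, j ∉ Set.range e → Function.extend e w 0 j = 0 := by
    intro j hj
    rw [Function.extend_apply' _ _ _ hj]; rfl
  have hw' : ∀ i, Function.extend e w 0 (e i) = w i := fun i => e.injective.extend_apply _ _ _
  have ha' : ∀ i, Function.extend e z (fun _ => z i0) (e i) = z i :=
    fun i => e.injective.extend_apply _ _ _
  refine ⟨Function.extend e w 0, Function.extend e z (fun _ => z i0), ⟨?_, ?_⟩, ?_, ?_⟩
  · intro j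
    by_cases hj : j ∈ Set.range e
    · obtain ⟨i, rfl⟩ := hj
      rw [hw']; exact (hw i).le
    · rw [hsupp j hj]
  · rw [← hw1]
    symm
    refine Fintype.sum_of_injective e e.injective _ _ hsupp (fun i => (hw' i).symm)
  · intro j
    by_cases hj : j ∈ Set.range e
    · obtain ⟨i, rfl⟩ := hj
      rw [ha']; exact hz ⟨i, rfl⟩
    · rw [Function.extend_apply' _ _ _ hj]; exact hz ⟨i0, rfl⟩
  · rw [← hsum]
    symm
    refine Fintype.sum_of_injective e e.injective _ _ ?_ ?_
    · intro j hj; rw [hsupp j hj, zero_smul]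
    · intro i; rw [hw', ha']

lemma isCompact_convexHull_aux {d : ℕ} {A : Set (EuclideanSpace ℝ (Fin d))} (hA : IsCompact A) :
    IsCompact (convexHull ℝ A) := by
  have h1 : IsCompact ((stdSimplex ℝ (Fin (d + 1))) ×ˢ
      (Set.univ.pi fun _ : Fin (d + 1) => A)) :=
    (isCompact_stdSimplex ℝ (Fin (d + 1))).prod (isCompact_univ_pi fun _ => hA)
  have h2 := h1.image (f := fun q : (Fin (d + 1) → ℝ) × (Fin (d + 1) → EuclideanSpace ℝ (Fin d)) =>
    ∑ i, q.1 i • q.2 i) (by fun_prop)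
  convert h2 using 1
  ext x
  constructor
  · intro hx
    obtain ⟨w, a, hw, ha, hs⟩ := carath_fin hx
    exact ⟨(w, a), ⟨hw, fun i _ => ha i⟩, hs⟩
  · rintro ⟨⟨w, a⟩, ⟨hw, ha⟩, rfl⟩
    exact (convex_convexHull ℝ A).sum_mem (fun i _ => hw.1 i) hw.2
      (fun i _ => subset_convexHull ℝ A (ha i trivial))

lemma bipolar_aux {d : ℕ} {C : Set (EuclideanSpace ℝ (Fin d))} (hC : IsContainer C)
    {y : EuclideanSpace ℝ (Fin d)} (h : ∀ a, (∀ x ∈ C, ⟪a, x⟫ ≤ 1) → ⟪a, y⟫ ≤ 1) : y ∈ C := by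
  by_contra hy
  obtain ⟨f, u, h1, h2⟩ := geometric_hahn_banach_closed_point hC.2.1 hC.1.isClosed hy
  have hu : 0 < u := by simpa using h1 0 (interior_subset hC.2.2)
  obtain ⟨v, rfl⟩ := (InnerProductSpace.toDual ℝ (EuclideanSpace ℝ (Fin d))).surjective f
  simp only [InnerProductSpace.toDual_apply_apply] at h1 h2
  have h3 := h (u⁻¹ • v) (by
    intro x hx
    rw [real_inner_smul_left, inv_mul_le_iff₀ hu]
    linarith [h1 x hx])
  rw [real_inner_smul_left, inv_mul_le_iff₀ hu] at h3
  linarith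

lemma isCompact_polar_aux {d : ℕ} {C : Set (EuclideanSpace ℝ (Fin d))} (hC : IsContainer C) :
    IsCompact {a : EuclideanSpace ℝ (Fin d) | ∀ x ∈ C, ⟪a, x⟫ ≤ 1} := by
  obtain ⟨r, hr, hball⟩ := Metric.mem_nhds_iff.1 (mem_interior_iff_mem_nhds.1 hC.2.2)
  refine Metric.isCompact_of_isClosed_isBounded ?_ ?_
  · have : {a : EuclideanSpace ℝ (Fin d) | ∀ x ∈ C, ⟪a, x⟫ ≤ 1} =
        ⋂ x ∈ C, {a : EuclideanSpace ℝ (Fin d) | ⟪a, x⟫ ≤ 1} := by ext; simp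
    rw [this]
    exact isClosed_biInter fun x _ => isClosed_le (by fun_prop) continuous_const
  · refine (Metric.isBounded_closedBall (x := 0) (r := 2 / r)).subset ?_
    intro a ha
    rw [mem_closedBall_zero_iff]
    by_cases ha0 : a = 0
    · rw [ha0, norm_zero]; positivity
    have hn : 0 < ‖a‖ := norm_pos_iff.2 ha0
    have h1 := ha ((r / 2 / ‖a‖) • a) (hball (by
      rw [mem_ball_zero_iff, norm_smul, Real.norm_of_nonneg (by positivity),
        div_mul_cancel₀ _ hn.ne']
      linarith))
    rw [real_inner_smul_right, real_inner_self_eq_norm_sq] at h1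
    have h2 : r / 2 / ‖a‖ * ‖a‖ ^ 2 = ‖a‖ * r / 2 := by field_simp
    rw [h2] at h1
    rw [le_div_iff₀ hr]
    linarith

lemma forward_aux {d : ℕ} {P C : Set (EuclideanSpace ℝ (Fin d))} (hPne : P.Nonempty)
    (hPcomp : IsCompact P) (hC : IsContainer C) (h : OptimallyContained P C) :
    (0 : EuclideanSpace ℝ (Fin d)) ∈ convexHull ℝ
      {a : EuclideanSpace ℝ (Fin d) | (∀ x ∈ C, ⟪a, x⟫ ≤ 1) ∧ ∃ p ∈ P, ⟪a, p⟫ = 1} := by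
  obtain ⟨hPC, hopt⟩ := h
  by_contra h0
  set Q : Set (EuclideanSpace ℝ (Fin d)) := {a | ∀ x ∈ C, ⟪a, x⟫ ≤ 1} with hQ
  have hQc : IsCompact Q := isCompact_polar_aux hC
  have hK : IsCompact (Q ×ˢ P) := hQc.prod hPcomp
  have hcontI : Continuous fun q : EuclideanSpace ℝ (Fin d) × EuclideanSpace ℝ (Fin d) =>
    ⟪q.1, q.2⟫ := by fun_prop
  have hA : IsCompact {a : EuclideanSpace ℝ (Fin d) | (∀ x ∈ C, ⟪a, x⟫ ≤ 1) ∧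
      ∃ p ∈ P, ⟪a, p⟫ = 1} := by
    have h1 := (hK.inter_right (isClosed_eq hcontI (continuous_const (y := (1 : ℝ))))).image
      continuous_fst
    convert h1 using 1
    ext a
    constructor
    · rintro ⟨ha, p, hp, hap⟩
      exact ⟨(a, p), ⟨⟨ha, hp⟩, hap⟩, rfl⟩
    · rintro ⟨⟨a', p⟩, ⟨⟨ha, hp⟩, hap⟩, rfl⟩
      exact ⟨ha, p, hp, hap⟩
  obtain ⟨f, u, hfu, hf⟩ := geometric_hahn_banach_point_closed (convex_convexHull ℝ _)
    (isCompact_convexHull_aux hA).isClosed h0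
  obtain ⟨c, rfl⟩ := (InnerProductSpace.toDual ℝ (EuclideanSpace ℝ (Fin d))).surjective f
  simp only [InnerProductSpace.toDual_apply_apply, inner_zero_right] at hf hfu
  have hc : ∀ a ∈ Q, ∀ p ∈ P, ⟪a, p⟫ = 1 → 0 < ⟪a, c⟫ := by
    intro a ha p hp hap
    rw [real_inner_comm]
    exact hfu.trans (hf a (subset_convexHull ℝ _ ⟨ha, p, hp, hap⟩))
  -- a uniform gap on the part where the inner product with `c` is nonpositive
  obtain ⟨δ, hδ, hδ1⟩ : ∃ δ > 0, ∀ a ∈ Q, ∀ p ∈ P, ⟪a, c⟫ ≤ 0 → ⟪a, p⟫ ≤ 1 - δ := by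
    have hK0 : IsCompact ((Q ×ˢ P) ∩ {q | ⟪q.1, c⟫ ≤ 0}) :=
      hK.inter_right (isClosed_le (by fun_prop) continuous_const)
    rcases ((Q ×ˢ P) ∩ {q | ⟪q.1, c⟫ ≤ 0}).eq_empty_or_nonempty with he | hne
    · refine ⟨1, one_pos, fun a ha p hp hac => ?_⟩
      exact absurd (show (a, p) ∈ ((Q ×ˢ P) ∩ {q | ⟪q.1, c⟫ ≤ 0}) from ⟨⟨ha, hp⟩, hac⟩)
        (by rw [he]; exact Set.notMem_empty _)
    · obtain ⟨⟨a0, p0⟩, ⟨⟨ha0, hp0⟩, hac0⟩, hmax⟩ := hK0.exists_isMaxOn hne hcontI.continuousOn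
      refine ⟨1 - ⟪a0, p0⟫, ?_, fun a ha p hp hac => ?_⟩
      · have h1 : ⟪a0, p0⟫ ≤ 1 := ha0 p0 (hPC hp0)
        have h2 : ⟪a0, p0⟫ ≠ 1 := fun h => absurd (hc a0 ha0 p0 hp0 h) (not_lt.2 hac0)
        have := lt_of_le_of_ne h1 h2
        linarith
      · have := hmax (show (a, p) ∈ ((Q ×ˢ P) ∩ {q | ⟪q.1, c⟫ ≤ 0}) from ⟨⟨ha, hp⟩, hac⟩)
        simp only [Set.mem_ofPred_eq] at this
        linarith
  obtain ⟨M, hM⟩ := (hQc.image (f := fun a => -⟪a, c⟫) (by fun_prop)).bddAbove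
  have hM' : ∀ a ∈ Q, -⟪a, c⟫ ≤ M := fun a ha => hM ⟨a, ha, rfl⟩
  have h0Q : (0 : EuclideanSpace ℝ (Fin d)) ∈ Q := by intro x _; simp
  have hM0 : 0 ≤ M := by simpa using hM' 0 h0Q
  set t : ℝ := δ / (M + 1) with ht
  have htpos : 0 < t := by positivity
  have htM : t * M < δ := by
    rw [ht, div_mul_eq_mul_div, div_lt_iff₀ (by linarith)]
    nlinarith
  have hlt : ∀ a ∈ Q, ∀ p ∈ P, ⟪a, p - t • c⟫ < 1 := by
    intro a ha p hp
    rw [inner_sub_right, real_inner_smul_right]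
    rcases le_or_gt ⟪a, c⟫ 0 with hac | hac
    · have h1 := hδ1 a ha p hp hac
      have h2 := mul_le_mul_of_nonneg_left (hM' a ha) htpos.le
      linarith
    · have h1 : ⟪a, p⟫ ≤ 1 := ha p (hPC hp)
      have h2 := mul_pos htpos hac
      linarith
  obtain ⟨⟨a0, p0⟩, ⟨ha0, hp0⟩, hmax⟩ := hK.exists_isMaxOn
    (f := fun q : EuclideanSpace ℝ (Fin d) × EuclideanSpace ℝ (Fin d) => ⟪q.1, q.2 - t • c⟫)
    ⟨(0, hPne.some), h0Q, hPne.some_mem⟩ (by fun_prop)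
  set ρ : ℝ := max ⟪a0, p0 - t • c⟫ (1 / 2) with hρ
  have hρ0 : 0 < ρ := lt_of_lt_of_le (by norm_num) (le_max_right _ _)
  have hρ1 : ρ < 1 := max_lt (hlt a0 ha0 p0 hp0) (by norm_num)
  refine hopt ⟨t • c, ρ, hρ0.le, hρ1, fun p hp => ?_⟩
  rw [Set.mem_vadd_set]
  refine ⟨p - t • c, ?_, by simp [vadd_eq_add]⟩
  refine ⟨ρ⁻¹ • (p - t • c), ?_, smul_inv_smul₀ hρ0.ne' _⟩
  apply bipolar_aux hC
  intro a ha
  rw [real_inner_smul_right, inv_mul_le_iff₀ hρ0, mul_one]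
  exact le_trans (hmax (show (a, p) ∈ Q ×ˢ P from ⟨ha, hp⟩)) (le_max_left _ _)

theorem optimality_condition {d : ℕ} (P C : Set (EuclideanSpace ℝ (Fin d)))
    (hPne : P.Nonempty) (hPcomp : IsCompact P) (hPconv : Convex ℝ P)
    (hC : IsContainer C) :
    OptimallyContained P C ↔
      P ⊆ C ∧ ∃ (k : ℕ), 2 ≤ k ∧ k ≤ d + 1 ∧
        ∃ (p : Fin k → EuclideanSpace ℝ (Fin d)) (a : Fin k → EuclideanSpace ℝ (Fin d)),
          (∀ i, p i ∈ P) ∧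
          (∀ i, ⟪a i, p i⟫ = 1 ∧ ∀ x ∈ C, ⟪a i, x⟫ ≤ 1) ∧
          (0 : EuclideanSpace ℝ (Fin d)) ∈ convexHull ℝ (Set.range a) := by
  constructor
  · intro h
    refine ⟨h.1, ?_⟩
    obtain ⟨w, a, hw, ha, hs⟩ := carath_fin (forward_aux hPne hPcomp hC h)
    have hd : d ≠ 0 := by
      rintro rfl
      obtain ⟨_, p, _, hap⟩ := ha 0
      rw [Subsingleton.elim (a 0) 0, inner_zero_left] at hap
      exact zero_ne_one hap
    choose ha1 p hp hap using ha
    refine ⟨d + 1, by omega, le_rfl, p, a, hp, fun i => ⟨hap i, ha1 i⟩, ?_⟩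
    rw [← hs]
    exact (convex_convexHull ℝ _).sum_mem (fun i _ => hw.1 i) hw.2
      (fun i _ => subset_convexHull ℝ _ ⟨i, rfl⟩)
  · rintro ⟨hPC, k, -, -, p, a, hp, ha, h0⟩
    refine ⟨hPC, ?_⟩
    rintro ⟨c, ρ, hρ0, hρ1, hsub⟩
    have hconv : Convex ℝ {y : EuclideanSpace ℝ (Fin d) | 1 - ρ ≤ ⟪c, y⟫} :=
      convex_halfSpace_ge (innerₗ (EuclideanSpace ℝ (Fin d)) c).isLinear (1 - ρ)
    have hr : Set.range a ⊆ {y : EuclideanSpace ℝ (Fin d) | 1 - ρ ≤ ⟪c, y⟫} := by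
      rintro _ ⟨i, rfl⟩
      obtain ⟨_, ⟨x, hx, rfl⟩, hxp⟩ := hsub (hp i)
      have h1 := (ha i).1
      have h2 := (ha i).2 x hx
      simp only [vadd_eq_add] at hxp
      rw [← hxp, inner_add_right, real_inner_smul_right, real_inner_comm] at h1
      have h3 := mul_le_mul_of_nonneg_left h2 hρ0
      simp only [Set.mem_ofPred_eq]
      linarith
    have := convexHull_min hr hconv h0
    simp only [Set.mem_ofPred_eq, inner_zero_right] at this
    linarith
end

section
/- Let P ⊆ ℝ^d be a nonempty compact convex set, ε > 0, and let S ⊆ P be an ε-core-set of P with respect to the Euclidean unit ball B^d, i.e. R(P,B^d) ≤ (1+ε)·R(S,B^d). Let c_S be the center of the minimal enclosing Euclidean ball of S, i.e. S ⊆ c_S + R(S,B^d)·B^d. Then P ⊆ c_S + (1 + ε + √(2ε+ε²))·R(S,B^d)·B^d; that is, S is a center-conform (ε + √(2ε+ε²))-core-set of P. -/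
open Set Pointwise

theorem ball_eq_aux {d : ℕ} (c : EuclideanSpace ℝ (Fin d)) {ρ : ℝ} (h : 0 ≤ ρ) :
    c +ᵥ ρ • Metric.closedBall (0 : EuclideanSpace ℝ (Fin d)) 1 = Metric.closedBall c ρ := by
  rw [smul_unitClosedBall, Metric.vadd_closedBall, Real.norm_of_nonneg h]
  simp

theorem cRadius_le_aux {d : ℕ} (S : Set (EuclideanSpace ℝ (Fin d)))
    (c : EuclideanSpace ℝ (Fin d)) {ρ : ℝ} (h : 0 ≤ ρ) (hS : S ⊆ Metric.closedBall c ρ) :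
    cRadius S (Metric.closedBall 0 1) ≤ ρ :=
  csInf_le ⟨0, fun _ hx => hx.1⟩ ⟨h, c, by rwa [ball_eq_aux c h]⟩

theorem cRadius_nonneg_aux {d : ℕ} (S B : Set (EuclideanSpace ℝ (Fin d))) :
    0 ≤ cRadius S B := Real.sInf_nonneg fun _ hx => hx.1

theorem convex_aux {d : ℕ} (x a c : EuclideanSpace ℝ (Fin d)) (t : ℝ) :
    ‖x - ((1 - t) • a + t • c)‖ ^ 2 =
      (1 - t) * ‖x - a‖ ^ 2 + t * ‖x - c‖ ^ 2 - t * (1 - t) * ‖a - c‖ ^ 2 := by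
  have h1 : x - ((1 - t) • a + t • c) = (1 - t) • (x - a) + t • (x - c) := by module
  have h2 : a - c = (x - c) - (x - a) := by abel
  rw [h1, h2, norm_add_sq_real, norm_sub_sq_real (x - c) (x - a), norm_smul, norm_smul, inner_smul_left,
    inner_smul_right, real_inner_comm (x - c) (x - a), mul_pow, mul_pow, Real.norm_eq_abs,
    Real.norm_eq_abs, sq_abs, sq_abs]
  simp only [conj_trivial]
  ring

theorem dist_aux {d : ℕ} (S : Set (EuclideanSpace ℝ (Fin d))) (hSne : S.Nonempty)
    (a c : EuclideanSpace ℝ (Fin d)) (r ρ : ℝ) (hr : r = cRadius S (Metric.closedBall 0 1))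
    (ha : S ⊆ Metric.closedBall a r) (hc : S ⊆ Metric.closedBall c ρ) :
    ‖a - c‖ ^ 2 + r ^ 2 ≤ ρ ^ 2 := by
  have hr0 : 0 ≤ r := hr ▸ cRadius_nonneg_aux _ _
  obtain ⟨x₀, hx₀⟩ := hSne
  have key : ∀ t ∈ Ioo (0 : ℝ) 1, (1 - t) * ‖a - c‖ ^ 2 + r ^ 2 ≤ ρ ^ 2 := by
    rintro t ⟨ht0, ht1⟩
    set Q := (1 - t) * r ^ 2 + t * ρ ^ 2 - t * (1 - t) * ‖a - c‖ ^ 2 with hQ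
    have hx : ∀ x ∈ S, ‖x - ((1 - t) • a + t • c)‖ ^ 2 ≤ Q := by
      intro x hx
      rw [convex_aux]
      have h1 := ha hx
      have h2 := hc hx
      rw [Metric.mem_closedBall, dist_eq_norm] at h1 h2
      have h3 := mul_le_mul_of_nonneg_left (pow_le_pow_left₀ (norm_nonneg _) h1 2)
        (sub_nonneg.2 ht1.le)
      have h4 := mul_le_mul_of_nonneg_left (pow_le_pow_left₀ (norm_nonneg _) h2 2) ht0.le
      linarith
    have hQ0 : 0 ≤ Q := (sq_nonneg _).trans (hx x₀ hx₀)
    have h5 : r ≤ Real.sqrt Q := by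
      rw [hr]
      refine cRadius_le_aux S ((1 - t) • a + t • c) (Real.sqrt_nonneg _) fun x hxS => ?_
      rw [Metric.mem_closedBall, dist_eq_norm]
      exact Real.le_sqrt_of_sq_le (hx x hxS)
    have h6 : r ^ 2 ≤ Q := (Real.le_sqrt hr0 hQ0).1 h5
    have h7 : t * ((1 - t) * ‖a - c‖ ^ 2 + r ^ 2) ≤ t * ρ ^ 2 := by linarith
    exact le_of_mul_le_mul_left h7 ht0
  have hlim : Filter.Tendsto (fun t : ℝ => (1 - t) * ‖a - c‖ ^ 2 + r ^ 2) (nhdsWithin 0 (Ioi 0))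
      (nhds ((1 - 0) * ‖a - c‖ ^ 2 + r ^ 2)) :=
    (Continuous.tendsto (by fun_prop) 0).mono_left nhdsWithin_le_nhds
  have := le_of_tendsto hlim (Filter.eventually_of_mem (Ioo_mem_nhdsGT one_pos) key)
  simpa using this

theorem center_conformity_MEB {d : ℕ} (P S : Set (EuclideanSpace ℝ (Fin d)))
    (hPne : P.Nonempty) (hPcomp : IsCompact P) (hPconv : Convex ℝ P)
    (hSP : S ⊆ P) (hSne : S.Nonempty)
    (ε : ℝ) (hε : 0 < ε)
    (B : Set (EuclideanSpace ℝ (Fin d)))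
    (hB : B = Metric.closedBall (0 : EuclideanSpace ℝ (Fin d)) 1)
    (hCore : cRadius P B ≤ (1 + ε) * cRadius S B)
    (cS : EuclideanSpace ℝ (Fin d)) (hcS : S ⊆ cS +ᵥ (cRadius S B) • B) :
    P ⊆ cS +ᵥ ((1 + ε + Real.sqrt (2 * ε + ε ^ 2)) * cRadius S B) • B := by
  subst hB
  set r := cRadius S (Metric.closedBall 0 1) with hr
  have hr0 : 0 ≤ r := cRadius_nonneg_aux _ _
  rw [ball_eq_aux _ hr0] at hcS
  rw [ball_eq_aux _ (by positivity)]
  intro p hp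
  rw [Metric.mem_closedBall, dist_eq_norm]
  have key : ∀ ρ ∈ Ioi ((1 + ε) * r), ‖p - cS‖ ≤ ρ + Real.sqrt (ρ ^ 2 - r ^ 2) := by
    intro ρ hρ
    have hne : {ρ : ℝ | 0 ≤ ρ ∧ ∃ c : EuclideanSpace ℝ (Fin d),
        P ⊆ c +ᵥ ρ • Metric.closedBall (0 : EuclideanSpace ℝ (Fin d)) 1}.Nonempty := by
      obtain ⟨M, hM⟩ := hPcomp.isBounded.subset_closedBall 0
      refine ⟨max M 0, le_max_right _ _, 0, ?_⟩
      rw [ball_eq_aux _ (le_max_right _ _)]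
      exact hM.trans (Metric.closedBall_subset_closedBall (le_max_left _ _))
    obtain ⟨σ, ⟨hσ0, c, hc⟩, hσ⟩ := exists_lt_of_csInf_lt hne (hCore.trans_lt hρ)
    rw [ball_eq_aux _ hσ0] at hc
    have hc' : P ⊆ Metric.closedBall c ρ := hc.trans (Metric.closedBall_subset_closedBall hσ.le)
    have h1 := dist_aux S hSne cS c r ρ hr hcS (hSP.trans hc')
    have h2 : ‖c - cS‖ ≤ Real.sqrt (ρ ^ 2 - r ^ 2) := by
      rw [norm_sub_rev]
      exact Real.le_sqrt_of_sq_le (by linarith)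
    have h3 := hc' hp
    rw [Metric.mem_closedBall, dist_eq_norm] at h3
    have h4 := norm_sub_le_norm_sub_add_norm_sub p c cS
    linarith
  have hlim : Filter.Tendsto (fun ρ : ℝ => ρ + Real.sqrt (ρ ^ 2 - r ^ 2))
      (nhdsWithin ((1 + ε) * r) (Ioi ((1 + ε) * r)))
      (nhds ((1 + ε) * r + Real.sqrt (((1 + ε) * r) ^ 2 - r ^ 2))) :=
    (Continuous.tendsto (by fun_prop) _).mono_left nhdsWithin_le_nhds
  have h := ge_of_tendsto hlim (Filter.eventually_of_mem self_mem_nhdsWithin key)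
  have e : ((1 + ε) * r) ^ 2 - r ^ 2 = (2 * ε + ε ^ 2) * r ^ 2 := by ring
  rw [e, Real.sqrt_mul (by positivity), Real.sqrt_sq hr0] at h
  linarith
end

section
/- A container C ⊆ ℝ^d satisfies R_1(P,C) = R(P,C) for all nonempty compact convex sets P ⊆ ℝ^d if and only if C is a parallelotope, i.e. the image of the cube [−1,1]^d under an invertible affine map. -/
open Set Pointwise

/-- The k-th core-radius: `sup {R(S,C) : S ⊆ P, |S| ≤ k+1}`. -/
noncomputable def coreRadius {d : ℕ} (k : ℕ) (P C : Set (EuclideanSpace ℝ (Fin d))) : ℝ :=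
  sSup {r : ℝ | ∃ S : Set (EuclideanSpace ℝ (Fin d)),
    S ⊆ P ∧ S.Finite ∧ S.ncard ≤ k + 1 ∧ r = cRadius S C}

/-- A parallelotope: the image of the cube `[-1,1]^d` under an invertible affine map. -/
def IsParallelotope {d : ℕ} (C : Set (EuclideanSpace ℝ (Fin d))) : Prop :=
  ∃ f : EuclideanSpace ℝ (Fin d) ≃ᵃ[ℝ] EuclideanSpace ℝ (Fin d),
    C = f '' {x : EuclideanSpace ℝ (Fin d) | ∀ i, x i ∈ Set.Icc (-1 : ℝ) 1}

abbrev EE (d : ℕ) := EuclideanSpace ℝ (Fin d)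

lemma mem_tr {d : ℕ} (C : Set (EE d)) (c x : EE d) (ρ : ℝ) :
    x ∈ c +ᵥ ρ • C ↔ ∃ z ∈ C, c + ρ • z = x := by
  simp [Set.mem_vadd_set, Set.mem_smul_set]

lemma cRadius_le {d : ℕ} {P C : Set (EE d)} {ρ : ℝ} (h0 : 0 ≤ ρ) (c : EE d)
    (h : ∀ x ∈ P, ∃ z ∈ C, c + ρ • z = x) : cRadius P C ≤ ρ := by
  apply csInf_le ⟨0, fun r hr => hr.1⟩
  exact ⟨h0, c, fun x hx => (mem_tr C c x ρ).2 (h x hx)⟩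

lemma cRadius_set_nonempty {d : ℕ} {P C : Set (EE d)} (hC : IsContainer C) (hP : IsCompact P) :
    {ρ : ℝ | 0 ≤ ρ ∧ ∃ c : EE d, P ⊆ c +ᵥ ρ • C}.Nonempty := by
  obtain ⟨ε, hε, hb⟩ := Metric.mem_nhds_iff.1 (mem_interior_iff_mem_nhds.1 hC.2.2)
  obtain ⟨M, hM⟩ := hP.isBounded.exists_norm_le
  have hρ : 0 < (|M| + 1) / ε := by positivity
  refine ⟨(|M| + 1) / ε, hρ.le, 0, fun x hx => (mem_tr _ _ _ _).2 ⟨((|M| + 1) / ε)⁻¹ • x, hb ?_, ?_⟩⟩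
  · rw [mem_ball_zero_iff, norm_smul, norm_inv, Real.norm_of_nonneg hρ.le, inv_div,
      div_mul_eq_mul_div, div_lt_iff₀ (by positivity)]
    have := hM x hx
    have := le_abs_self M
    nlinarith
  · rw [smul_inv_smul₀ hρ.ne', zero_add]

lemma cRadius_nonneg {d : ℕ} (P C : Set (EE d)) : 0 ≤ cRadius P C :=
  Real.sInf_nonneg fun _ h => h.1

lemma cRadius_mono {d : ℕ} {S P C : Set (EE d)} (hC : IsContainer C) (hP : IsCompact P)
    (h : S ⊆ P) : cRadius S C ≤ cRadius P C := by
  apply csInf_le_csInf ⟨0, fun r hr => hr.1⟩ (cRadius_set_nonempty hC hP)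
  rintro ρ ⟨h0, c, hc⟩
  exact ⟨h0, c, h.trans hc⟩

/-- backward direction -/
lemma backward {d : ℕ} {C : Set (EE d)} (hC : IsContainer C) (hp : IsParallelotope C)
    (P : Set (EE d)) (hne : P.Nonempty) (hP : IsCompact P) : coreRadius 1 P C = cRadius P C := by
  obtain ⟨f, hf⟩ := hp
  set L := f.linear with hL
  obtain ⟨v, hfx⟩ : ∃ v, ∀ x, f x = L x + v := ⟨f 0, fun x => by
    have := f.map_vadd 0 x
    simpa using this⟩
  have hbdd : BddAbove {r : ℝ | ∃ S : Set (EE d),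
      S ⊆ P ∧ S.Finite ∧ S.ncard ≤ 1 + 1 ∧ r = cRadius S C} := by
    refine ⟨cRadius P C, ?_⟩
    rintro r ⟨S, hS, -, -, rfl⟩
    exact cRadius_mono hC hP hS
  have hempty : (0:ℝ) ∈ {r : ℝ | ∃ S : Set (EE d),
      S ⊆ P ∧ S.Finite ∧ S.ncard ≤ 1 + 1 ∧ r = cRadius S C} := by
    refine ⟨∅, by simp, by simp, by simp, ?_⟩
    exact le_antisymm (cRadius_nonneg _ _) (cRadius_le le_rfl 0 (by simp))
  apply le_antisymm
  · apply csSup_le ⟨0, hempty⟩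
    rintro r ⟨S, hS, -, -, rfl⟩
    exact cRadius_mono hC hP hS
  · have hr0 : 0 ≤ coreRadius 1 P C := le_csSup hbdd hempty
    set r := coreRadius 1 P C with hr
    have hw : ∀ x ∈ P, ∀ y ∈ P, ∀ i, L.symm x i - L.symm y i ≤ 2 * r := by
      intro x hx y hy i
      have h1 : cRadius {x, y} C ≤ r := by
        apply le_csSup hbdd
        refine ⟨{x, y}, ?_, by simp, Set.ncard_insert_le x {y} |>.trans (by simp), rfl⟩
        rintro z (rfl | rfl) <;> assumption
      have h2 : (L.symm x i - L.symm y i) / 2 ≤ cRadius {x, y} C := by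
        apply le_csInf (cRadius_set_nonempty hC (Set.toFinite _).isCompact)
        rintro ρ ⟨h0, c, hc⟩
        obtain ⟨a, ha, rfl⟩ := (mem_tr _ _ _ _).1 (hc (by simp : x ∈ ({x, y} : Set (EE d))))
        obtain ⟨b, hb, rfl⟩ := (mem_tr _ _ _ _).1 (hc (by simp : y ∈ ({c + ρ • a, y} : Set (EE d))))
        rw [hf] at ha hb
        obtain ⟨a, ha, rfl⟩ := ha
        obtain ⟨b, hb, rfl⟩ := hb
        have := (ha i).2
        have := (hb i).1
        simp only [hfx, map_add, map_smul, PiLp.add_apply, PiLp.smul_apply, smul_eq_mul,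
          LinearEquiv.symm_apply_apply]
        nlinarith
      linarith
    obtain ⟨x0, hx0⟩ := hne
    let m : EE d := WithLp.toLp 2 fun i => sSup ((fun x => L.symm x i) '' P) - r
    have hm : ∀ i, m i = sSup ((fun x => L.symm x i) '' P) - r := fun i => rfl
    refine cRadius_le hr0 (L m - r • v) fun x hx => ?_
    have hz : ∀ i, |L.symm x i - m i| ≤ r := by
      intro i
      have h1 : L.symm x i ≤ sSup ((fun x => L.symm x i) '' P) := by
        apply le_csSup ⟨L.symm x0 i + 2 * r, ?_⟩ (Set.mem_image_of_mem (fun x => L.symm x i) hx)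
        rintro _ ⟨y, hy, rfl⟩
        have := hw y hy x0 hx0 i
        simp only
        linarith
      have h2 : sSup ((fun x => L.symm x i) '' P) ≤ L.symm x i + 2 * r := by
        apply csSup_le ⟨_, Set.mem_image_of_mem (fun x => L.symm x i) hx⟩
        rintro _ ⟨y, hy, rfl⟩
        have := hw y hy x hx i
        simp only
        linarith
      rw [abs_le, hm]
      constructor <;> linarith
    refine ⟨f (r⁻¹ • (L.symm x - m)), ?_, ?_⟩
    · rw [hf]
      refine ⟨_, fun i => ?_, rfl⟩
      rw [Set.mem_Icc, ← abs_le]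
      simp only [PiLp.smul_apply, PiLp.sub_apply, smul_eq_mul, abs_mul, abs_inv, abs_of_nonneg hr0]
      rw [inv_mul_eq_div]
      exact div_le_one_of_le₀ (hz i) hr0
    · have : r • (r⁻¹ • (L.symm x - m)) = L.symm x - m := by
        rcases hr0.eq_or_lt with h | h
        · have : L.symm x - m = 0 := by
            ext i
            have := hz i
            rw [← h] at this
            simpa using abs_nonpos_iff.1 this
          rw [this]; simp
        · rw [smul_inv_smul₀ h.ne']
      rw [hfx, smul_add, ← map_smul, this, map_sub, LinearEquiv.apply_symm_apply]
      abel

lemma helly_of {d : ℕ} {C : Set (EE d)} (hC : IsContainer C)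
    (h : ∀ P : Set (EE d), P.Nonempty → IsCompact P → Convex ℝ P →
      coreRadius 1 P C = cRadius P C)
    (P : Set (EE d)) (hne : P.Nonempty) (hP : IsCompact P) (hcv : Convex ℝ P) (r : ℝ) (hr : 0 ≤ r)
    (hxy : ∀ x ∈ P, ∀ y ∈ P, ∃ a ∈ C, ∃ b ∈ C, x - y = r • (a - b)) (r' : ℝ) (hr' : r < r') :
    ∃ c, ∀ x ∈ P, ∃ z ∈ C, c + r' • z = x := by
  have h0C : (0 : EE d) ∈ C := interior_subset hC.2.2
  have h1 : cRadius P C ≤ r := by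
    rw [← h P hne hP hcv]
    apply csSup_le
    · exact ⟨_, ∅, by simp, by simp, by simp, rfl⟩
    rintro ρ ⟨S, hSP, hSf, hS, rfl⟩
    have key : ∀ x ∈ P, ∀ y ∈ P, S ⊆ {x, y} → cRadius S C ≤ r := by
      intro x hx y hy hS
      obtain ⟨a, ha, b, hb, hab⟩ := hxy x hx y hy
      refine cRadius_le hr (x - r • a) fun w hw => ?_
      rcases hS hw with rfl | hw
      · exact ⟨a, ha, by simp⟩
      · refine ⟨b, hb, ?_⟩
        rw [Set.mem_singleton_iff] at hw
        subst hw
        rw [smul_sub] at hab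
        have : w = x - (r • a - r • b) := by rw [← hab]; abel
        rw [this]; abel
    rcases S.eq_empty_or_nonempty with rfl | ⟨x, hx⟩
    · obtain ⟨x, hx⟩ := hne
      exact key x hx x hx (by simp)
    · have h3 : (S \ {x}).ncard ≤ 1 := by
        have := Set.ncard_sdiff_singleton_add_one hx hSf
        omega
      rcases (S \ {x}).eq_empty_or_nonempty with h4 | ⟨y, hy⟩
      · refine key x (hSP hx) x (hSP hx) fun w hw => ?_
        by_contra hne
        have : w ∈ S \ {x} := ⟨hw, by simpa using hne⟩
        simp [h4] at this
      · refine key x (hSP hx) y (hSP hy.1) fun w hw => ?_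
        by_cases hwx : w = x
        · simp [hwx]
        · right
          exact (Set.ncard_le_one (hSf.sdiff)).1 h3 w ⟨hw, hwx⟩ y hy
  obtain ⟨ρ, ⟨h0, c, hc⟩, hρ⟩ := exists_lt_of_csInf_lt (cRadius_set_nonempty hC hP) (h1.trans_lt hr')
  refine ⟨c, fun x hx => ?_⟩
  obtain ⟨z, hz, rfl⟩ := (mem_tr _ _ _ _).1 (hc hx)
  have hr'0 : 0 < r' := hr.trans_lt hr'
  refine ⟨(ρ / r') • z, ?_, ?_⟩
  · exact hC.2.1.smul_mem_of_zero_mem h0C hz ⟨by positivity, div_le_one_of_le₀ hρ.le hr'0.le⟩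
  · rw [smul_smul, mul_div_cancel₀ _ hr'0.ne']

lemma limit_of {d : ℕ} {C : Set (EE d)} (hC : IsCompact C) (P : Set (EE d)) (hne : P.Nonempty)
    (h : ∀ r' : ℝ, 1 < r' → ∃ c, ∀ x ∈ P, ∃ z ∈ C, c + r' • z = x) :
    ∃ c, ∀ x ∈ P, x - c ∈ C := by
  obtain ⟨x0, hx0⟩ := hne
  let r : ℕ → ℝ := fun n => 1 + 1 / ((n : ℝ) + 1)
  have hr1 : ∀ n, 1 < r n := fun n => by
    have : 0 < 1 / ((n : ℝ) + 1) := by positivity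
    simp only [r]; linarith
  have hr : Filter.Tendsto r Filter.atTop (nhds 1) := by
    have h := (tendsto_one_div_add_atTop_nhds_zero_nat (𝕜 := ℝ)).const_add 1
    rwa [add_zero] at h
  choose c hc using fun n => h (r n) (hr1 n)
  choose z hz hzx using fun n => hc n x0 hx0
  obtain ⟨z0, hz0, φ, hφ, hlim⟩ := hC.tendsto_subseq hz
  have hrφ := hr.comp hφ.tendsto_atTop
  have hcl : Filter.Tendsto (fun n => c (φ n)) Filter.atTop (nhds (x0 - z0)) := by
    have h1 : (fun n => c (φ n)) = fun n => x0 - (r ∘ φ) n • (z ∘ φ) n := by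
      funext n
      rw [← hzx (φ n)]; simp
    rw [h1]
    simpa using tendsto_const_nhds.sub (hrφ.smul hlim)
  refine ⟨x0 - z0, fun x hx => ?_⟩
  have h2 : Filter.Tendsto (fun n => ((r ∘ φ) n)⁻¹ • (x - c (φ n))) Filter.atTop
      (nhds (x - (x0 - z0))) := by
    simpa using (hrφ.inv₀ one_ne_zero).smul (hcl.const_sub x)
  refine hC.isClosed.mem_of_tendsto h2 (Filter.Eventually.of_forall fun n => ?_)
  obtain ⟨w, hw, hwx⟩ := hc (φ n) x hx
  have : ((r ∘ φ) n)⁻¹ • (x - c (φ n)) = w := by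
    rw [← hwx, add_sub_cancel_left, Function.comp, inv_smul_smul₀ (by linarith [hr1 (φ n)])]
  rwa [this]

/-- functionals supporting `g` at a smooth point. -/
def SmoothFun {d : ℕ} (g : EE d → ℝ) (u : EE d →ₗ[ℝ] ℝ) : Prop :=
  (∀ x, u x ≤ g x) ∧ ∃ p, g p = 1 ∧ u p = 1 ∧
    ∀ v : EE d →ₗ[ℝ] ℝ, (∀ x, v x ≤ g x) → v p = 1 → v = u

lemma hb {d : ℕ} (g : EE d → ℝ) (hadd : ∀ x y, g (x + y) ≤ g x + g y)
    (hsmul : ∀ (t : ℝ) x, g (t • x) = |t| * g x) (p : EE d) :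
    ∃ v : EE d →ₗ[ℝ] ℝ, (∀ x, v x ≤ g x) ∧ v p = g p := by
  have hg0 : g 0 = 0 := by simpa using hsmul 0 0
  have hnn : ∀ x, 0 ≤ g x := fun x => by
    have h1 := hadd x (-x)
    have h2 := hsmul (-1) x
    simp at h1 h2
    linarith
  by_cases hp : p = 0
  · exact ⟨0, by simpa using hnn, by simp [hp, hg0]⟩
  let f : EE d →ₗ.[ℝ] ℝ := LinearPMap.mkSpanSingleton p (g p) hp
  obtain ⟨v, hv, hv'⟩ := exists_extension_of_le_sublinear f g
    (fun c hc x => by rw [hsmul, abs_of_pos hc]) hadd (by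
      rintro ⟨x, hx⟩
      obtain ⟨t, rfl⟩ := Submodule.mem_span_singleton.1 hx
      have h1 : f ⟨t • p, hx⟩ = t • g p := LinearPMap.mkSpanSingleton'_apply p (g p) _ t hx
      rw [h1, hsmul, smul_eq_mul]
      exact mul_le_mul_of_nonneg_right (le_abs_self t) (hnn p))
  refine ⟨v, hv', ?_⟩
  have hmem : p ∈ f.domain := Submodule.mem_span_singleton.2 ⟨1, by simp⟩
  have := hv ⟨p, hmem⟩
  simp only at this
  rw [this]
  exact LinearPMap.mkSpanSingleton_apply ℝ ℝ hp _

lemma smoothFun_neg {d : ℕ} {g : EE d → ℝ} (hsmul : ∀ (t : ℝ) x, g (t • x) = |t| * g x)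
    {u : EE d →ₗ[ℝ] ℝ} (hu : SmoothFun g u) : SmoothFun g (-u) := by
  have heven : ∀ x, g (-x) = g x := fun x => by simpa using hsmul (-1) x
  obtain ⟨h1, p, hp, hup, huniq⟩ := hu
  refine ⟨fun x => ?_, -p, by rw [heven, hp], by simp [hup], fun v hv hvp => ?_⟩
  · have := h1 (-x)
    rw [heven, map_neg] at this
    simpa using this
  · rw [← huniq (-v) (fun x => ?_) (by simpa using hvp), neg_neg]
    have := hv (-x)
    rw [heven, map_neg] at this
    simpa using this

lemma smooth_dense {d : ℕ} (g : EE d → ℝ) (hadd : ∀ x y, g (x + y) ≤ g x + g y)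
    (hsmul : ∀ (t : ℝ) x, g (t • x) = |t| * g x) (hpos : ∀ x, x ≠ 0 → 0 < g x)
    (K : NNReal) (hlip : LipschitzWith K g) (y : EE d) (hy : y ≠ 0) (ε : ℝ) (hε : 0 < ε) :
    ∃ u, SmoothFun g u ∧ g y - ε ≤ u y := by
  have heven : ∀ x, g (-x) = g x := fun x => by simpa using hsmul (-1) x
  have hg0 : g 0 = 0 := by simpa using hsmul 0 0
  have hd : Dense {x | DifferentiableAt ℝ g x} :=
    MeasureTheory.Measure.dense_of_ae (hlip.ae_differentiableAt (μ := MeasureTheory.volume))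
  have hδ : 0 < min ‖y‖ (ε / (2 * (K + 1))) := lt_min (norm_pos_iff.2 hy) (by positivity)
  obtain ⟨p, hp, hpy⟩ := hd.exists_dist_lt y hδ
  have hpy1 : dist y p < ‖y‖ := hpy.trans_le (min_le_left _ _)
  have hpy2 : dist y p < ε / (2 * (K + 1)) := hpy.trans_le (min_le_right _ _)
  have hp0 : p ≠ 0 := by
    rintro rfl
    simp at hpy1
  have hgp := hpos p hp0
  obtain ⟨v, hv, hvp⟩ := hb g hadd hsmul p
  have huniq : ∀ w : EE d →ₗ[ℝ] ℝ, (∀ x, w x ≤ g x) → w p = g p →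
      LinearMap.toContinuousLinearMap w = fderiv ℝ g p := by
    intro w hw hwp
    have hmin : IsLocalMin (fun x => g x - LinearMap.toContinuousLinearMap w x) p := by
      refine Filter.Eventually.of_forall fun x => ?_
      have := hw x
      simp only [LinearMap.coe_toContinuousLinearMap']
      linarith
    have hder := (DifferentiableAt.hasFDerivAt hp).sub
      (LinearMap.toContinuousLinearMap w).hasFDerivAt (x := p)
    have := hmin.hasFDerivAt_eq_zero hder
    exact (sub_eq_zero.1 this).symm
  refine ⟨v, ⟨hv, (g p)⁻¹ • p, ?_, ?_, ?_⟩, ?_⟩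
  · rw [hsmul, abs_of_pos (inv_pos.2 hgp), inv_mul_cancel₀ hgp.ne']
  · rw [map_smul, hvp, smul_eq_mul, inv_mul_cancel₀ hgp.ne']
  · intro w hw hwp
    have hwp' : w p = g p := by
      rw [map_smul, smul_eq_mul] at hwp
      field_simp at hwp
      exact hwp
    have := (huniq w hw hwp').trans (huniq v hv hvp).symm
    exact LinearMap.toContinuousLinearMap.injective this
  · have h1 : g (p - y) ≤ K * dist y p := by
      have := hlip.dist_le_mul (p - y) 0
      rw [hg0, Real.dist_eq, sub_zero, dist_zero_right] at this
      rw [dist_comm, dist_eq_norm]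
      exact (le_abs_self _).trans this
    have h2 : g y ≤ g p + g (p - y) := by
      have := hadd p (y - p)
      rw [add_sub_cancel, ← heven (y - p), neg_sub] at this
      exact this
    have h3 : v p - v y ≤ g (p - y) := by
      rw [← map_sub]; exact hv _
    have h4 : K * dist y p ≤ ε / 2 := by
      rw [lt_div_iff₀ (by positivity)] at hpy2
      have : (0:ℝ) ≤ dist y p := dist_nonneg
      nlinarith
    linarith

lemma pos_of {d : ℕ} (g : EE d → ℝ) (hadd : ∀ x y, g (x + y) ≤ g x + g y)
    (hsmul : ∀ (t : ℝ) x, g (t • x) = |t| * g x)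
    (hH : ∀ S : Set (EE d), S.Finite → S.Nonempty → (∀ x ∈ S, ∀ y ∈ S, g (x - y) < 2) →
      ∃ c, ∃ r < 1, ∀ x ∈ S, g (x - c) ≤ r)
    (T : Set (EE d →ₗ[ℝ] ℝ)) (hT : T.Finite) (hTU : ∀ u ∈ T, SmoothFun g u)
    (hneg : ∀ u ∈ T, -u ∉ T) : ∃ c, ∀ u ∈ T, 0 < u c := by
  have heven : ∀ x, g (-x) = g x := fun x => by simpa using hsmul (-1) x
  rcases T.eq_empty_or_nonempty with rfl | hne
  · exact ⟨0, by simp⟩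
  have : ∀ u : EE d →ₗ[ℝ] ℝ, ∃ p, u ∈ T → g p = 1 ∧ u p = 1 ∧
    ∀ v : EE d →ₗ[ℝ] ℝ, (∀ x, v x ≤ g x) → v p = 1 → v = u := by
    intro u
    by_cases hu : u ∈ T
    · obtain ⟨_, p, h⟩ := hTU u hu
      exact ⟨p, fun _ => h⟩
    · exact ⟨0, fun h => absurd h hu⟩
  choose p hp using this
  obtain ⟨c, r, hr, hc⟩ := hH (p '' T) (hT.image p) (hne.image p) (by
    rintro _ ⟨u, hu, rfl⟩ _ ⟨v, hv, rfl⟩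
    by_contra! hlt
    obtain ⟨w, hw, hwp⟩ := hb g hadd hsmul (p u - p v)
    obtain ⟨hu1, hu2, hu3⟩ := hp u hu
    obtain ⟨hv1, hv2, hv3⟩ := hp v hv
    have h1 := hw (p u)
    have h2 := hw (-(p v))
    rw [heven, map_neg] at h2
    rw [map_sub] at hwp
    have e1 : w = u := hu3 w hw (by linarith)
    have e2 : -w = v := hv3 (-w) (fun x => by
      have := hw (-x)
      rw [heven, map_neg] at this
      simpa using this) (by simp only [LinearMap.neg_apply]; linarith)
    apply hneg u hu
    rw [← e1, e2]
    exact hv)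
  refine ⟨c, fun u hu => ?_⟩
  have h1 := hc (p u) ⟨u, hu, rfl⟩
  have h2 := (hTU u hu).1 (p u - c)
  rw [map_sub, (hp u hu).2.1] at h2
  linarith

lemma exists_basis {d : ℕ} (g : EE d → ℝ) (hadd : ∀ x y, g (x + y) ≤ g x + g y)
    (hsmul : ∀ (t : ℝ) x, g (t • x) = |t| * g x)
    (hH : ∀ S : Set (EE d), S.Finite → S.Nonempty → (∀ x ∈ S, ∀ y ∈ S, g (x - y) < 2) →
      ∃ c, ∃ r < 1, ∀ x ∈ S, g (x - c) ≤ r) :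
    ∃ B : Set (EE d →ₗ[ℝ] ℝ), LinearIndependent ℝ (Subtype.val : B → (EE d →ₗ[ℝ] ℝ)) ∧
      (∀ b ∈ B, SmoothFun g b) ∧ ∀ u, SmoothFun g u → u ∈ B ∨ -u ∈ B := by
  classical
  obtain ⟨B, hBU, hspan, hli⟩ := exists_linearIndependent ℝ {u | SmoothFun g u}
  refine ⟨B, hli, hBU, fun u hu => ?_⟩
  by_contra! hcon
  obtain ⟨hu1, hu2⟩ := hcon
  have hfin : B.Finite := hli.setFinite
  have hself : ∀ w, SmoothFun g w → w ≠ -w := by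
    rintro w ⟨-, p, -, h, -⟩ hw
    have := congrArg (fun l : EE d →ₗ[ℝ] ℝ => l p) hw
    simp only [LinearMap.neg_apply, h] at this
    norm_num at this
  have hbb : ∀ b ∈ B, ∀ b' ∈ B, b ≠ -b' := by
    intro b hb b' hb' h
    by_cases hbb : b = b'
    · subst hbb
      exact hself b (hBU hb) h
    · have hli' : LinearIndepOn ℝ id B := hli
      have hp : LinearIndepOn ℝ id ({b, b'} : Set (EE d →ₗ[ℝ] ℝ)) :=
        hli'.mono (by rintro z (rfl | rfl) <;> assumption)
      rw [LinearIndepOn.pair_iff id hbb] at hp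
      have := (hp 1 1 (by simp [h])).1
      norm_num at this
  have hmem : u ∈ Submodule.span ℝ (hfin.toFinset : Set (EE d →ₗ[ℝ] ℝ)) := by
    rw [hfin.coe_toFinset, hspan]; exact Submodule.subset_span hu
  obtain ⟨a, -, ha⟩ := Submodule.mem_span_finset.1 hmem
  let σ : (EE d →ₗ[ℝ] ℝ) → (EE d →ₗ[ℝ] ℝ) := fun b => if 0 < a b then -b else b
  have hσ : ∀ b, σ b = b ∨ σ b = -b := fun b => by
    simp only [σ]; split_ifs <;> simp
  obtain ⟨c, hc⟩ := pos_of g hadd hsmul hH (insert u (σ '' B)) ((hfin.image σ).insert u) (by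
      rintro w (rfl | ⟨b, hb, rfl⟩)
      · exact hu
      · rcases hσ b with h | h <;> rw [h]
        · exact hBU hb
        · exact smoothFun_neg hsmul (hBU hb)) (by
      rintro w (rfl | ⟨b, hb, rfl⟩)
      · rintro (h | ⟨b, hb, h⟩)
        · exact hself w hu h.symm
        · rcases hσ b with h' | h' <;> rw [h'] at h
          · exact hu2 (h ▸ hb)
          · exact hu1 (neg_injective h ▸ hb)
      · rintro (h | ⟨b', hb', h⟩)
        · rcases hσ b with h' | h' <;> rw [h'] at h
          · exact hu2 (by rw [← h, neg_neg]; exact hb)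
          · exact hu1 (by rw [← h, neg_neg]; exact hb)
        · have h1 := hbb b hb b' hb'
          have h2 := hbb b hb b hb
          have h3 := hbb b' hb' b' hb'
          by_cases e : b = b'
          · subst e
            rcases hσ b with h' | h' <;> rw [h'] at h
            · exact h2 h
            · exact h2 (by rw [← neg_neg (-b), ← h, neg_neg])
          · rcases hσ b with h' | h' <;> rcases hσ b' with h'' | h'' <;> rw [h', h''] at h
            · exact h1 (by rw [h, neg_neg])
            · exact e (neg_injective h).symm
            · exact e (by rw [h, neg_neg])
            · exact h1 (by rw [h, neg_neg]))
  have h1 := hc u (by simp)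
  rw [← ha, LinearMap.sum_apply] at h1
  refine absurd h1 (not_lt.2 (Finset.sum_nonpos fun b hb => ?_))
  have h2 := hc (σ b) (Or.inr ⟨b, by simpa using hb, rfl⟩)
  simp only [σ] at h2
  rw [LinearMap.smul_apply, smul_eq_mul]
  split_ifs at h2 with h3
  · simp only [LinearMap.neg_apply] at h2
    nlinarith
  · nlinarith

lemma final_step {d : ℕ} (g : EE d → ℝ) (hadd : ∀ x y, g (x + y) ≤ g x + g y)
    (hsmul : ∀ (t : ℝ) x, g (t • x) = |t| * g x) (hpos : ∀ x, x ≠ 0 → 0 < g x)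
    (K : NNReal) (hlip : LipschitzWith K g)
    (hH : ∀ S : Set (EE d), S.Finite → S.Nonempty → (∀ x ∈ S, ∀ y ∈ S, g (x - y) < 2) →
      ∃ c, ∃ r < 1, ∀ x ∈ S, g (x - c) ≤ r) :
    ∃ Φ : EE d ≃ₗ[ℝ] EE d, ∀ x, g x ≤ 1 ↔ ∀ i, Φ x i ∈ Set.Icc (-1 : ℝ) 1 := by
  classical
  obtain ⟨B, hli, hBU, hB⟩ := exists_basis g hadd hsmul hH
  have hg0 : g 0 = 0 := by simpa using hsmul 0 0
  have heven : ∀ x, g (-x) = g x := fun x => by simpa using hsmul (-1) x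
  have hfin : B.Finite := hli.setFinite
  have := hfin.fintype
  have key : ∀ (y : EE d) (r : ℝ), 0 ≤ r → (∀ b ∈ B, |b y| ≤ r) → g y ≤ r := by
    intro y r hr h
    by_cases hy : y = 0
    · rw [hy, hg0]; exact hr
    refine le_of_forall_pos_le_add fun ε hε => ?_
    obtain ⟨u, hu, huy⟩ := smooth_dense g hadd hsmul hpos K hlip y hy ε hε
    have : u y ≤ r := by
      rcases hB u hu with h' | h'
      · exact (le_abs_self _).trans (h u h')
      · have := h _ h'
        rw [LinearMap.neg_apply, abs_neg] at this
        exact (le_abs_self _).trans this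
    linarith
  have hcard1 : Fintype.card B ≤ d := by
    have := hli.fintype_card_le_finrank
    rwa [Subspace.dual_finrank_eq, finrank_euclideanSpace_fin] at this
  let Ψ : EE d →ₗ[ℝ] (B → ℝ) := LinearMap.pi fun b => b.1
  have hΨ : Function.Injective Ψ := by
    rw [← LinearMap.ker_eq_bot, LinearMap.ker_eq_bot']
    intro y hy
    by_contra hne
    have := key y 0 le_rfl (fun b hb => by
      have := congrFun hy ⟨b, hb⟩
      simp only [Ψ, LinearMap.pi_apply, Pi.zero_apply] at this
      simp [this])
    linarith [hpos y hne]
  have hcard2 : d ≤ Fintype.card B := by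
    have := LinearMap.finrank_le_finrank_of_injective hΨ
    simpa using this
  let e : Fin d ≃ B := (Fintype.equivFinOfCardEq (le_antisymm hcard1 hcard2)).symm
  let Φ0 : EE d →ₗ[ℝ] EE d :=
    (WithLp.linearEquiv 2 ℝ (Fin d → ℝ)).symm.toLinearMap ∘ₗ LinearMap.pi fun i => (e i).1
  have hΦ0 : ∀ x i, Φ0 x i = (e i).1 x := fun x i => rfl
  have hinj : Function.Injective Φ0 := by
    intro x y hxy
    apply hΨ
    funext b
    have : Φ0 x (e.symm b) = Φ0 y (e.symm b) := by rw [hxy]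
    simpa [hΦ0, Ψ] using this
  refine ⟨LinearEquiv.ofInjectiveEndo Φ0 hinj, fun x => ?_⟩
  simp only [LinearEquiv.coe_ofInjectiveEndo, hΦ0]
  constructor
  · intro h i
    have h1 := (hBU _ (e i).2).1 x
    have h2 := (hBU _ (e i).2).1 (-x)
    rw [heven, map_neg] at h2
    constructor <;> linarith
  · intro h
    refine key x 1 zero_le_one fun b hb => ?_
    have := h (e.symm ⟨b, hb⟩)
    rw [Equiv.apply_symm_apply] at this
    exact abs_le.2 this

lemma forward {d : ℕ} {C : Set (EE d)} (hC : IsContainer C)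
    (h : ∀ P : Set (EE d), P.Nonempty → IsCompact P → Convex ℝ P →
      coreRadius 1 P C = cRadius P C) : IsParallelotope C := by
  have h0C : (0 : EE d) ∈ C := interior_subset hC.2.2
  -- central symmetry
  obtain ⟨c, hc⟩ : ∃ c, ∀ x ∈ -C, x - c ∈ C := by
    refine limit_of hC.1 (-C) ⟨0, by simpa using h0C⟩ fun r' hr' => ?_
    refine helly_of hC h (-C) ⟨0, by simpa using h0C⟩ hC.1.neg hC.2.1.neg 1 zero_le_one ?_ r' hr'
    intro x hx y hy
    exact ⟨-y, hy, -x, hx, by simp; abel⟩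
  obtain ⟨m, hm⟩ : ∃ m : EE d, c = -((2 : ℝ) • m) := ⟨-((1 / 2 : ℝ) • c), by
    rw [smul_neg, neg_neg, smul_smul]; norm_num⟩
  subst hm
  let C0 : Set (EE d) := (fun x => x + m) ⁻¹' C
  have hmem : ∀ x, x ∈ C0 ↔ x + m ∈ C := fun x => Iff.rfl
  have hsymm : ∀ x ∈ C0, -x ∈ C0 := by
    intro x hx
    have := hc (-(x + m)) (by simpa using (hmem x).1 hx)
    rw [hmem]
    convert this using 1
    rw [two_smul]; abel
  have hcomp : IsCompact C0 := (Homeomorph.addRight m).isCompact_preimage.2 hC.1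
  have hconv : Convex ℝ C0 := hC.2.1.translate_preimage_left m
  have hmint : m ∈ interior C := by
    have h2m : (2 : ℝ) • m ∈ C := by simpa using hc 0 (by simpa using h0C)
    have := hC.2.1.combo_interior_self_mem_interior hC.2.2 h2m (a := 1 / 2) (b := 1 / 2)
      (by norm_num) (by norm_num) (by norm_num)
    rw [smul_zero, zero_add, smul_smul] at this
    norm_num at this
    exact this
  have hnhds : C0 ∈ nhds (0 : EE d) := by
    have hcont : ContinuousAt (fun x : EE d => x + m) 0 := by fun_prop
    apply hcont
    simpa using mem_interior_iff_mem_nhds.1 hmint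
  have habs : Absorbent ℝ C0 := absorbent_nhds_zero hnhds
  have h00 : (0 : EE d) ∈ C0 := mem_of_mem_nhds hnhds
  have hbal : Balanced ℝ C0 := by
    intro t ht
    rintro _ ⟨x, hx, rfl⟩
    rw [Real.norm_eq_abs] at ht
    rcases le_total 0 t with h0 | h0
    · rw [abs_of_nonneg h0] at ht
      exact hconv.smul_mem_of_zero_mem h00 hx ⟨h0, ht⟩
    · rw [abs_of_nonpos h0] at ht
      have := hconv.smul_mem_of_zero_mem h00 (hsymm x hx) ⟨neg_nonneg.2 h0, ht⟩
      simpa using this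
  have hadd := gauge_add_le hconv habs
  have hsmul : ∀ (t : ℝ) x, gauge C0 (t • x) = |t| * gauge C0 x := fun t x => by
    rw [gauge_smul hbal, Real.norm_eq_abs]
  have hpos : ∀ x, x ≠ 0 → 0 < gauge C0 x := fun x hx =>
    (gauge_pos habs (NormedSpace.isVonNBounded_of_isBounded ℝ hcomp.isBounded)).2 hx
  have hle : ∀ x, gauge C0 x ≤ 1 ↔ x ∈ C0 := fun x => by
    rw [gauge_le_one_iff_mem_closure hconv hnhds, hcomp.isClosed.closure_eq]
  have hle' : ∀ (r : ℝ) (_ : 0 < r) x, gauge C0 x ≤ r ↔ r⁻¹ • x ∈ C0 := fun r hr x => by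
    rw [← hle, hsmul, abs_of_pos (inv_pos.2 hr), inv_mul_le_iff₀ hr, mul_one]
  obtain ⟨K, hK⟩ := hconv.lipschitz_gauge hnhds
  obtain ⟨Φ, hΦ⟩ := final_step (gauge C0) hadd hsmul hpos K hK (by
    intro S hS hne hlt
    obtain ⟨q, hq, hmax⟩ := Set.exists_max_image (S ×ˢ S) (fun q => gauge C0 (q.1 - q.2))
      (hS.prod hS) (hne.prod hne)
    have hq2 : gauge C0 (q.1 - q.2) < 2 := hlt _ hq.1 _ hq.2
    have hq0 : 0 ≤ gauge C0 (q.1 - q.2) := gauge_nonneg _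
    set M := gauge C0 (q.1 - q.2) with hM
    obtain ⟨r, hr1, hr2⟩ := exists_between (show M / 2 < 1 by linarith)
    obtain ⟨r', hr'1, hr'2⟩ := exists_between hr2
    have hr0 : 0 < r := by linarith
    obtain ⟨c, hc⟩ := helly_of hC h (convexHull ℝ S) hne.convexHull
      (hS.isCompact_convexHull ℝ) (convex_convexHull ℝ S) r hr0.le (by
        intro x hx y hy
        have hsub : convexHull ℝ (S - S) ⊆ {z | gauge C0 z ≤ 2 * r} := by
          apply convexHull_min
          · rintro _ ⟨x, hx, y, hy, rfl⟩
            have := hmax (x, y) ⟨hx, hy⟩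
            simp only at this
            simp only [Set.mem_ofPred_eq]
            linarith
          · exact hconv.setOfPred_gauge_le h00 habs _
        have hxy : gauge C0 (x - y) ≤ 2 * r := hsub (by
          rw [convexHull_sub]; exact Set.sub_mem_sub hx hy)
        rw [hle' _ (by positivity)] at hxy
        refine ⟨_, hxy, _, hsymm _ hxy, ?_⟩
        rw [add_sub_add_right_eq_sub, sub_neg_eq_add, ← two_smul ℝ, smul_smul, smul_smul]
        have : r * (2 * (2 * r)⁻¹) = 1 := by field_simp
        rw [← mul_assoc] at this
        rw [this, one_smul]) r' hr'1
    refine ⟨c + r' • m, r', hr'2, fun x hx => ?_⟩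
    obtain ⟨z, hz, rfl⟩ := hc x (subset_convexHull ℝ S hx)
    have hr'0 : 0 < r' := by linarith
    rw [hle' _ hr'0, add_sub_add_left_eq_sub, ← smul_sub, inv_smul_smul₀ hr'0.ne', hmem]
    simpa using hz)
  refine ⟨Φ.symm.toAffineEquiv.trans (AffineEquiv.constVAdd ℝ (EE d) m), ?_⟩
  ext x
  have hx : x ∈ C ↔ x - m ∈ C0 := by rw [hmem, sub_add_cancel]
  rw [hx, ← hle, hΦ]
  constructor
  · intro h
    exact ⟨Φ (x - m), h, by simp⟩
  · rintro ⟨y, hy, rfl⟩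
    simpa using hy

theorem parallelotope_characterization {d : ℕ} (C : Set (EuclideanSpace ℝ (Fin d)))
    (hC : IsContainer C) :
    (∀ P : Set (EuclideanSpace ℝ (Fin d)), P.Nonempty → IsCompact P → Convex ℝ P →
      coreRadius 1 P C = cRadius P C) ↔ IsParallelotope C := by
  exact ⟨forward hC, fun hp P hne hP _ => backward hC hp P hne hP⟩
end

section
/- (Henk's inequality in terms of core-radii) Let P ⊆ ℝ^d be a nonempty compact convex set and let k, l be natural numbers with 1 ≤ l ≤ k ≤ d. Then R_k(P, B^d) ≤ √(k(l+1)/(l(k+1))) · R_l(P, B^d), with equality when P = T^d is a regular d-simplex. -/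
open Set Pointwise

section HenkHelpers

variable {d : ℕ}

local notation "E" => EuclideanSpace ℝ (Fin d)

lemma hk_mem_iff (c : E) {r : ℝ} (hr : 0 ≤ r) (S : Set E) :
    S ⊆ c +ᵥ r • Metric.closedBall (0 : E) 1 ↔ ∀ x ∈ S, ‖x - c‖ ≤ r := by
  rw [smul_unitClosedBall_of_nonneg hr, Metric.vadd_closedBall]
  simp [Set.subset_def, Metric.mem_closedBall, dist_eq_norm]

lemma hk_cRadius_le {S : Set E} {c : E} {r : ℝ} (hr : 0 ≤ r) (h : ∀ x ∈ S, ‖x - c‖ ≤ r) :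
    cRadius S (Metric.closedBall (0 : E) 1) ≤ r := by
  apply csInf_le ⟨0, fun _ h => h.1⟩
  exact ⟨hr, c, (hk_mem_iff c hr S).2 h⟩

lemma hk_cRadius_nonneg (S : Set E) : 0 ≤ cRadius S (Metric.closedBall (0 : E) 1) :=
  Real.sInf_nonneg fun _ h => h.1

lemma hk_le_cRadius {S : Set E} (hS : S.Finite) {a : ℝ}
    (h : ∀ (c : E) (r : ℝ), 0 ≤ r → (∀ x ∈ S, ‖x - c‖ ≤ r) → a ≤ r) :
    a ≤ cRadius S (Metric.closedBall (0 : E) 1) := by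
  apply le_csInf
  · obtain ⟨M, hM⟩ := hS.isBounded.exists_norm_le
    refine ⟨max M 0, le_max_right _ _, 0, (hk_mem_iff 0 (le_max_right _ _) S).2 ?_⟩
    intro x hx
    simpa using Or.inl (hM x hx)
  · rintro r ⟨hr, c, hc⟩
    exact h c r hr ((hk_mem_iff c hr S).1 hc)

lemma hk_bdd {P : Set E} (hP : Bornology.IsBounded P) (k : ℕ) :
    BddAbove {r : ℝ | ∃ S : Set E, S ⊆ P ∧ S.Finite ∧ S.ncard ≤ k + 1 ∧
      r = cRadius S (Metric.closedBall (0 : E) 1)} := by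
  obtain ⟨M, hM⟩ := hP.exists_norm_le
  refine ⟨max M 0, ?_⟩
  rintro r ⟨S, hSP, -, -, rfl⟩
  refine hk_cRadius_le (c := 0) (le_max_right _ _) fun x hx => ?_
  simpa using Or.inl (hM x (hSP hx))

lemma hk_le_core {P : Set E} (hP : Bornology.IsBounded P) {k : ℕ} {S : Set E} (hS : S ⊆ P)
    (hf : S.Finite) (hc : S.ncard ≤ k + 1) :
    cRadius S (Metric.closedBall (0 : E) 1) ≤ coreRadius k P (Metric.closedBall (0 : E) 1) :=
  le_csSup (hk_bdd hP k) ⟨S, hS, hf, hc, rfl⟩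

lemma hk_core_nonneg (P : Set E) (k : ℕ) :
    0 ≤ coreRadius k P (Metric.closedBall (0 : E) 1) := by
  apply Real.sSup_nonneg
  rintro r ⟨S, -, -, -, rfl⟩
  exact hk_cRadius_nonneg S

lemma hk_core_le {P : Set E} {k : ℕ} {a : ℝ}
    (h : ∀ S : Set E, S ⊆ P → S.Finite → S.ncard ≤ k + 1 →
      cRadius S (Metric.closedBall (0 : E) 1) ≤ a) :
    coreRadius k P (Metric.closedBall (0 : E) 1) ≤ a := by
  apply csSup_le
  · exact ⟨_, ∅, Set.empty_subset _, Set.finite_empty, by simp, rfl⟩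
  · rintro r ⟨S, h1, h2, h3, rfl⟩
    exact h S h1 h2 h3

/-- weighted variance -/
noncomputable def hkVar {ι : Type*} [Fintype ι] (x : ι → E) (w : ι → ℝ) : ℝ :=
  ∑ i, w i * ‖x i‖ ^ 2 - ‖∑ i, w i • x i‖ ^ 2

lemma hk_var_id {ι : Type*} [Fintype ι] (x : ι → E) (w : ι → ℝ) (hw : ∑ i, w i = 1) (p : E) :
    ∑ i, w i * ‖x i - p‖ ^ 2 = hkVar x w + ‖(∑ i, w i • x i) - p‖ ^ 2 := by
  have h1 : ∑ i, w i * ‖x i - p‖ ^ 2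
      = ∑ i, w i * ‖x i‖ ^ 2 - 2 * inner ℝ (∑ i, w i • x i) p + ‖p‖ ^ 2 := by
    have : ∀ i, w i * ‖x i - p‖ ^ 2
        = w i * ‖x i‖ ^ 2 - 2 * inner ℝ (w i • x i) p + w i * ‖p‖ ^ 2 := by
      intro i
      rw [norm_sub_sq_real, real_inner_smul_left]; ring
    simp_rw [this]
    rw [Finset.sum_add_distrib, Finset.sum_sub_distrib, ← Finset.mul_sum, ← Finset.sum_mul, hw,
      sum_inner, one_mul]
  rw [h1, hkVar, norm_sub_sq_real]; ring

lemma hk_exists {ι : Type*} [Fintype ι] [Nonempty ι] (x : ι → E) :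
    ∃ w : ι → ℝ, (∀ i, 0 ≤ w i) ∧ ∑ i, w i = 1 ∧ 0 ≤ hkVar x w ∧
      ∀ i, ‖x i - ∑ j, w j • x j‖ ^ 2 ≤ hkVar x w := by
  classical
  obtain ⟨w, hw, hmax⟩ := (isCompact_stdSimplex ℝ ι).exists_isMaxOn
    ⟨_, single_mem_stdSimplex ℝ (Classical.arbitrary ι)⟩
    (f := hkVar x) (by unfold hkVar; fun_prop)
  set c := ∑ j, w j • x j with hc
  have hV := hk_var_id x w hw.2 c
  rw [← hc, sub_self, norm_zero] at hV
  have hV' : ∑ i, w i * ‖x i - c‖ ^ 2 = hkVar x w := by rw [hV]; ring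
  have hnn : 0 ≤ hkVar x w := by
    rw [← hV']; exact Finset.sum_nonneg fun i _ => mul_nonneg (hw.1 i) (by positivity)
  refine ⟨w, hw.1, hw.2, hnn, fun i => ?_⟩
  by_contra! hlt
  set a := ‖x i - c‖ ^ 2 with ha
  set V := hkVar x w with hVd
  have hapos : 0 < a := lt_of_le_of_lt hnn hlt
  obtain ⟨t, ht⟩ : ∃ t, t = (a - V) / (2 * a) := ⟨_, rfl⟩
  have hta : t * (2 * a) = a - V := by rw [ht]; field_simp
  have ht0 : 0 < t := by rw [ht]; apply div_pos <;> linarith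
  have ht1 : t ≤ 1 := by rw [ht, div_le_one (by linarith)]; linarith
  set w' : ι → ℝ := (1 - t) • w + t • Pi.single i 1 with hw'
  have hmem : w' ∈ stdSimplex ℝ ι :=
    convex_stdSimplex ℝ ι hw (single_mem_stdSimplex ℝ i) (by linarith) ht0.le (by ring)
  have hle : hkVar x w' ≤ V := hmax hmem
  have hid := hk_var_id x w' hmem.2 c
  have e1 : ∑ j, w' j * ‖x j - c‖ ^ 2 = (1 - t) * V + t * a := by
    rw [← hV', Finset.mul_sum]
    simp [hw', add_mul, Finset.sum_add_distrib, Pi.single_apply, ha, mul_assoc]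
  have e2 : ∑ j, w' j • x j - c = t • (x i - c) := by
    have : ∑ j, w' j • x j = (1 - t) • c + t • x i := by
      rw [hc, Finset.smul_sum]
      simp [hw', add_smul, Finset.sum_add_distrib, Pi.single_apply, mul_smul]
    rw [this]; module
  rw [e1, e2, norm_smul, mul_pow, ← ha, Real.norm_eq_abs, sq_abs] at hid
  have : t * (a - V) ≤ t * (t * a) := by nlinarith
  have := le_of_mul_le_mul_left this ht0
  linarith

lemma hk_step_set {S : Set E} (hS : S.Finite) {k : ℕ} (hk : 2 ≤ k) (hcard : S.ncard = k + 1) :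
    ∃ y ∈ S, cRadius S (Metric.closedBall (0 : E) 1) ≤
      Real.sqrt ((k : ℝ) ^ 2 / ((k : ℝ) ^ 2 - 1)) *
        cRadius (S \ {y}) (Metric.closedBall (0 : E) 1) := by
  classical
  have : Fintype S := hS.fintype
  have hne : S.Nonempty := by
    rw [Set.nonempty_iff_ne_empty]; rintro rfl; simp at hcard
  have : Nonempty S := hne.to_subtype
  have hk2 : (2 : ℝ) ≤ k := by exact_mod_cast hk
  have hcS : (Fintype.card S : ℝ) = k + 1 := by
    rw [← Nat.card_eq_fintype_card, Nat.card_coe_set_eq, hcard]; push_cast; ring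
  obtain ⟨w, hw0, hw1, hV0, hV⟩ := hk_exists (fun i : S => (i : E))
  set V := hkVar (fun i : S => (i : E)) w with hVd
  set c := ∑ j : S, w j • (j : E) with hc
  obtain ⟨i, hi⟩ := Finite.exists_min w
  have hmin : w i * (k + 1) ≤ 1 := by
    have : ∑ _j : S, w i ≤ ∑ j, w j := Finset.sum_le_sum fun j _ => hi j
    rw [hw1, Finset.sum_const, Finset.card_univ, nsmul_eq_mul, hcS] at this
    linarith
  obtain ⟨R, hR⟩ : ∃ R, R = Real.sqrt V := ⟨_, rfl⟩
  have hR0 : 0 ≤ R := hR ▸ Real.sqrt_nonneg _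
  have hR2 : R ^ 2 = V := by rw [hR]; exact Real.sq_sqrt hV0
  have hb : ∀ j : S, ‖(j : E) - c‖ ≤ R := fun j => abs_le_of_sq_le_sq' (by rw [hR2]; exact hV j) hR0 |>.2
  refine ⟨i, i.2, ?_⟩
  refine (hk_cRadius_le (c := c) hR0 fun x hx => hb ⟨x, hx⟩).trans ?_
  have hk1 : (0 : ℝ) < (k : ℝ) ^ 2 - 1 := by nlinarith
  have hq : 0 < Real.sqrt ((k : ℝ) ^ 2 / ((k : ℝ) ^ 2 - 1)) := Real.sqrt_pos.2 (by positivity)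
  rw [← div_le_iff₀' hq]
  apply hk_le_cRadius (hS.subset Set.sdiff_subset)
  intro p ρ hρ hp
  rw [div_le_iff₀' hq]
  refine (abs_le_of_sq_le_sq' ?_ (by positivity)).2
  rw [mul_pow, Real.sq_sqrt (by positivity), div_mul_eq_mul_div, le_div_iff₀ hk1]
  have hid := hk_var_id (fun i : S => (i : E)) w hw1 p
  rw [← Finset.add_sum_erase _ _ (Finset.mem_univ i)] at hid
  have hrest : ∑ j ∈ Finset.univ.erase i, w j * ‖(j : E) - p‖ ^ 2 ≤ (1 - w i) * ρ ^ 2 := by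
    have : (1 - w i) = ∑ j ∈ Finset.univ.erase i, w j := by
      rw [← hw1, ← Finset.add_sum_erase _ _ (Finset.mem_univ i)]; ring
    rw [this, Finset.sum_mul]
    apply Finset.sum_le_sum
    intro j hj
    apply mul_le_mul_of_nonneg_left _ (hw0 j)
    apply pow_le_pow_left₀ (norm_nonneg _)
    apply hp
    refine ⟨j.2, fun h => (Finset.ne_of_mem_erase hj) (Subtype.ext h)⟩
  rw [← hVd, ← hc, ← hR2] at hid
  have htri : ‖(i : E) - p‖ ≤ R + ‖c - p‖ := by
    have := norm_sub_le_norm_sub_add_norm_sub (i : E) c p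
    linarith [hb i]
  set t := ‖c - p‖
  set a := w i
  have ha0 : 0 ≤ a := hw0 i
  have h2 : ‖(i : E) - p‖ ^ 2 ≤ (R + t) ^ 2 := pow_le_pow_left₀ (norm_nonneg _) htri 2
  have h3 : R ^ 2 + t ^ 2 - a * (R + t) ^ 2 ≤ (1 - a) * ρ ^ 2 := by
    have := mul_le_mul_of_nonneg_left h2 ha0
    linarith
  have ha1 : 0 < 1 - a := by nlinarith
  have h4 : R ^ 2 * (1 - 2 * a) ≤ (1 - a) ^ 2 * ρ ^ 2 := by
    have := mul_le_mul_of_nonneg_left h3 ha1.le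
    nlinarith [sq_nonneg ((1 - a) * t - a * R)]
  have h5 : ((k : ℝ) ^ 2 - 1) * (1 - a) ^ 2 ≤ (k : ℝ) ^ 2 * (1 - 2 * a) := by
    have : k * a ≤ 1 - a := by linarith
    have : (k * a) ^ 2 ≤ (1 - a) ^ 2 := pow_le_pow_left₀ (by positivity) this 2
    nlinarith
  have h6 : (1 - a) ^ 2 * (R ^ 2 * ((k : ℝ) ^ 2 - 1)) ≤ (1 - a) ^ 2 * ((k : ℝ) ^ 2 * ρ ^ 2) := by
    have := mul_le_mul_of_nonneg_left h5 (sq_nonneg R)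
    have := mul_le_mul_of_nonneg_left h4 (sq_nonneg (k : ℝ))
    linarith
  exact le_of_mul_le_mul_left h6 (by positivity)

lemma hk_step {P : Set E} (hP : Bornology.IsBounded P) {k : ℕ} (hk : 1 ≤ k) :
    coreRadius (k + 1) P (Metric.closedBall (0 : E) 1) ≤
      Real.sqrt (((k : ℝ) + 1) ^ 2 / (((k : ℝ) + 1) ^ 2 - 1)) *
        coreRadius k P (Metric.closedBall (0 : E) 1) := by
  have hk1 : (1 : ℝ) ≤ k := by exact_mod_cast hk
  apply hk_core_le
  intro S hSP hS hc
  rcases Nat.lt_or_ge S.ncard (k + 2) with h | h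
  · refine (hk_le_core hP hSP hS (k := k) (by omega)).trans ?_
    apply le_mul_of_one_le_left (hk_core_nonneg P k)
    rw [Real.one_le_sqrt, one_le_div (by nlinarith)]
    linarith
  · have hcard : S.ncard = (k + 1) + 1 := by omega
    obtain ⟨y, hy, hle⟩ := hk_step_set hS (k := k + 1) (by omega) hcard
    push_cast at hle
    refine hle.trans (mul_le_mul_of_nonneg_left ?_ (Real.sqrt_nonneg _))
    apply hk_le_core hP (Set.sdiff_subset.trans hSP) (hS.subset Set.sdiff_subset)
    rw [Set.ncard_sdiff_singleton_of_mem hy]; omega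

lemma hk_ineq {P : Set E} (hP : Bornology.IsBounded P) {k l : ℕ} (hl : 1 ≤ l) (hlk : l ≤ k) :
    coreRadius k P (Metric.closedBall (0 : E) 1) ≤
      Real.sqrt ((k : ℝ) * ((l : ℝ) + 1) / ((l : ℝ) * ((k : ℝ) + 1))) *
        coreRadius l P (Metric.closedBall (0 : E) 1) := by
  have hl1 : (1 : ℝ) ≤ l := by exact_mod_cast hl
  induction k, hlk using Nat.le_induction with
  | base =>
    rw [div_self (by positivity)]; simp
  | succ k hk ih =>
    have hk1 : (1 : ℝ) ≤ k := by exact_mod_cast hl.trans hk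
    refine (hk_step hP (hl.trans hk)).trans ?_
    refine (mul_le_mul_of_nonneg_left ih (Real.sqrt_nonneg _)).trans ?_
    have h0 : (0 : ℝ) < ((k : ℝ) + 1) ^ 2 - 1 := by nlinarith
    rw [← mul_assoc, ← Real.sqrt_mul (by positivity)]
    apply le_of_eq
    congr 2
    push_cast
    have : ((k : ℝ) + 1) ^ 2 - 1 = k * (k + 2) := by ring
    rw [this]
    field_simp
    ring

lemma hk_core_one {P : Set E} {r : ℝ} (hr : 0 ≤ r) (h : ∀ x ∈ P, ∀ y ∈ P, dist x y ≤ r) :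
    coreRadius 1 P (Metric.closedBall (0 : E) 1) ≤ r / 2 := by
  apply hk_core_le
  intro S hSP hS hc
  have : ∃ c : E, ∀ x ∈ S, ‖x - c‖ ≤ r / 2 := by
    rcases Nat.lt_or_ge S.ncard 2 with h2 | h2
    · rcases (Set.ncard_le_one_iff_eq hS).1 (by omega) with rfl | ⟨a, rfl⟩
      · exact ⟨0, by simp⟩
      · exact ⟨a, by simp; positivity⟩
    · obtain ⟨a, b, -, rfl⟩ := Set.ncard_eq_two.1 (le_antisymm hc h2)
      have hab := h a (hSP (by simp)) b (hSP (by simp))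
      refine ⟨midpoint ℝ a b, ?_⟩
      intro x hx
      rw [← dist_eq_norm]
      rcases hx with rfl | rfl
      · rw [dist_left_midpoint]; norm_num; linarith
      · rw [dist_right_midpoint]; norm_num; linarith
  obtain ⟨c, hc⟩ := this
  exact hk_cRadius_le (by positivity) hc

lemma hk_simplex_lower {v : Fin (d + 1) → E} {r : ℝ} (hr : 0 < r)
    (hv : ∀ i j, i ≠ j → dist (v i) (v j) = r) {k : ℕ} (hk : k ≤ d) :
    r * Real.sqrt ((k : ℝ) / (2 * (k + 1))) ≤
      coreRadius k (convexHull ℝ (Set.range v)) (Metric.closedBall (0 : E) 1) := by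
  classical
  let u : Fin (k + 1) → E := fun i => v (Fin.castLE (by omega) i)
  have hu : ∀ i j, i ≠ j → ‖u i - u j‖ = r := by
    intro i j hij
    rw [← dist_eq_norm]
    exact hv _ _ fun h => hij (Fin.castLE_injective _ h)
  have hbd : Bornology.IsBounded (convexHull ℝ (Set.range v)) :=
    isBounded_convexHull.2 (Set.finite_range v).isBounded
  have hsub : Set.range u ⊆ convexHull ℝ (Set.range v) := by
    rintro _ ⟨i, rfl⟩
    exact subset_convexHull ℝ _ ⟨_, rfl⟩
  have hcard : (Set.range u).ncard ≤ k + 1 := by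
    rw [← Set.image_univ]
    refine (Set.ncard_image_le Set.finite_univ).trans ?_
    simp [Set.ncard_univ]
  refine le_trans ?_ (hk_le_core hbd hsub (Set.finite_range u) hcard)
  apply hk_le_cRadius (Set.finite_range u)
  intro p ρ hρ hp
  have hk0 : (0 : ℝ) < (k : ℝ) + 1 := by positivity
  set w : Fin (k + 1) → ℝ := fun _ => 1 / ((k : ℝ) + 1) with hw
  have hw1 : ∑ i, w i = 1 := by
    simp [hw]; field_simp
  set c := ∑ i, w i • u i with hc
  -- variance via averaging the identity over the points themselves
  have hj : ∀ j, ∑ i, w i * ‖u i - u j‖ ^ 2 = r ^ 2 * (k / (k + 1)) := by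
    intro j
    rw [← Finset.add_sum_erase _ _ (Finset.mem_univ j), sub_self, norm_zero]
    rw [Finset.sum_congr rfl (g := fun _ => 1 / ((k : ℝ) + 1) * r ^ 2)
      (fun i hi => by rw [hu i j (Finset.ne_of_mem_erase hi)])]
    simp
    field_simp
  have hVc := hk_var_id u w hw1 c
  rw [← hc, sub_self, norm_zero] at hVc
  have hsum : ∑ j, w j * (r ^ 2 * (k / (k + 1))) = 2 * hkVar u w := by
    calc ∑ j, w j * (r ^ 2 * (k / (k + 1)))
        = ∑ j, (w j * hkVar u w + w j * ‖u j - c‖ ^ 2) := by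
          apply Finset.sum_congr rfl
          intro j _
          rw [← hj j, hk_var_id u w hw1 (u j), ← hc, norm_sub_rev c]; ring
      _ = 2 * hkVar u w := by
          rw [Finset.sum_add_distrib, ← Finset.sum_mul, hw1, hVc]; ring
  rw [← Finset.sum_mul, hw1] at hsum
  have hle : hkVar u w ≤ ρ ^ 2 := by
    have h1 := hk_var_id u w hw1 p
    have h2 : ∑ i, w i * ‖u i - p‖ ^ 2 ≤ ∑ i, w i * ρ ^ 2 := by
      apply Finset.sum_le_sum
      intro i _
      apply mul_le_mul_of_nonneg_left _ (by simp only [hw]; positivity)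
      exact pow_le_pow_left₀ (norm_nonneg _) (hp _ ⟨i, rfl⟩) 2
    rw [← Finset.sum_mul, hw1] at h2
    nlinarith [sq_nonneg ‖∑ i, w i • u i - p‖]
  refine (abs_le_of_sq_le_sq' ?_ hρ).2
  rw [mul_pow, Real.sq_sqrt (by positivity)]
  have : (k : ℝ) / (2 * (k + 1)) = (k / (k + 1)) / 2 := by field_simp
  rw [this]
  linarith

end HenkHelpers

theorem henk_inequality {d : ℕ} (k l : ℕ) (hl : 1 ≤ l) (hlk : l ≤ k) (hkd : k ≤ d)
    (B : Set (EuclideanSpace ℝ (Fin d)))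
    (hB : B = Metric.closedBall (0 : EuclideanSpace ℝ (Fin d)) 1) :
    (∀ P : Set (EuclideanSpace ℝ (Fin d)), P.Nonempty → IsCompact P → Convex ℝ P →
      coreRadius k P B ≤
        Real.sqrt ((k : ℝ) * ((l : ℝ) + 1) / ((l : ℝ) * ((k : ℝ) + 1))) * coreRadius l P B) ∧
    (∀ (v : Fin (d + 1) → EuclideanSpace ℝ (Fin d)), IsRegularSimplex v →
      coreRadius k (convexHull ℝ (Set.range v)) B =
        Real.sqrt ((k : ℝ) * ((l : ℝ) + 1) / ((l : ℝ) * ((k : ℝ) + 1))) *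
          coreRadius l (convexHull ℝ (Set.range v)) B) := by
  subst hB
  refine ⟨fun P _ hPc _ => hk_ineq hPc.isBounded hl hlk, ?_⟩
  rintro v ⟨-, r, hr, hv⟩
  have hbd : Bornology.IsBounded (convexHull ℝ (Set.range v)) :=
    isBounded_convexHull.2 (Set.finite_range v).isBounded
  apply le_antisymm (hk_ineq hbd hl hlk)
  refine le_trans ?_ (hk_simplex_lower hr hv hkd)
  have hone : coreRadius 1 (convexHull ℝ (Set.range v))
      (Metric.closedBall (0 : EuclideanSpace ℝ (Fin d)) 1) ≤ r / 2 := by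
    apply hk_core_one hr.le
    intro x hx y hy
    refine (Metric.dist_le_diam_of_mem hbd hx hy).trans ?_
    rw [convexHull_diam]
    apply Metric.diam_le_of_forall_dist_le hr.le
    rintro _ ⟨i, rfl⟩ _ ⟨j, rfl⟩
    by_cases hij : i = j
    · subst hij; simpa using hr.le
    · exact (hv i j hij).le
  have hl1 : (1 : ℝ) ≤ l := by exact_mod_cast hl
  have hL := (hk_ineq hbd le_rfl hl).trans (mul_le_mul_of_nonneg_left hone (Real.sqrt_nonneg _))
  refine (mul_le_mul_of_nonneg_left hL (Real.sqrt_nonneg _)).trans ?_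
  rw [← mul_assoc, ← Real.sqrt_mul (by positivity)]
  have : (k : ℝ) * (l + 1) / (l * (k + 1)) * (l * ((1 : ℕ) + 1) / ((1 : ℕ) * (l + 1)))
      = 2 ^ 2 * (k / (2 * (k + 1))) := by
    push_cast
    field_simp
    norm_num
  rw [this, Real.sqrt_mul (by positivity), Real.sqrt_sq (by norm_num)]
  apply le_of_eq
  ring
end

section
/- Let P ⊆ ℝ^d be a nonempty compact convex set, C ⊆ ℝ^d a container, and k, l natural numbers with 1 ≤ l ≤ k ≤ d. Then R_k(P,C) ≤ (k/l) · R_l(P,C). -/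
open Set Pointwise

/-- `S` is contained in a translate of `ρ • C`. -/
def TransCov {d : ℕ} (S C : Set (EuclideanSpace ℝ (Fin d))) (ρ : ℝ) : Prop :=
  ∃ c : EuclideanSpace ℝ (Fin d), ∀ x ∈ S, x - c ∈ ρ • C

lemma transCov_iff {d : ℕ} (S C : Set (EuclideanSpace ℝ (Fin d))) (ρ : ℝ) :
    TransCov S C ρ ↔ ∃ c : EuclideanSpace ℝ (Fin d), S ⊆ c +ᵥ ρ • C := by
  unfold TransCov
  refine exists_congr fun c => forall₂_congr fun x _ => ?_
  rw [Set.mem_vadd_set_iff_neg_vadd_mem, vadd_eq_add, sub_eq_neg_add]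

lemma smul_mono_container {d : ℕ} {C : Set (EuclideanSpace ℝ (Fin d))} (hC : Convex ℝ C)
    (h0 : (0 : EuclideanSpace ℝ (Fin d)) ∈ C) {a b : ℝ} (ha : 0 ≤ a) (hab : a ≤ b) :
    a • C ⊆ b • C := by
  rintro _ ⟨y, hy, rfl⟩
  rcases eq_or_lt_of_le (ha.trans hab) with hb | hb
  · have : a = b := by linarith
    exact this ▸ ⟨y, hy, rfl⟩
  · refine ⟨(a / b) • y, hC.smul_mem_of_zero_mem h0 hy ⟨by positivity, ?_⟩, ?_⟩
    · rw [div_le_one hb]; exact hab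
    · simp only [smul_smul]
      congr 1
      field_simp

lemma cov_step {d : ℕ} {C : Set (EuclideanSpace ℝ (Fin d))} (hC : Convex ℝ C) (n : ℕ)
    (hn : 1 ≤ n) (σ : ℝ) (T : Finset (EuclideanSpace ℝ (Fin d))) (hT : T.card = n + 2)
    (h : ∀ x ∈ T, TransCov ((T.erase x : Finset _) : Set (EuclideanSpace ℝ (Fin d))) C σ) :
    TransCov (T : Set (EuclideanSpace ℝ (Fin d))) C (((n : ℝ) + 1) / n * σ) := by
  classical
  choose! c hc using h
  have hn' : (0 : ℝ) < n := by exact_mod_cast hn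
  have hD : Convex ℝ (σ • C) := hC.smul σ
  refine ⟨((1 : ℝ) / (n * (n + 2))) • (((n : ℝ) + 1) • ∑ i ∈ T, c i - ∑ i ∈ T, i), ?_⟩
  intro x hx
  have hx : x ∈ T := hx
  have hcard : ((T.erase x).card : ℝ) = n + 1 := by
    rw [Finset.card_erase_of_mem hx, hT]; push_cast [Nat.add_sub_cancel]; norm_num
  have hw : ∑ i ∈ T.erase x, (1 / ((n : ℝ) + 1)) = 1 := by
    rw [Finset.sum_const, nsmul_eq_mul, hcard]; field_simp
  have hA : ∑ i ∈ T.erase x, (1 / ((n : ℝ) + 1)) • (x - c i) ∈ σ • C := by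
    refine hD.sum_mem (fun _ _ => by positivity) hw ?_
    intro i hi
    rw [Finset.mem_erase] at hi
    refine hc i hi.2 x ?_
    simp [hx, hi.1.symm]
  have hB : ∑ i ∈ T.erase x, (1 / ((n : ℝ) + 1)) • (i - c x) ∈ σ • C := by
    refine hD.sum_mem (fun _ _ => by positivity) hw ?_
    intro i hi
    exact hc x hx i (Finset.mem_coe.2 hi)
  have hAB := hD hA hB (a := (n + 1 : ℝ) / (n + 2)) (b := 1 / (n + 2 : ℝ)) (by positivity)
    (by positivity) (by field_simp; ring)
  have := Set.smul_mem_smul_set (a := ((n : ℝ) + 1) / n) hAB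
  rw [smul_smul] at this
  convert this using 1
  rw [← Finset.add_sum_erase T c hx, ← Finset.add_sum_erase T (fun i => i) hx]
  simp only [← Finset.smul_sum, Finset.sum_sub_distrib, Finset.sum_const]
  rw [← Nat.cast_smul_eq_nsmul ℝ, ← Nat.cast_smul_eq_nsmul ℝ, hcard]
  match_scalars <;> field_simp <;> ring

theorem coreRadius_ratio_general {d : ℕ} (P C : Set (EuclideanSpace ℝ (Fin d)))
    (hPne : P.Nonempty) (hPcomp : IsCompact P) (hPconv : Convex ℝ P)
    (hC : IsContainer C) (k l : ℕ) (hl : 1 ≤ l) (hlk : l ≤ k) (hkd : k ≤ d) :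
    coreRadius k P C ≤ ((k : ℝ) / (l : ℝ)) * coreRadius l P C := by
  classical
  obtain ⟨-, hconv, h0i⟩ := hC
  have h0 : (0 : EuclideanSpace ℝ (Fin d)) ∈ C := interior_subset h0i
  have hl' : (0 : ℝ) < l := by exact_mod_cast hl
  have hbdd : ∀ S : Set (EuclideanSpace ℝ (Fin d)),
      BddBelow {ρ : ℝ | 0 ≤ ρ ∧ ∃ c : EuclideanSpace ℝ (Fin d), S ⊆ c +ᵥ ρ • C} :=
    fun S => ⟨0, fun _ h => h.1⟩
  have hle : ∀ (S : Set (EuclideanSpace ℝ (Fin d))) (ρ : ℝ), 0 ≤ ρ → TransCov S C ρ →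
      cRadius S C ≤ ρ := fun S ρ h h' => csInf_le (hbdd S) ⟨h, (transCov_iff _ _ _).1 h'⟩
  have hnn : ∀ S : Set (EuclideanSpace ℝ (Fin d)), 0 ≤ cRadius S C :=
    fun S => Real.sInf_nonneg fun _ h => h.1
  -- a uniform cover of P
  obtain ⟨R, hR, hPR⟩ : ∃ R : ℝ, 0 ≤ R ∧ TransCov P C R := by
    have habs : Absorbs ℝ C P :=
      (NormedSpace.isVonNBounded_of_isBounded ℝ hPcomp.isBounded)
        (mem_interior_iff_mem_nhds.1 h0i)
    obtain ⟨r, hr, h⟩ := habs.exists_pos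
    refine ⟨r, hr.le, 0, fun x hx => ?_⟩
    simpa using h r (by simp [abs_of_pos hr]) hx
  have hsub : ∀ S : Set (EuclideanSpace ℝ (Fin d)), S ⊆ P → TransCov S C R := fun S hS => by
    obtain ⟨c, hc⟩ := hPR
    exact ⟨c, fun x hx => hc x (hS hx)⟩
  have hcore : ∀ S : Set (EuclideanSpace ℝ (Fin d)), S ⊆ P → S.Finite → S.ncard ≤ l + 1 →
      cRadius S C ≤ coreRadius l P C := by
    intro S h1 h2 h3
    refine le_csSup ⟨R, ?_⟩ ⟨S, h1, h2, h3, rfl⟩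
    rintro _ ⟨S', h1, -, -, rfl⟩
    exact hle _ _ hR (hsub _ h1)
  have hcore0 : 0 ≤ coreRadius l P C :=
    (hnn ∅).trans (hcore ∅ (empty_subset _) finite_empty (by simp))
  have main : ∀ ρ : ℝ, coreRadius l P C < ρ → coreRadius k P C ≤ (k : ℝ) / l * ρ := by
    intro ρ hρ
    have hρ0 : 0 ≤ ρ := hcore0.trans hρ.le
    have key : ∀ n : ℕ, l ≤ n → ∀ T : Finset (EuclideanSpace ℝ (Fin d)),
        (T : Set (EuclideanSpace ℝ (Fin d))) ⊆ P → T.card ≤ n + 1 →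
        TransCov (T : Set (EuclideanSpace ℝ (Fin d))) C ((n : ℝ) / l * ρ) := by
      intro n hn
      induction n, hn using Nat.le_induction with
      | base =>
        intro T hTP hT
        have h1 := (hcore T hTP T.finite_toSet (by simpa using hT)).trans_lt hρ
        unfold cRadius at h1
        obtain ⟨ρ', ⟨h2, h3⟩, h4⟩ := exists_lt_of_csInf_lt (by
          exact ⟨R, hR, (transCov_iff _ _ _).1 (hsub _ hTP)⟩) h1
        obtain ⟨c, hc⟩ := (transCov_iff _ _ _).2 h3
        rw [div_self hl'.ne', one_mul]
        exact ⟨c, fun x hx => smul_mono_container hconv h0 h2 h4.le (hc x hx)⟩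
      | succ n hn ih =>
        intro T hTP hT
        have hn0 : (0 : ℝ) < n := by exact_mod_cast (by omega : 0 < n)
        rcases Nat.lt_or_ge T.card (n + 2) with h | h
        · obtain ⟨c, hc⟩ := ih T hTP (by omega)
          refine ⟨c, fun x hx => smul_mono_container hconv h0 (by positivity) ?_ (hc x hx)⟩
          gcongr
          simp
        · have := cov_step hconv n (by omega) ((n : ℝ) / l * ρ) T (by omega) (by
            intro x hx
            refine ih _ (fun y hy => hTP ?_) ?_
            · exact Finset.mem_of_mem_erase hy
            · rw [Finset.card_erase_of_mem hx]; omega)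
          convert this using 1
          push_cast
          field_simp
    refine csSup_le ⟨_, ∅, empty_subset _, finite_empty, by simp, rfl⟩ ?_
    rintro _ ⟨S, h1, h2, h3, rfl⟩
    refine hle _ _ (by positivity) ?_
    have := key k hlk h2.toFinset (by simpa using h1)
      (by rwa [← Set.ncard_eq_toFinset_card S h2])
    simpa using this
  have hk' : (0 : ℝ) < k := by exact_mod_cast (by omega : 0 < k)
  have h2 : coreRadius k P C / ((k : ℝ) / l) ≤ coreRadius l P C := by
    refine le_of_forall_gt_imp_ge_of_dense fun ρ hρ => ?_
    rw [div_le_iff₀ (by positivity), mul_comm]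
    exact main ρ hρ
  rwa [div_le_iff₀ (by positivity), mul_comm] at h2
end

section
/- Let T^d be a regular d-simplex in ℝ^d with centroid at the origin. Then for every k with 1 ≤ k ≤ d, the k-th core-radius of T^d with respect to the container −T^d equals k: R_k(T^d, −T^d) = k. In particular R_k(T^d,−T^d)/R_l(T^d,−T^d) = k/l for 1 ≤ l ≤ k ≤ d, so the inequality R_k(P,C) ≤ (k/l)·R_l(P,C) is sharp. -/
open Set Pointwise

theorem cRadius_le_aux_s15 {d : ℕ} (T S : Set (EuclideanSpace ℝ (Fin d))) (hc : Convex ℝ T)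
    (h0 : (0 : EuclideanSpace ℝ (Fin d)) ∈ T) (k : ℕ) (hk : 1 ≤ k) (hS : S ⊆ T)
    (hf : S.Finite) (hn : S.ncard ≤ k + 1) :
    ∃ c : EuclideanSpace ℝ (Fin d), S ⊆ c +ᵥ (k : ℝ) • (-T) := by
  classical
  obtain ⟨F, rfl⟩ := hf.exists_finset_coe
  rw [Set.ncard_coe_finset] at hn
  have hk0 : (0 : ℝ) < k := by exact_mod_cast hk
  refine ⟨∑ y ∈ F, y, fun x hx => ?_⟩
  have hx' : x ∈ F := hx
  rw [Set.mem_vadd_set]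
  refine ⟨x - ∑ y ∈ F, y, ?_, by simp⟩
  rw [Set.mem_smul_set]
  refine ⟨-(∑ y ∈ F.erase x, (k : ℝ)⁻¹ • y), ?_, ?_⟩
  · rw [Set.neg_mem_neg]
    have hcard : ((F.erase x).card : ℝ) ≤ k := by
      rw [Finset.card_erase_of_mem hx']
      exact_mod_cast (by omega)
    have hsc : ∑ y ∈ F.erase x, (k : ℝ)⁻¹ ≤ 1 := by
      rw [Finset.sum_const, nsmul_eq_mul, ← div_eq_mul_inv, div_le_one hk0]
      exact hcard
    rcases (F.erase x).eq_empty_or_nonempty with he | hne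
    · rw [he]; simpa using h0
    have hpos : 0 < ∑ y ∈ F.erase x, (k : ℝ)⁻¹ :=
      Finset.sum_pos (fun _ _ => by positivity) hne
    have hm := hc.centerMass_mem (t := F.erase x) (w := fun _ => (k : ℝ)⁻¹) (z := fun y => y)
      (fun _ _ => by positivity) hpos
      (fun y hy => hS (Finset.mem_coe.2 (Finset.mem_of_mem_erase hy)))
    have h2 := hc.smul_mem_of_zero_mem h0 hm ⟨hpos.le, hsc⟩
    rw [Finset.centerMass, smul_smul, mul_inv_cancel₀ hpos.ne', one_smul] at h2
    exact h2
  · rw [← Finset.smul_sum, smul_neg, smul_smul, mul_inv_cancel₀ hk0.ne', one_smul,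
      ← Finset.add_sum_erase F (fun y => y) hx']
    abel

theorem coreRadius_aux {d : ℕ}
    (v : Fin (d + 1) → EuclideanSpace ℝ (Fin d)) (hv : IsRegularSimplexCentered v)
    (T : Set (EuclideanSpace ℝ (Fin d))) (hT : T = convexHull ℝ (Set.range v))
    (k : ℕ) (hk : 1 ≤ k) (hkd : k ≤ d) : coreRadius k T (-T) = (k : ℝ) := by
  classical
  obtain ⟨hind, -, hsum⟩ := hv
  have hc : Convex ℝ T := hT ▸ convex_convexHull ℝ _
  have hvT : ∀ i, v i ∈ T := fun i => hT ▸ subset_convexHull ℝ _ (Set.mem_range_self i)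
  have h0 : (0 : EuclideanSpace ℝ (Fin d)) ∈ T := by
    have hm := hc.centerMass_mem (t := Finset.univ) (w := fun _ : Fin (d + 1) => (1 : ℝ)) (z := v)
      (fun _ _ => by positivity) (by simp; positivity) (fun i _ => hvT i)
    simpa [Finset.centerMass, hsum] using hm
  have hle : ∀ S : Set (EuclideanSpace ℝ (Fin d)), S ⊆ T → S.Finite → S.ncard ≤ k + 1 →
      cRadius S (-T) ≤ k := fun S h1 h2 h3 =>
    csInf_le ⟨0, fun _ h => h.1⟩ ⟨by positivity, cRadius_le_aux_s15 T S hc h0 k hk h1 h2 h3⟩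
  let b : AffineBasis (Fin (d + 1)) ℝ (EuclideanSpace ℝ (Fin d)) :=
    ⟨v, hind, by rw [hind.affineSpan_eq_top_iff_card_eq_finrank_add_one]; simp⟩
  have hbv : ∀ i, b i = v i := fun i => rfl
  have hnn : ∀ t ∈ T, ∀ i, 0 ≤ b.coord i t := by
    intro t ht
    have := b.convexHull_eq_nonneg_coord
    rw [hT] at ht
    have h3 : t ∈ convexHull ℝ (Set.range b) := ht
    rw [this] at h3
    exact h3
  let K : Fin (d + 1) := ⟨k, by omega⟩
  let S : Set (EuclideanSpace ℝ (Fin d)) :=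
    Set.image v (Finset.Iic K : Finset (Fin (d + 1)))
  have hST : S ⊆ T := by rintro _ ⟨i, -, rfl⟩; exact hvT i
  have hSf : S.Finite := (Finset.finite_toSet _).image _
  have hSn : S.ncard ≤ k + 1 := by
    refine (Set.ncard_image_le (Finset.finite_toSet _)).trans ?_
    rw [Set.ncard_coe_finset, Fin.card_Iic]
  have hge : (k : ℝ) ≤ cRadius S (-T) := by
    refine le_csInf ⟨k, by positivity, cRadius_le_aux_s15 T S hc h0 k hk hST hSf hSn⟩ ?_
    rintro ρ ⟨hρ, c, hcS⟩
    have key : ∀ i, (if i ≤ K then (1 : ℝ) else 0) ≤ b.coord i c + ρ * b.coord i 0 := by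
      intro i
      have hmem : v (if i ≤ K then i else K) ∈ S := by
        refine ⟨_, ?_, rfl⟩
        split_ifs with h <;> simp [h]
      obtain ⟨y, ⟨t, ht, hty⟩, hyv⟩ := hcS hmem
      have hp := hnn _ ht i
      have e1 : b.coord i (v (if i ≤ K then i else K)) = if i ≤ K then (1 : ℝ) else 0 := by
        rw [← hbv, b.coord_apply]
        split_ifs with h1 h2 h3 <;> simp_all
      have lin : ∀ x, b.coord i x = (b.coord i).linear x + b.coord i 0 := by
        intro x
        have := (b.coord i).map_vadd 0 x
        simpa using this
      rw [← e1, ← hyv, ← hty]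
      simp only [vadd_eq_add]
      rw [lin (c + ρ • t), lin c]
      rw [lin (-t)] at hp
      simp only [map_add, map_smul, map_neg, smul_eq_mul] at hp ⊢
      nlinarith [mul_nonneg hρ hp]
    have := Finset.sum_le_sum (fun i (_ : i ∈ Finset.univ) => key i)
    rw [Finset.sum_add_distrib, ← Finset.mul_sum, b.sum_coord_apply_eq_one,
      b.sum_coord_apply_eq_one, Finset.sum_boole] at this
    have hcard : (Finset.univ.filter (fun i => i ≤ K)).card = k + 1 := by
      rw [Finset.filter_ge_eq_Iic, Fin.card_Iic]
    rw [hcard] at this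
    push_cast at this
    linarith
  refine IsGreatest.csSup_eq ⟨⟨S, hST, hSf, hSn, le_antisymm hge (hle S hST hSf hSn)⟩, ?_⟩
  rintro r ⟨S', h1, h2, h3, rfl⟩
  exact hle S' h1 h2 h3

theorem coreRadius_simplex_negSimplex {d : ℕ}
    (v : Fin (d + 1) → EuclideanSpace ℝ (Fin d)) (hv : IsRegularSimplexCentered v)
    (T : Set (EuclideanSpace ℝ (Fin d))) (hT : T = convexHull ℝ (Set.range v)) :
    (∀ k : ℕ, 1 ≤ k → k ≤ d → coreRadius k T (-T) = (k : ℝ)) ∧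
    (∀ k l : ℕ, 1 ≤ l → l ≤ k → k ≤ d →
      coreRadius k T (-T) = ((k : ℝ) / (l : ℝ)) * coreRadius l T (-T)) := by
  refine ⟨fun k h1 h2 => coreRadius_aux v hv T hT k h1 h2, fun k l h1 h2 h3 => ?_⟩
  rw [coreRadius_aux v hv T hT k (h1.trans h2) h3, coreRadius_aux v hv T hT l h1 (h2.trans h3)]
  have : (l : ℝ) ≠ 0 := by exact_mod_cast (by omega)
  field_simp
end

section
/- (Generalized Bohnenblust inequality) Let P ⊆ ℝ^d be a nonempty compact convex set and C ⊆ ℝ^d a container. Then R(P,C) ≤ ((1 + s(C))·d/(d+1)) · R_1(P,C), where s(C) = R(−C,C) is the Minkowski asymmetry of C. Equality holds when P = T^d is a regular d-simplex with centroid at the origin and C = −T^d, and also when P = T^d and C = T^d − T^d (the Minkowski difference body). -/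
open Set Pointwise

/-- The Minkowski asymmetry `s(C) = R(-C, C)`. -/
noncomputable def minkowskiAsymmetry {d : ℕ} (C : Set (EuclideanSpace ℝ (Fin d))) : ℝ :=
  cRadius (-C) C

theorem gb_mem_iff {d : ℕ} {C : Set (EuclideanSpace ℝ (Fin d))} {c x : EuclideanSpace ℝ (Fin d)}
    {ρ : ℝ} : x ∈ c +ᵥ ρ • C ↔ ∃ z ∈ C, x = c + ρ • z := by
  constructor
  · rintro ⟨y, ⟨z, hz, rfl⟩, rfl⟩
    exact ⟨z, hz, rfl⟩
  · rintro ⟨z, hz, rfl⟩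
    exact ⟨_, ⟨z, hz, rfl⟩, rfl⟩

theorem gb_scale {d : ℕ} {C : Set (EuclideanSpace ℝ (Fin d))} (hC : Convex ℝ C)
    (h0 : (0 : EuclideanSpace ℝ (Fin d)) ∈ C) {a b : ℝ} (ha : 0 ≤ a) (hab : a ≤ b)
    {z : EuclideanSpace ℝ (Fin d)} (hz : z ∈ C) : ∃ w ∈ C, a • z = b • w := by
  rcases eq_or_lt_of_le (ha.trans hab) with hb | hb
  · refine ⟨z, hz, ?_⟩
    have : a = b := by linarith
    rw [this]
  · refine ⟨(a / b) • z, ?_, ?_⟩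
    · exact hC.smul_mem_of_zero_mem h0 hz ⟨by positivity, (div_le_one hb).2 hab⟩
    · rw [smul_smul, mul_div_cancel₀ _ hb.ne']

theorem gb_mean {d : ℕ} {C : Set (EuclideanSpace ℝ (Fin d))} (hC : Convex ℝ C)
    (h0 : (0 : EuclideanSpace ℝ (Fin d)) ∈ C) {ι : Type*} (J : Finset ι)
    (z : ι → EuclideanSpace ℝ (Fin d)) (hz : ∀ j ∈ J, z j ∈ C) :
    ∃ m ∈ C, ∑ j ∈ J, z j = (J.card : ℝ) • m := by
  rcases J.eq_empty_or_nonempty with rfl | hJ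
  · exact ⟨0, h0, by simp⟩
  · have hc : (0 : ℝ) < J.card := by exact_mod_cast hJ.card_pos
    refine ⟨∑ j ∈ J, ((J.card : ℝ)⁻¹) • z j, ?_, ?_⟩
    · refine hC.sum_mem (fun _ _ => by positivity) ?_ hz
      simp [hc.ne']
    · rw [← Finset.smul_sum, smul_smul, mul_inv_cancel₀ hc.ne', one_smul]

theorem gb_key {d : ℕ} {P C : Set (EuclideanSpace ℝ (Fin d))} (hC : IsContainer C)
    {s r : ℝ} (hs : 0 ≤ s) (hr : 0 ≤ r) (c0 : EuclideanSpace ℝ (Fin d))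
    (hneg : -C ⊆ c0 +ᵥ s • C)
    (hP : ∀ x ∈ P, ∀ y ∈ P, ∃ c : EuclideanSpace ℝ (Fin d), {x, y} ⊆ c +ᵥ r • C) :
    ∃ c : EuclideanSpace ℝ (Fin d), P ⊆ c +ᵥ ((1 + s) * (d : ℝ) / ((d : ℝ) + 1) * r) • C := by
  classical
  obtain ⟨hcomp, hconv, hint⟩ := hC
  have h0 := interior_subset hint
  set ρ : ℝ := (1 + s) * (d : ℝ) / ((d : ℝ) + 1) * r with hρ
  have hpair : ∀ x y : P, ∃ z ∈ C,
      (x : EuclideanSpace ℝ (Fin d)) - y = r • c0 + (r * (1 + s)) • z := by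
    intro x y
    obtain ⟨c, hc⟩ := hP x x.2 y y.2
    obtain ⟨y1, h1, e1⟩ := gb_mem_iff.1 (hc (by simp : (x : EuclideanSpace ℝ (Fin d)) ∈ _))
    obtain ⟨y2, h2, e2⟩ := gb_mem_iff.1 (hc (by simp : (y : EuclideanSpace ℝ (Fin d)) ∈ _))
    obtain ⟨y3, h3, e3⟩ := gb_mem_iff.1 (hneg (by simpa using h2 : -y2 ∈ -C))
    refine ⟨(1 / (1 + s)) • y1 + (s / (1 + s)) • y3,
      hconv h1 h3 (by positivity) (by positivity) (by field_simp), ?_⟩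
    have hs1 : 1 + s ≠ 0 := by positivity
    have e4 : y2 = -(c0 + s • y3) := by rw [← e3, neg_neg]
    rw [e1, e2, e4, smul_add, smul_smul, smul_smul]
    have a1 : r * (1 + s) * (1 / (1 + s)) = r := by field_simp
    have a2 : r * (1 + s) * (s / (1 + s)) = r * s := by field_simp
    rw [a1, a2]
    module
  choose z hzC hz using hpair
  have hel : (⋂ p : P, ((p : EuclideanSpace ℝ (Fin d)) +ᵥ (-ρ) • C)).Nonempty := by
    apply Convex.helly_theorem_compact' (𝕜 := ℝ)
    · intro p
      exact (hconv.smul _).vadd _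
    · intro p
      exact (hcomp.smul _).vadd _
    · intro I hI
      rw [finrank_euclideanSpace_fin] at hI
      rcases I.eq_empty_or_nonempty with rfl | hne
      · simp
      have hn : (0 : ℝ) < I.card := by exact_mod_cast hne.card_pos
      set n : ℝ := (I.card : ℝ) with hndef
      have hnd : n ≤ d + 1 := by rw [hndef]; exact_mod_cast hI
      have hn1 : 1 ≤ n := by rw [hndef]; exact_mod_cast hne.card_pos
      refine ⟨n⁻¹ • ∑ j ∈ I, (j : EuclideanSpace ℝ (Fin d)) + ((n - 1) / n * r) • c0, ?_⟩
      simp only [mem_iInter]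
      intro i hi
      have hsum : n • (i : EuclideanSpace ℝ (Fin d)) - ∑ j ∈ I, (j : EuclideanSpace ℝ (Fin d))
          = ∑ j ∈ I.erase i, (r • c0 + (r * (1 + s)) • z i j) := by
        rw [← Finset.sum_congr rfl (fun j _ => hz i j)]
        have : ∑ j ∈ I.erase i, ((i : EuclideanSpace ℝ (Fin d)) - j)
            = ∑ j ∈ I, ((i : EuclideanSpace ℝ (Fin d)) - j) := by
          rw [← Finset.add_sum_erase I _ hi]; simp
        rw [this, Finset.sum_sub_distrib, Finset.sum_const, hndef, Nat.cast_smul_eq_nsmul]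
      have hcard : ((I.erase i).card : ℝ) = n - 1 := by
        rw [Finset.card_erase_of_mem hi, Nat.cast_sub hne.card_pos, Nat.cast_one]
      obtain ⟨m, hm, em⟩ := gb_mean hconv h0 (I.erase i) (z i) (fun j _ => hzC i j)
      rw [Finset.sum_add_distrib, Finset.sum_const, ← Finset.smul_sum, em,
        ← Nat.cast_smul_eq_nsmul ℝ, hcard] at hsum
      have hle : (n - 1) / n * (r * (1 + s)) ≤ ρ := by
        rw [hρ]
        have : (n - 1) / n ≤ (d : ℝ) / (d + 1) := by
          rw [div_le_div_iff₀ hn (by positivity)]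
          nlinarith
        calc (n - 1) / n * (r * (1 + s)) ≤ (d : ℝ) / (d + 1) * (r * (1 + s)) := by gcongr
          _ = _ := by ring
      obtain ⟨w, hw, ew⟩ := gb_scale hconv h0
        (mul_nonneg (div_nonneg (by linarith) hn.le) (by positivity)) hle hm
      refine gb_mem_iff.2 ⟨w, hw, ?_⟩
      rw [neg_smul, ← ew]
      have e5 : (i : EuclideanSpace ℝ (Fin d)) = n⁻¹ • (∑ j ∈ I, (j : EuclideanSpace ℝ (Fin d)) +
          ((n - 1) • r • c0 + (r * (1 + s)) • (n - 1) • m)) := by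
        rw [← hsum, add_sub_cancel, smul_smul, inv_mul_cancel₀ hn.ne', one_smul]
      rw [e5]
      module
  obtain ⟨c, hc⟩ := hel
  refine ⟨c, fun p hp => ?_⟩
  obtain ⟨w, hw, ew⟩ := gb_mem_iff.1 (mem_iInter.1 hc ⟨p, hp⟩)
  refine gb_mem_iff.2 ⟨w, hw, ?_⟩
  rw [ew]
  module

theorem gb_bdd {d : ℕ} (P C : Set (EuclideanSpace ℝ (Fin d))) :
    BddBelow {ρ : ℝ | 0 ≤ ρ ∧ ∃ c : EuclideanSpace ℝ (Fin d), P ⊆ c +ᵥ ρ • C} :=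
  ⟨0, fun _ h => h.1⟩

theorem gb_le {d : ℕ} {P C : Set (EuclideanSpace ℝ (Fin d))} {ρ : ℝ} (h : 0 ≤ ρ)
    (c : EuclideanSpace ℝ (Fin d)) (hc : P ⊆ c +ᵥ ρ • C) : cRadius P C ≤ ρ :=
  csInf_le (gb_bdd P C) ⟨h, c, hc⟩

theorem gb_nonneg {d : ℕ} (P C : Set (EuclideanSpace ℝ (Fin d))) : 0 ≤ cRadius P C :=
  Real.sInf_nonneg fun _ h => h.1

theorem gb_nonempty {d : ℕ} {P C : Set (EuclideanSpace ℝ (Fin d))} (hP : IsCompact P)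
    (hC : IsContainer C) :
    {ρ : ℝ | 0 ≤ ρ ∧ ∃ c : EuclideanSpace ℝ (Fin d), P ⊆ c +ᵥ ρ • C}.Nonempty := by
  have h1 : Absorbs ℝ C P :=
    (NormedSpace.isVonNBounded_of_isBounded ℝ hP.isBounded) (mem_interior_iff_mem_nhds.1 hC.2.2)
  obtain ⟨r, hr, h⟩ := h1.exists_pos
  refine ⟨r, hr.le, 0, ?_⟩
  rw [zero_vadd]
  exact h r (by rw [Real.norm_of_nonneg hr.le])

theorem gb_exists {d : ℕ} {P C : Set (EuclideanSpace ℝ (Fin d))} (hP : IsCompact P)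
    (hC : IsContainer C) {r : ℝ} (hr : cRadius P C < r) :
    ∃ c : EuclideanSpace ℝ (Fin d), P ⊆ c +ᵥ r • C := by
  obtain ⟨a, ⟨ha, c, hc⟩, har⟩ := exists_lt_of_csInf_lt (gb_nonempty hP hC) hr
  refine ⟨c, fun x hx => ?_⟩
  obtain ⟨z, hz, e⟩ := gb_mem_iff.1 (hc hx)
  obtain ⟨w, hw, e'⟩ := gb_scale hC.2.1 (interior_subset hC.2.2) ha har.le hz
  exact gb_mem_iff.2 ⟨w, hw, by rw [e, e']⟩

theorem gb_core_nonneg {d : ℕ} (k : ℕ) (P C : Set (EuclideanSpace ℝ (Fin d))) :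
    0 ≤ coreRadius k P C := by
  apply Real.sSup_nonneg
  rintro _ ⟨S, -, -, -, rfl⟩
  exact gb_nonneg S C

theorem gb_main {d : ℕ} {P C : Set (EuclideanSpace ℝ (Fin d))} (hP : IsCompact P)
    (hC : IsContainer C) :
    cRadius P C ≤ ((1 + minkowskiAsymmetry C) * (d : ℝ) / ((d : ℝ) + 1)) * coreRadius 1 P C := by
  have hbdd : BddAbove {r : ℝ | ∃ S : Set (EuclideanSpace ℝ (Fin d)),
      S ⊆ P ∧ S.Finite ∧ S.ncard ≤ 1 + 1 ∧ r = cRadius S C} := by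
    refine ⟨cRadius P C, ?_⟩
    rintro _ ⟨S, hS, -, -, rfl⟩
    exact csInf_le_csInf (gb_bdd S C) (gb_nonempty hP hC)
      fun ρ ⟨h, c, hc⟩ => ⟨h, c, hS.trans hc⟩
  have hs0 : 0 ≤ minkowskiAsymmetry C := gb_nonneg _ _
  have hr0 := gb_core_nonneg 1 P C
  set s := minkowskiAsymmetry C with hs
  set r := coreRadius 1 P C with hr
  have hε : ∀ ε : ℝ, 0 < ε →
      cRadius P C ≤ (1 + (s + ε)) * (d : ℝ) / ((d : ℝ) + 1) * (r + ε) := by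
    intro ε hε
    obtain ⟨c0, hc0⟩ := gb_exists (P := -C) (r := s + ε) hC.1.neg hC
      (by change s < s + ε; linarith)
    obtain ⟨c, hc⟩ := gb_key (P := P) (r := r + ε) hC (by linarith) (by linarith) c0 hc0 (by
      intro x hx y hy
      have hfin : ({x, y} : Set (EuclideanSpace ℝ (Fin d))).Finite := by simp
      apply gb_exists hfin.isCompact hC
      have : cRadius {x, y} C ≤ r :=
        le_csSup hbdd ⟨{x, y}, by simp [insert_subset_iff, hx, hy], hfin,
          Set.ncard_insert_le x {y} |>.trans (by simp), rfl⟩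
      linarith)
    exact gb_le (by positivity) c hc
  have ht : Filter.Tendsto (fun ε : ℝ => (1 + (s + ε)) * (d : ℝ) / ((d : ℝ) + 1) * (r + ε))
      (nhdsWithin 0 (Ioi 0)) (nhds ((1 + s) * (d : ℝ) / ((d : ℝ) + 1) * r)) := by
    have hcont : Continuous
        (fun ε : ℝ => (1 + (s + ε)) * (d : ℝ) / ((d : ℝ) + 1) * (r + ε)) := by fun_prop
    have := (hcont.tendsto 0).mono_left (nhdsWithin_le_nhds (s := Ioi 0))
    simpa using this
  exact ge_of_tendsto ht (by
    filter_upwards [self_mem_nhdsWithin] with ε h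
    exact hε ε h)

theorem gb_core_le {d : ℕ} {P C : Set (EuclideanSpace ℝ (Fin d))} {ρ : ℝ} (hρ : 0 ≤ ρ)
    (h : ∀ x ∈ P, ∀ y ∈ P, ∃ c : EuclideanSpace ℝ (Fin d), {x, y} ⊆ c +ᵥ ρ • C) :
    coreRadius 1 P C ≤ ρ := by
  apply Real.sSup_le _ hρ
  rintro _ ⟨S, hS, hfin, hcard, rfl⟩
  have hsub : S = ∅ ∨ ∃ x y, S = {x, y} := by
    rcases Nat.lt_or_ge S.ncard 2 with h2 | h2
    · have h1 : S.ncard ≤ 1 := by omega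
      rcases Set.ncard_le_one_iff_eq hfin |>.1 h1 with h | ⟨a, h⟩
      · exact Or.inl h
      · exact Or.inr ⟨a, a, by simp [h]⟩
    · obtain ⟨x, y, -, h⟩ := Set.ncard_eq_two.1 (le_antisymm hcard h2)
      exact Or.inr ⟨x, y, h⟩
  rcases hsub with rfl | ⟨x, y, rfl⟩
  · exact gb_le hρ 0 (empty_subset _)
  · obtain ⟨c, hc⟩ := h x (hS (by simp)) y (hS (by simp))
    exact gb_le hρ c hc

theorem gb_simplex {d : ℕ} (v : Fin (d + 1) → EuclideanSpace ℝ (Fin d))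
    (hv : IsRegularSimplexCentered v) (T : Set (EuclideanSpace ℝ (Fin d)))
    (hT : T = convexHull ℝ (Set.range v)) :
    IsContainer T ∧ ∃ l : Fin (d + 1) → (EuclideanSpace ℝ (Fin d) →ₗ[ℝ] ℝ),
      (∀ x, ∑ i, l i x = 0) ∧ (∀ i, l i (v i) = d / (d + 1)) ∧
      (∀ x ∈ T, ∀ i, -(1 / ((d : ℝ) + 1)) ≤ l i x ∧ l i x ≤ d / (d + 1)) := by
  obtain ⟨hind, -, hsum⟩ := hv
  have htop : affineSpan ℝ (range v) = ⊤ :=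
    hind.affineSpan_eq_top_iff_card_eq_finrank_add_one.2 (by simp)
  let b : AffineBasis (Fin (d + 1)) ℝ (EuclideanSpace ℝ (Fin d)) := ⟨v, hind, htop⟩
  have hb : ⇑b = v := rfl
  have hcen : Finset.univ.centroid ℝ b = 0 := by
    rw [Finset.centroid_eq_centerMass _ Finset.univ_nonempty,
      Finset.centerMass]
    simp only [Finset.centroidWeights_apply, ← Finset.smul_sum, hb, hsum, smul_zero]
  have hc0 : ∀ i, b.coord i 0 = 1 / ((d : ℝ) + 1) := by
    intro i
    rw [← hcen, b.coord_apply_centroid (Finset.mem_univ i)]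
    simp
  have hlin : ∀ i x, (b.coord i).linear x = b.coord i x - 1 / ((d : ℝ) + 1) := by
    intro i x
    have := (b.coord i).linearMap_vsub x 0
    rw [hc0] at this
    simpa using this
  have hd : ((d : ℝ) + 1) ≠ 0 := by positivity
  refine ⟨⟨?_, ?_, ?_⟩, fun i => (b.coord i).linear, ?_, ?_, ?_⟩
  · rw [hT]
    exact (Set.finite_range v).isCompact_convexHull ℝ
  · rw [hT]; exact convex_convexHull ℝ _
  · rw [hT, ← hb, ← hcen]
    exact b.centroid_mem_interior_convexHull
  · intro x
    simp only [hlin, Finset.sum_sub_distrib, b.sum_coord_apply_eq_one]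
    simp
    field_simp
    simp
  · intro i
    rw [hlin, ← hb, b.coord_apply_eq]
    field_simp
    ring
  · intro x hx i
    rw [hT, ← hb, b.convexHull_eq_nonneg_coord] at hx
    rw [hlin]
    have h1 : b.coord i x ≤ 1 := by
      rw [← b.sum_coord_apply_eq_one x]
      exact Finset.single_le_sum (f := fun i => b.coord i x) (fun j _ => hx j) (Finset.mem_univ i)
    have h2 : (d : ℝ) / (d + 1) = 1 - 1 / (d + 1) := by field_simp; ring
    constructor
    · linarith [hx i]
    · rw [h2]; linarith

theorem gb_neg_container {d : ℕ} {C : Set (EuclideanSpace ℝ (Fin d))} (hC : IsContainer C) :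
    IsContainer (-C) := by
  refine ⟨hC.1.neg, hC.2.1.neg, ?_⟩
  rw [mem_interior_iff_mem_nhds]
  have := neg_mem_nhds_zero _ (mem_interior_iff_mem_nhds.1 hC.2.2)
  exact this

theorem gb_diff_container {d : ℕ} {C : Set (EuclideanSpace ℝ (Fin d))} (hC : IsContainer C) :
    IsContainer (C + -C) := by
  refine ⟨hC.1.add hC.1.neg, hC.2.1.add hC.2.1.neg, ?_⟩
  refine interior_mono ?_ hC.2.2
  intro x hx
  exact ⟨x, hx, 0, by simpa using interior_subset hC.2.2, by simp⟩

theorem gb_eq1 {d : ℕ} (v : Fin (d + 1) → EuclideanSpace ℝ (Fin d))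
    (hv : IsRegularSimplexCentered v) (T : Set (EuclideanSpace ℝ (Fin d)))
    (hT : T = convexHull ℝ (Set.range v)) :
    cRadius T (-T) =
        ((1 + minkowskiAsymmetry (-T)) * (d : ℝ) / ((d : ℝ) + 1)) * coreRadius 1 T (-T) := by
  classical
  obtain ⟨hc, l, hl0, hlv, hl⟩ := gb_simplex v hv T hT
  have hvT : ∀ i, v i ∈ T := fun i => by rw [hT]; exact subset_convexHull ℝ _ ⟨i, rfl⟩
  have hC := gb_neg_container hc
  refine le_antisymm (gb_main hc.1 hC) ?_
  have h1 : coreRadius 1 T (-T) ≤ 1 := by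
    apply gb_core_le zero_le_one
    intro x hx y hy
    refine ⟨x + y, ?_⟩
    rw [one_smul]
    rintro w (rfl | rfl)
    · exact ⟨-y, by simpa using hy, by simp⟩
    · exact ⟨-x, by simpa using hx, by simp⟩
  have h2 : minkowskiAsymmetry (-T) ≤ d := by
    refine gb_le (by positivity) 0 ?_
    rw [zero_vadd, neg_neg]
    conv_lhs => rw [hT]
    refine convexHull_min ?_ (hC.2.1.smul _)
    rintro _ ⟨i, rfl⟩
    obtain ⟨m, hm, em⟩ := gb_mean hC.2.1 (interior_subset hC.2.2) (Finset.univ.erase i)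
      (fun j => - v j) (fun j _ => by simpa using hvT j)
    refine ⟨m, hm, ?_⟩
    have h3 := Finset.add_sum_erase Finset.univ v (Finset.mem_univ i)
    rw [hv.2.2] at h3
    simp only [Finset.sum_neg_distrib, Finset.card_erase_of_mem (Finset.mem_univ i),
      Finset.card_univ, Fintype.card_fin, Nat.add_sub_cancel] at em
    change (d : ℝ) • m = v i
    rw [← em]
    exact (eq_neg_of_add_eq_zero_left h3).symm
  have h3 : (d : ℝ) ≤ cRadius T (-T) := by
    refine le_csInf (gb_nonempty hc.1 hC) ?_
    rintro ρ ⟨hρ, c, hcT⟩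
    have hi : ∀ i, (d : ℝ) / (d + 1) ≤ l i c + ρ * (1 / (d + 1)) := by
      intro i
      obtain ⟨z, hz, e⟩ := gb_mem_iff.1 (hcT (hvT i))
      have := (hl (-z) hz i).1
      rw [map_neg, neg_le_neg_iff] at this
      rw [← hlv i, e, map_add, map_smul, smul_eq_mul]
      gcongr
    have := Finset.sum_le_sum (fun i (_ : i ∈ Finset.univ) => hi i)
    rw [Finset.sum_add_distrib, hl0] at this
    simp only [Finset.sum_const, Finset.card_univ, Fintype.card_fin, nsmul_eq_mul] at this
    push_cast at this
    field_simp at this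
    linarith
  refine le_trans ?_ h3
  have h4 := gb_core_nonneg 1 T (-T)
  calc _ ≤ (1 + (d : ℝ)) * d / (d + 1) * 1 := by gcongr
    _ = d := by field_simp; ring

theorem gb_eq2 {d : ℕ} (v : Fin (d + 1) → EuclideanSpace ℝ (Fin d))
    (hv : IsRegularSimplexCentered v) (T : Set (EuclideanSpace ℝ (Fin d)))
    (hT : T = convexHull ℝ (Set.range v)) :
    cRadius T (T + (-T)) =
        ((1 + minkowskiAsymmetry (T + (-T))) * (d : ℝ) / ((d : ℝ) + 1)) *
          coreRadius 1 T (T + (-T)) := by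
  classical
  obtain ⟨hc, l, hl0, hlv, hl⟩ := gb_simplex v hv T hT
  have hvT : ∀ i, v i ∈ T := fun i => by rw [hT]; exact subset_convexHull ℝ _ ⟨i, rfl⟩
  have hC := gb_diff_container hc
  refine le_antisymm (gb_main hc.1 hC) ?_
  have h1 : coreRadius 1 T (T + -T) ≤ 1 / 2 := by
    apply gb_core_le (by norm_num)
    intro x hx y hy
    refine ⟨(1 / 2 : ℝ) • (x + y), ?_⟩
    rintro w (rfl | rfl)
    · exact gb_mem_iff.2 ⟨w + -y, ⟨w, hx, -y, by simpa using hy, rfl⟩, by module⟩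
    · exact gb_mem_iff.2 ⟨w + -x, ⟨w, hy, -x, by simpa using hx, rfl⟩, by module⟩
  have h2 : minkowskiAsymmetry (T + -T) ≤ 1 := by
    refine gb_le zero_le_one 0 ?_
    rw [zero_vadd, one_smul, neg_add, neg_neg, add_comm]
  have h3 : (d : ℝ) / (d + 1) ≤ cRadius T (T + -T) := by
    refine le_csInf (gb_nonempty hc.1 hC) ?_
    rintro ρ ⟨hρ, c, hcT⟩
    have hi : ∀ i, (d : ℝ) / (d + 1) ≤ l i c + ρ := by
      intro i
      obtain ⟨z, ⟨t, ht, u, hu, rfl⟩, e⟩ := gb_mem_iff.1 (hcT (hvT i))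
      have a1 := (hl (-u) hu i).1
      have a2 := (hl t ht i).2
      rw [map_neg, neg_le_neg_iff] at a1
      have a3 : (d : ℝ) / (d + 1) + 1 / (d + 1) = 1 := by field_simp
      have a4 : l i (t + u) ≤ 1 := by rw [map_add]; linarith
      rw [← hlv i, e, map_add, map_smul, smul_eq_mul]
      have := mul_le_mul_of_nonneg_left a4 hρ
      simp only at this ⊢
      linarith
    have := Finset.sum_le_sum (fun i (_ : i ∈ Finset.univ) => hi i)
    rw [Finset.sum_add_distrib, hl0] at this
    simp only [Finset.sum_const, Finset.card_univ, Fintype.card_fin, nsmul_eq_mul] at this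
    push_cast at this
    rw [zero_add] at this
    exact le_of_mul_le_mul_left this (by positivity)
  refine le_trans ?_ h3
  have h4 := gb_core_nonneg 1 T (T + -T)
  calc _ ≤ (1 + (1 : ℝ)) * d / (d + 1) * (1 / 2) := by gcongr
    _ = d / (d + 1) := by ring

theorem generalized_bohnenblust {d : ℕ} :
    (∀ P C : Set (EuclideanSpace ℝ (Fin d)), P.Nonempty → IsCompact P → Convex ℝ P →
      IsContainer C →
      cRadius P C ≤ ((1 + minkowskiAsymmetry C) * (d : ℝ) / ((d : ℝ) + 1)) * coreRadius 1 P C) ∧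
    (∀ (v : Fin (d + 1) → EuclideanSpace ℝ (Fin d)), IsRegularSimplexCentered v →
      ∀ T : Set (EuclideanSpace ℝ (Fin d)), T = convexHull ℝ (Set.range v) →
      (cRadius T (-T) =
        ((1 + minkowskiAsymmetry (-T)) * (d : ℝ) / ((d : ℝ) + 1)) * coreRadius 1 T (-T)) ∧
      (cRadius T (T + (-T)) =
        ((1 + minkowskiAsymmetry (T + (-T))) * (d : ℝ) / ((d : ℝ) + 1)) *
          coreRadius 1 T (T + (-T)))) := by
  exact ⟨fun P C _ hP _ hC => gb_main hP hC, fun v hv T hT => ⟨gb_eq1 v hv T hT, gb_eq2 v hv T hT⟩⟩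
end

section
/- Let T^d be a regular d-simplex in ℝ^d with centroid at the origin and let C^d = T^d ∩ (−T^d). Then for every k with 1 ≤ k ≤ d, R_k(T^d, C^d) = (d+1)/2 if k ≤ (d+1)/2, and R_k(T^d, C^d) = k if k ≥ (d+1)/2. -/
open Set Pointwise

lemma exists_between_sum {n : ℕ} (L U : Fin n → ℝ) (h : ∀ i, L i ≤ U i)
    (hL : ∑ i, L i ≤ 1) (hU : 1 ≤ ∑ i, U i) :
    ∃ c : Fin n → ℝ, (∀ i, L i ≤ c i ∧ c i ≤ U i) ∧ ∑ i, c i = 1 := by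
  by_cases he : ∑ i, U i = ∑ i, L i
  · exact ⟨L, fun i => ⟨le_rfl, h i⟩, by linarith⟩
  · have hpos : 0 < ∑ i, U i - ∑ i, L i := by
      rcases lt_or_eq_of_le (hL.trans hU) with h' | h'
      · linarith
      · exact absurd h'.symm he
    obtain ⟨t, ht⟩ : ∃ t, t = (1 - ∑ i, L i) / (∑ i, U i - ∑ i, L i) := ⟨_, rfl⟩
    have ht0 : 0 ≤ t := by rw [ht]; exact div_nonneg (by linarith) hpos.le
    have ht1 : t ≤ 1 := by rw [ht, div_le_one hpos]; linarith
    refine ⟨fun i => L i + t * (U i - L i), fun i => ⟨?_, ?_⟩, ?_⟩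
    · nlinarith [mul_nonneg ht0 (sub_nonneg.2 (h i))]
    · nlinarith [mul_nonneg (sub_nonneg.2 ht1) (sub_nonneg.2 (h i))]
    · rw [Finset.sum_add_distrib, ← Finset.mul_sum, Finset.sum_sub_distrib, ht,
        div_mul_cancel₀ _ hpos.ne']
      ring

/-- Linear functionals describing the simplex and its barycentric coordinates. -/
lemma exists_functionals {d : ℕ}
    (v : Fin (d + 1) → EuclideanSpace ℝ (Fin d)) (hv : IsRegularSimplexCentered v) :
    ∃ a : Fin (d + 1) → (EuclideanSpace ℝ (Fin d) →ₗ[ℝ] ℝ),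
      (∀ x, x ∈ convexHull ℝ (Set.range v) ↔ ∀ i, -(1 / ((d : ℝ) + 1)) ≤ a i x) ∧
      (∀ x, ∑ i, a i x = 0) ∧
      (∀ i j, a i (v j) = (if i = j then 1 else 0) - 1 / ((d : ℝ) + 1)) := by
  obtain ⟨hai, -, hsum⟩ := hv
  have htop : affineSpan ℝ (Set.range v) = ⊤ := by
    rw [hai.affineSpan_eq_top_iff_card_eq_finrank_add_one]
    simp
  let b : AffineBasis (Fin (d + 1)) ℝ (EuclideanSpace ℝ (Fin d)) := ⟨v, hai, htop⟩
  have hb : ∀ j, b j = v j := fun j => rfl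
  have hn : ((d : ℝ) + 1) ≠ 0 := by positivity
  have hdec : ∀ i x, b.coord i x = (b.coord i).linear x + b.coord i 0 := fun i x => by
    conv_lhs => rw [AffineMap.decomp (b.coord i)]
    simp
  have h0 : ∀ i, b.coord i 0 = 1 / ((d : ℝ) + 1) := fun i => by
    have h1 : ∑ j, b.coord i (v j) = 1 := by
      simp_rw [← hb, AffineBasis.coord_apply]
      simp
    simp_rw [hdec i (v _)] at h1
    rw [Finset.sum_add_distrib, ← map_sum, hsum] at h1
    simp at h1
    field_simp
    linarith
  refine ⟨fun i => (b.coord i).linear, fun x => ?_, fun x => ?_, fun i j => ?_⟩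
  · have := b.convexHull_eq_nonneg_coord
    have hr : Set.range b = Set.range v := rfl
    rw [hr] at this
    rw [this]
    simp only [Set.mem_ofPred_eq]
    refine forall_congr' fun i => ?_
    rw [hdec, h0]
    constructor <;> intro h <;> linarith
  · have h1 := b.sum_coord_apply_eq_one x
    simp_rw [hdec _ x, h0] at h1
    rw [Finset.sum_add_distrib] at h1
    have h2 : ∑ _i : Fin (d + 1), 1 / ((d : ℝ) + 1) = 1 := by
      rw [Finset.sum_const, Finset.card_univ, Fintype.card_fin, nsmul_eq_mul]
      push_cast
      field_simp
    rw [h2] at h1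
    show ∑ i, (b.coord i).linear x = 0
    linarith
  · have := hdec i (v j)
    rw [h0, ← hb, AffineBasis.coord_apply] at this
    show (b.coord i).linear (b j) = _
    linarith

theorem coreRadius_eq_max {d : ℕ}
    (v : Fin (d + 1) → EuclideanSpace ℝ (Fin d)) (hv : IsRegularSimplexCentered v)
    (T : Set (EuclideanSpace ℝ (Fin d))) (hT : T = convexHull ℝ (Set.range v))
    (k : ℕ) (hk₁ : 1 ≤ k) (hk₂ : k ≤ d) :
    coreRadius k T (T ∩ (-T)) = max (((d : ℝ) + 1) / 2) (k : ℝ) := by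
  obtain ⟨a, haT, hsum, hav⟩ := exists_functionals v hv
  rw [← hT] at haT
  obtain ⟨ρ, hρ⟩ : ∃ ρ, ρ = max (((d : ℝ) + 1) / 2) (k : ℝ) := ⟨_, rfl⟩
  rw [← hρ]
  have hρ1 : ((d : ℝ) + 1) / 2 ≤ ρ := hρ ▸ le_max_left _ _
  have hρ2 : (k : ℝ) ≤ ρ := hρ ▸ le_max_right _ _
  have hk1 : (1 : ℝ) ≤ k := by exact_mod_cast hk₁
  have hρ0 : 0 < ρ := by linarith
  have hn : 0 < ((d : ℝ) + 1) := by positivity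
  obtain ⟨e, he⟩ : ∃ e, e = 1 / ((d : ℝ) + 1) := ⟨_, rfl⟩
  rw [← he] at haT hav
  have hen : ((d : ℝ) + 1) * e = 1 := by rw [he]; field_simp
  have he0 : 0 < e := by rw [he]; positivity
  have hρe : 1 ≤ 2 * (ρ * e) := by nlinarith
  have hC : ∀ x, x ∈ T ∩ (-T) ↔ ∀ i, |a i x| ≤ e := fun x => by
    simp only [Set.mem_inter_iff, Set.mem_neg, haT, map_neg, abs_le]
    constructor
    · rintro ⟨h1, h2⟩ i
      exact ⟨h1 i, by linarith [h2 i]⟩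
    · intro h
      exact ⟨fun i => (h i).1, fun i => by linarith [(h i).2]⟩
  -- upper bound
  have upper : ∀ S : Set (EuclideanSpace ℝ (Fin d)), S ⊆ T → S.Finite → S.ncard ≤ k + 1 →
      ∃ c : EuclideanSpace ℝ (Fin d), S ⊆ c +ᵥ ρ • (T ∩ (-T)) := by
    intro S hST hSf hcard
    have hnn : ∀ s ∈ S, ∀ i, 0 ≤ a i s + e := fun s hs i => by
      linarith [(haT s).1 (hST hs) i]
    have hsum1 : ∀ s, ∑ i, (a i s + e) = 1 := fun s => by
      rw [Finset.sum_add_distrib, hsum]; simp [hen]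
    obtain ⟨M, hM⟩ : ∃ M : Fin (d + 1) → ℝ,
      M = fun i => min 1 (∑ s ∈ hSf.toFinset, (a i s + e)) := ⟨_, rfl⟩
    have hMs : ∀ s ∈ S, ∀ i, a i s + e ≤ M i := fun s hs i => by
      rw [hM]
      refine le_min ?_ ?_
      · rw [← hsum1 s]
        exact Finset.single_le_sum (f := fun i => a i s + e) (fun j _ => hnn s hs j)
          (Finset.mem_univ i)
      · exact Finset.single_le_sum (f := fun s => a i s + e)
          (fun t ht => hnn t (hSf.mem_toFinset.1 ht) i) (hSf.mem_toFinset.2 hs)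
    have hM1 : ∀ i, M i ≤ 1 := fun i => by rw [hM]; exact min_le_left _ _
    have hMsum : ∑ i, M i ≤ k + 1 := by
      calc ∑ i, M i ≤ ∑ i, ∑ s ∈ hSf.toFinset, (a i s + e) :=
            Finset.sum_le_sum fun i _ => by rw [hM]; exact min_le_right _ _
        _ = ∑ s ∈ hSf.toFinset, (1 : ℝ) := by
            rw [Finset.sum_comm]; exact Finset.sum_congr rfl fun s _ => hsum1 s
        _ = (S.ncard : ℝ) := by simp [Set.ncard_eq_toFinset_card S hSf]
        _ ≤ k + 1 := by exact_mod_cast hcard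
    have hconst : ∑ _i : Fin (d + 1), ρ * e = ρ := by
      simp; linear_combination ρ * hen
    obtain ⟨c, hc, hc1⟩ := exists_between_sum (fun i => M i - ρ * e) (fun _ => ρ * e)
      (fun i => by linarith [hM1 i])
      (by rw [Finset.sum_sub_distrib, hconst]; linarith) (by rw [hconst]; linarith)
    obtain ⟨x, hx⟩ : ∃ x, x = ∑ j, c j • v j := ⟨_, rfl⟩
    have hax : ∀ i, a i x = c i - e := fun i => by
      rw [hx, map_sum]
      simp only [map_smul, hav, smul_eq_mul, mul_sub, Finset.sum_sub_distrib, ← Finset.sum_mul, hc1]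
      simp
    refine ⟨x, fun s hs => ?_⟩
    refine Set.mem_vadd_set.2 ⟨s - x, ?_, by simp⟩
    rw [Set.mem_smul_set_iff_inv_smul_mem₀ hρ0.ne', hC]
    intro i
    rw [map_smul, map_sub, hax, smul_eq_mul, abs_mul, abs_of_pos (inv_pos.2 hρ0),
      inv_mul_le_iff₀ hρ0, abs_le]
    have h1 := hc i
    have h2 := hnn s hs i
    have h3 := hMs s hs i
    constructor <;> linarith [h1.1, h1.2]
  have bdd : ∀ S : Set (EuclideanSpace ℝ (Fin d)),
      BddBelow {ρ : ℝ | 0 ≤ ρ ∧ ∃ c : EuclideanSpace ℝ (Fin d), S ⊆ c +ᵥ ρ • (T ∩ (-T))} :=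
    fun S => ⟨0, fun r hr => hr.1⟩
  -- lower bound
  let S₀ : Set (EuclideanSpace ℝ (Fin d)) :=
    Set.range fun j : Fin (k + 1) => v (Fin.castLE (by omega) j)
  have hS₀T : S₀ ⊆ T := by
    rintro _ ⟨j, rfl⟩
    rw [hT]
    exact subset_convexHull ℝ _ ⟨_, rfl⟩
  have hS₀f : S₀.Finite := Set.finite_range _
  have hS₀c : S₀.ncard ≤ k + 1 := by
    have : S₀ = (fun j : Fin (k + 1) => v (Fin.castLE (by omega) j)) '' Set.univ :=
      Set.image_univ.symm
    rw [this]
    refine (Set.ncard_image_le Set.finite_univ).trans ?_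
    simp [Set.ncard_univ]
  have hmem : ∀ j : Fin (d + 1), j.val ≤ k → v j ∈ S₀ := fun j hj =>
    ⟨⟨j.val, by omega⟩, rfl⟩
  have lower : ρ ≤ cRadius S₀ (T ∩ (-T)) := by
    refine le_csInf ⟨ρ, hρ0.le, upper S₀ hS₀T hS₀f hS₀c⟩ ?_
    rintro r ⟨hr0, c, hc⟩
    have key : ∀ s ∈ S₀, ∀ i, |a i s - a i c| ≤ r * e := by
      intro s hs i
      obtain ⟨y, hy, rfl⟩ := Set.mem_vadd_set.1 (hc hs)
      obtain ⟨z, hz, rfl⟩ := Set.mem_smul_set.1 hy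
      simp only [vadd_eq_add, map_add, map_smul, smul_eq_mul, add_sub_cancel_left, abs_mul,
        abs_of_nonneg hr0]
      exact mul_le_mul_of_nonneg_left ((hC z).1 hz i) hr0
    rw [hρ]
    refine max_le ?_ ?_
    · have h0 := abs_le.1 (key (v ⟨0, by omega⟩) (hmem _ (by simp)) ⟨0, by omega⟩)
      have h1 := abs_le.1 (key (v ⟨1, by omega⟩) (hmem _ (by simpa using hk₁)) ⟨0, by omega⟩)
      rw [hav] at h0 h1
      simp at h0 h1
      have : 1 ≤ 2 * (r * e) := by linarith [h0.2, h1.1]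
      nlinarith [mul_le_mul_of_nonneg_left this hn.le]
    · have hi : ∀ i : Fin (d + 1), (if i.val ≤ k then (1 : ℝ) else 0) - e - a i c ≤ r * e := by
        intro i
        by_cases h : i.val ≤ k
        · have := (abs_le.1 (key (v i) (hmem i h) i)).2
          rw [hav] at this
          simpa [h] using this
        · have := (abs_le.1 (key (v ⟨0, by omega⟩) (hmem _ (by simp)) i)).2
          rw [hav, if_neg (by intro h'; rw [h'] at h; simp at h)] at this
          simpa [h] using this
      have hs := Finset.sum_le_sum (s := Finset.univ) fun i _ => hi i
      rw [Finset.sum_sub_distrib, Finset.sum_sub_distrib, hsum] at hs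
      have hcount : ∑ i : Fin (d + 1), (if i.val ≤ k then (1 : ℝ) else 0) = k + 1 := by
        rw [Fin.sum_univ_eq_sum_range (fun i => if i ≤ k then (1 : ℝ) else 0) (d + 1),
          Finset.sum_boole]
        have : (Finset.range (d + 1)).filter (fun i => i ≤ k) = Finset.range (k + 1) := by
          ext i; simp; omega
        rw [this]; simp
      rw [hcount] at hs
      simp at hs
      nlinarith
  have le : ∀ S : Set (EuclideanSpace ℝ (Fin d)), S ⊆ T → S.Finite → S.ncard ≤ k + 1 →
      cRadius S (T ∩ (-T)) ≤ ρ := fun S h1 h2 h3 =>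
    csInf_le (bdd S) ⟨hρ0.le, upper S h1 h2 h3⟩
  refine le_antisymm (csSup_le ⟨_, S₀, hS₀T, hS₀f, hS₀c, rfl⟩ ?_) (lower.trans ?_)
  · rintro r ⟨S, h1, h2, h3, rfl⟩
    exact le S h1 h2 h3
  · refine le_csSup ⟨ρ, ?_⟩ ⟨S₀, hS₀T, hS₀f, hS₀c, rfl⟩
    rintro r ⟨S, h1, h2, h3, rfl⟩
    exact le S h1 h2 h3

theorem coreRadii_simplex_inter_negSimplex {d : ℕ}
    (v : Fin (d + 1) → EuclideanSpace ℝ (Fin d)) (hv : IsRegularSimplexCentered v)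
    (T : Set (EuclideanSpace ℝ (Fin d))) (hT : T = convexHull ℝ (Set.range v))
    (k : ℕ) (hk₁ : 1 ≤ k) (hk₂ : k ≤ d) :
    ((k : ℝ) ≤ ((d : ℝ) + 1) / 2 → coreRadius k T (T ∩ (-T)) = ((d : ℝ) + 1) / 2) ∧
    (((d : ℝ) + 1) / 2 ≤ (k : ℝ) → coreRadius k T (T ∩ (-T)) = (k : ℝ)) := by
  rw [coreRadius_eq_max v hv T hT k hk₁ hk₂]
  exact ⟨fun h => max_eq_left h, fun h => max_eq_right h⟩
end
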